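/- There exist positive constants c1 and c2 such that for every n divisible by 4, the two-cycle chain with golden-ratio laziness satisfies c1·n^{3/2} ≤ t_mix ≤ t_unif ≤ c2·n^{3/2}, where t_mix and t_unif are computed with respect to its unique stationary distribution π. -/

import Mathlib

open Finset

/-- The state space of the two-cycle chain: a common vertex `o` (the `Sum.inl` state) together
with two cycles indexed by `Fin 2`; `Sum.inr (i, j)` is position `j+1 ∈ {1,…,n−1}` on cycle
`i` (cycle `1` of the paper is `i = 0`, the "left" cycle). -/
abbrev TwoCycleState (n : ℕ) := Unit ⊕ (Fin 2 × Fin (n - 1))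

/-- The golden-ratio laziness parameter `α = 2/(√5+1)`. -/
noncomputable def goldenAlpha : ℝ := 2 / (Real.sqrt 5 + 1)

/-- The holding probability: `α` at states of the left cycle whose position `j` satisfies
`n/4 ≤ j ≤ 3n/4`, and `1/2` everywhere else (including at `o`). -/
noncomputable def tcHold (n : ℕ) : TwoCycleState n → ℝ
  | Sum.inl _ => 1 / 2
  | Sum.inr (i, j) =>
      if i = 0 ∧ n / 4 ≤ (j : ℕ) + 1 ∧ (j : ℕ) + 1 ≤ 3 * n / 4 then goldenAlpha else 1 / 2

/-- The conditional move distribution of the two-cycle chain: given that the chain moves, it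
goes clockwise (position `+1`) with probability `2/3` and counter-clockwise (position `−1`)
with probability `1/3`; from `o` it additionally picks one of the two cycles uniformly. -/
noncomputable def tcStep (n : ℕ) : TwoCycleState n → TwoCycleState n → ℝ
  | Sum.inl _, Sum.inl _ => 0
  | Sum.inl _, Sum.inr (_, j) =>
      (if (j : ℕ) = 0 then 1 / 3 else 0) + (if (j : ℕ) + 2 = n then 1 / 6 else 0)
  | Sum.inr (_, j), Sum.inl _ =>
      (if (j : ℕ) + 2 = n then 2 / 3 else 0) + (if (j : ℕ) = 0 then 1 / 3 else 0)
  | Sum.inr (i, j), Sum.inr (i', j') =>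
      if i = i' then
        (if (j' : ℕ) = (j : ℕ) + 1 then 2 / 3 else 0) +
          (if (j' : ℕ) + 1 = (j : ℕ) then 1 / 3 else 0)
      else 0

/-- The transition matrix of the two-cycle chain with golden-ratio laziness: stay in place with
the holding probability, and otherwise move according to `tcStep`. -/
noncomputable def tcP (n : ℕ) : Matrix (TwoCycleState n) (TwoCycleState n) ℝ :=
  fun x y => (if x = y then tcHold n x else 0) + (1 - tcHold n x) * tcStep n x y

namespace TwoCycle

section Chain

variable {V : Type*} [Fintype V] [DecidableEq V]

/-- `surv P o t x` is the probability that the chain `P` started at `x` does not visit `o` at any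
of the times `1, …, t`. -/
noncomputable def surv (P : Matrix V V ℝ) (o : V) : ℕ → V → ℝ
  | 0 => fun _ => 1
  | t + 1 => fun x => ∑ y, P x y * (if y = o then 0 else surv P o t y)

variable {P : Matrix V V ℝ} {o : V}

lemma surv_nonneg (h0 : ∀ x y, 0 ≤ P x y) (t : ℕ) (x : V) : 0 ≤ surv P o t x := by
  induction t generalizing x with
  | zero => simp [surv]
  | succ t ih =>
    refine Finset.sum_nonneg fun y _ => mul_nonneg (h0 x y) ?_
    split_ifs
    · exact le_rfl
    · exact ih y

lemma surv_succ_le (h0 : ∀ x y, 0 ≤ P x y) (h1 : ∀ x, ∑ y, P x y = 1) (t : ℕ) (x : V) :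
    surv P o (t + 1) x ≤ surv P o t x := by
  induction t generalizing x with
  | zero =>
    refine le_of_le_of_eq (Finset.sum_le_sum fun y _ => ?_) (h1 x)
    have := h0 x y
    split_ifs <;> simp [surv, this]
  | succ t ih =>
    refine Finset.sum_le_sum fun y _ => mul_le_mul_of_nonneg_left ?_ (h0 x y)
    split_ifs
    · exact le_rfl
    · exact ih y

lemma surv_le_of_superharmonic (h0 : ∀ x y, 0 ≤ P x y) {H : V → ℝ} {r : ℝ} (hr : 0 ≤ r)
    (hH : ∀ x, 1 ≤ H x) (hs : ∀ x, ∑ y, P x y * (if y = o then 0 else H y) ≤ r * H x)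
    (t : ℕ) (x : V) : surv P o t x ≤ r ^ t * H x := by
  induction t generalizing x with
  | zero => simpa [surv] using hH x
  | succ t ih =>
    calc surv P o (t + 1) x
        ≤ ∑ y, P x y * (if y = o then 0 else r ^ t * H y) := by
          refine Finset.sum_le_sum fun y _ => mul_le_mul_of_nonneg_left ?_ (h0 x y)
          split_ifs
          · exact le_rfl
          · exact ih y
      _ = r ^ t * ∑ y, P x y * (if y = o then 0 else H y) := by
          rw [Finset.mul_sum]
          refine Finset.sum_congr rfl fun y _ => ?_
          split_ifs <;> ring
      _ ≤ r ^ t * (r * H x) := mul_le_mul_of_nonneg_left (hs x) (pow_nonneg hr t)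
      _ = r ^ (t + 1) * H x := by ring

lemma pow_entry_nonneg (h0 : ∀ x y, 0 ≤ P x y) (t : ℕ) (x y : V) : 0 ≤ (P ^ t) x y := by
  induction t generalizing x with
  | zero => simp only [pow_zero, Matrix.one_apply]; split_ifs <;> norm_num
  | succ t ih =>
    rw [pow_succ', Matrix.mul_apply]
    exact Finset.sum_nonneg fun z _ => mul_nonneg (h0 x z) (ih z)

lemma pow_row_sum (h1 : ∀ x, ∑ y, P x y = 1) (t : ℕ) (x : V) : ∑ y, (P ^ t) x y = 1 := by
  induction t generalizing x with
  | zero => simp [Matrix.one_apply]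
  | succ t ih =>
    simp only [pow_succ', Matrix.mul_apply]
    rw [Finset.sum_comm]
    simp [← Finset.mul_sum, ih, h1]

lemma pow_succ_apply (t : ℕ) (x y : V) : (P ^ (t + 1)) x y = ∑ z, P x z * (P ^ t) z y := by
  rw [pow_succ', Matrix.mul_apply]

/-- Decomposition of the trajectory up to time `t` at its last visit to `o`. -/
lemma last_exit (h1 : ∀ x, ∑ y, P x y = 1) (t : ℕ) (x : V) :
    ∑ s ∈ Finset.range (t + 1), (P ^ s) x o * surv P o (t - s) o
      + (if x = o then 0 else surv P o t x) = 1 := by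
  induction t generalizing x with
  | zero =>
    by_cases h : x = o <;> simp [surv, h]
  | succ t ih =>
    have key : ∑ s ∈ Finset.range (t + 1), (P ^ (s + 1)) x o * surv P o (t - s) o
        = 1 - surv P o (t + 1) x := by
      have : ∀ s, (P ^ (s + 1)) x o * surv P o (t - s) o
          = ∑ y, P x y * ((P ^ s) y o * surv P o (t - s) o) := fun s => by
        rw [pow_succ_apply, Finset.sum_mul]
        exact Finset.sum_congr rfl fun y _ => by ring
      simp only [this]
      rw [Finset.sum_comm]
      simp only [← Finset.mul_sum]
      have h2 : ∀ y, ∑ s ∈ Finset.range (t + 1), (P ^ s) y o * surv P o (t - s) o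
          = 1 - (if y = o then 0 else surv P o t y) := fun y => by linarith [ih y]
      simp only [h2, mul_sub, Finset.sum_sub_distrib, mul_one, h1]
      rfl
    rw [Finset.sum_range_succ']
    simp only [Nat.add_sub_add_right, key]
    by_cases h : x = o
    · simp [h]
    · simp [h]

lemma convolution_surv (h1 : ∀ x, ∑ y, P x y = 1) (t : ℕ) {x : V} (hx : x ≠ o) :
    ∑ s ∈ Finset.range (t + 1), ((P ^ s) o o - (P ^ s) x o) * surv P o (t - s) o
      = surv P o t x := by
  have hxo := last_exit (P := P) (o := o) h1 t x
  have hoo := last_exit (P := P) (o := o) h1 t o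
  simp only [hx, if_false] at hxo
  simp only [if_true, add_zero] at hoo
  simp only [sub_mul, Finset.sum_sub_distrib]
  linarith

lemma le_mul_surv_of_subharmonic (h0 : ∀ x y, 0 ≤ P x y) {g : V → ℝ} {M : ℝ}
    (hM : ∀ x, g x ≤ M) (ho : g o = 0) (hs : ∀ x, x ≠ o → g x ≤ ∑ y, P x y * g y)
    (t : ℕ) {x : V} (hx : x ≠ o) : g x ≤ M * surv P o t x := by
  induction t generalizing x with
  | zero => simpa [surv] using hM x
  | succ t ih =>
    refine (hs x hx).trans ?_
    rw [surv, Finset.mul_sum]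
    refine Finset.sum_le_sum fun y _ => ?_
    by_cases h : y = o
    · simp [h, ho]
    · simp only [h, if_false]
      have := mul_le_mul_of_nonneg_left (ih h) (h0 x y)
      linarith

lemma subharmonic_nonpos (h0 : ∀ x y, 0 ≤ P x y) {g : V → ℝ} (ho : g o = 0)
    (hs : ∀ x, x ≠ o → g x ≤ ∑ y, P x y * g y)
    (hlim : ∀ x, Filter.Tendsto (fun t => surv P o t x) Filter.atTop (nhds 0)) (x : V) :
    g x ≤ 0 := by
  by_cases hx : x = o
  · simp [hx, ho]
  have hM : ∀ y, g y ≤ ∑ z, |g z| := fun y =>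
    (le_abs_self _).trans (Finset.single_le_sum (f := fun z => |g z|) (fun z _ => abs_nonneg _)
      (Finset.mem_univ y))
  have := (hlim x).const_mul (∑ z, |g z|)
  rw [mul_zero] at this
  exact ge_of_tendsto' this fun t => le_mul_surv_of_subharmonic h0 hM ho hs t hx

/-- If `P ^ s` is close to `π` when started at `o`, it is close to `π` from every state, up to the
probability of not having visited `o`. -/
lemma abs_pow_sub_le (h0 : ∀ x y, 0 ≤ P x y) (h1 : ∀ x, ∑ y, P x y = 1) {b ε : ℝ} {y : V}
    {t₀ : ℕ} (hε : 0 ≤ ε) (hb0 : 0 ≤ b) (hb1 : b ≤ 1)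
    (ho : ∀ s, t₀ ≤ s → |(P ^ s) o y - b| ≤ ε) (t : ℕ) (x : V) :
    |(P ^ (t₀ + t)) x y - b| ≤ ε + surv P o t x := by
  induction t generalizing x with
  | zero =>
    have h2 := pow_entry_nonneg h0 t₀ x y
    have h3 : (P ^ t₀) x y ≤ 1 := by
      rw [← pow_row_sum h1 t₀ x]
      exact Finset.single_le_sum (f := fun z => (P ^ t₀) x z)
        (fun z _ => pow_entry_nonneg h0 t₀ x z) (Finset.mem_univ y)
    simp only [surv, add_zero]
    rw [abs_le]; constructor <;> linarith
  | succ t ih =>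
    have e : (P ^ (t₀ + (t + 1))) x y - b = ∑ z, P x z * ((P ^ (t₀ + t)) z y - b) := by
      rw [← add_assoc, pow_succ_apply]
      simp [mul_sub, Finset.sum_sub_distrib, ← Finset.sum_mul, h1]
    rw [e]
    calc |∑ z, P x z * ((P ^ (t₀ + t)) z y - b)|
        ≤ ∑ z, |P x z * ((P ^ (t₀ + t)) z y - b)| := Finset.abs_sum_le_sum_abs _ _
      _ ≤ ∑ z, (P x z * ε + P x z * (if z = o then 0 else surv P o t z)) := by
          refine Finset.sum_le_sum fun z _ => ?_
          rw [abs_mul, abs_of_nonneg (h0 x z), ← mul_add]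
          refine mul_le_mul_of_nonneg_left ?_ (h0 x z)
          by_cases h : z = o
          · simpa [h] using ho (t₀ + t) (Nat.le_add_right _ _)
          · simpa [h] using ih z
      _ = ε + surv P o (t + 1) x := by
          rw [Finset.sum_add_distrib, ← Finset.sum_mul, h1, one_mul]; rfl

lemma pow_entry_le_one (h0 : ∀ x y, 0 ≤ P x y) (h1 : ∀ x, ∑ y, P x y = 1) (t : ℕ) (x y : V) :
    (P ^ t) x y ≤ 1 := by
  rw [← pow_row_sum h1 t x]
  exact Finset.single_le_sum (f := fun z => (P ^ t) x z)
    (fun z _ => pow_entry_nonneg h0 t x z) (Finset.mem_univ y)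

lemma exists_pow_entry_pos (h0 : ∀ x y, 0 ≤ P x y) (h1 : ∀ x, ∑ y, P x y = 1)
    (hoo : 1 / 2 ≤ P o o) {N : ℕ} (hN : ∀ x, surv P o N x ≤ 1 / 2) :
    ∃ ε : ℝ, 0 < ε ∧ ε ≤ 1 ∧ ∀ x, ε ≤ (P ^ N) x o := by
  have step : ∀ (x : V) (k s : ℕ), (P ^ s) x o ≤ 2 ^ k * (P ^ (s + k)) x o := by
    intro x k s
    induction k with
    | zero => simp
    | succ k ih =>
      have : (P ^ (s + k)) x o * P o o ≤ (P ^ (s + (k + 1))) x o := by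
        rw [← add_assoc, pow_succ, Matrix.mul_apply]
        exact Finset.single_le_sum (f := fun z => (P ^ (s + k)) x z * P z o)
          (fun z _ => mul_nonneg (pow_entry_nonneg h0 _ _ _) (h0 _ _)) (Finset.mem_univ o)
      have h3 := pow_entry_nonneg h0 (s + k) x o
      have h4 : (P ^ (s + k)) x o ≤ 2 * (P ^ (s + (k + 1))) x o := by nlinarith
      calc (P ^ s) x o ≤ 2 ^ k * (P ^ (s + k)) x o := ih
        _ ≤ 2 ^ k * (2 * (P ^ (s + (k + 1))) x o) := by gcongr
        _ = 2 ^ (k + 1) * (P ^ (s + (k + 1))) x o := by ring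
  have surv_le_one : ∀ t x, surv P o t x ≤ 1 := fun t x => by
    induction t with
    | zero => simp [surv]
    | succ t ih => exact (surv_succ_le h0 h1 t x).trans ih
  have bound : ∀ x, 1 / 2 ≤ ((N + 1 : ℕ) : ℝ) * (2 ^ N * (P ^ N) x o) := by
    intro x
    have h5 := last_exit (P := P) (o := o) h1 N x
    have h6 : (if x = o then 0 else surv P o N x) ≤ 1 / 2 := by
      split_ifs
      · norm_num
      · exact hN x
    have h7 : ∑ s ∈ Finset.range (N + 1), (P ^ s) x o * surv P o (N - s) o
        ≤ ∑ s ∈ Finset.range (N + 1), 2 ^ N * (P ^ N) x o := by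
      refine Finset.sum_le_sum fun s hs => ?_
      have hs' : s ≤ N := by simpa [Nat.lt_succ_iff] using hs
      have h8 := step x (N - s) s
      rw [Nat.add_sub_cancel' hs'] at h8
      have h9 := pow_entry_nonneg h0 s x o
      have h10 := pow_entry_nonneg h0 N x o
      calc (P ^ s) x o * surv P o (N - s) o ≤ (P ^ s) x o * 1 := by
            gcongr; exact surv_le_one _ _
        _ ≤ 2 ^ (N - s) * (P ^ N) x o := by simpa using h8
        _ ≤ 2 ^ N * (P ^ N) x o := by
            gcongr
            · norm_num
            · exact Nat.sub_le _ _
    rw [Finset.sum_const, Finset.card_range, nsmul_eq_mul] at h7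
    linarith
  have hpos : (0 : ℝ) < 2 * ((N + 1 : ℕ) : ℝ) * 2 ^ N := by positivity
  have key : ∀ x, 1 / (2 * ((N + 1 : ℕ) : ℝ) * 2 ^ N) ≤ (P ^ N) x o := by
    intro x
    rw [div_le_iff₀ hpos]
    linarith [bound x]
  exact ⟨_, by positivity, (key o).trans (pow_entry_le_one h0 h1 N o o), key⟩

lemma exists_osc_le (h0 : ∀ x y, 0 ≤ P x y) (h1 : ∀ x, ∑ y, P x y = 1)
    (hoo : 1 / 2 ≤ P o o) {N : ℕ} (hN : ∀ x, surv P o N x ≤ 1 / 2) :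
    ∃ C r : ℝ, 0 ≤ C ∧ 0 ≤ r ∧ r < 1 ∧
      ∀ t x x' y, |(P ^ t) x y - (P ^ t) x' y| ≤ C * r ^ t := by
  obtain ⟨ε, hε, hε1, hPN⟩ := exists_pow_entry_pos h0 h1 hoo hN
  have hN0 : 0 < N := by
    rcases Nat.eq_zero_or_pos N with h | h
    · have := hN o
      rw [h] at this
      norm_num [surv] at this
    · exact h
  have hN1 : (1 : ℝ) ≤ N := by exact_mod_cast hN0
  set r : ℝ := 1 - ε / (2 * N) with hr
  have hεN : ε / (2 * N) ≤ 1 / 2 := by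
    rw [div_le_iff₀ (by positivity)]; nlinarith
  have hεN' : 0 < ε / (2 * N) := by positivity
  have hr0 : 0 < r := by rw [hr]; linarith
  have hr1 : r < 1 := by rw [hr]; linarith
  have hrN : 1 - ε ≤ r ^ N := by
    have := one_add_mul_le_pow (a := -(ε / (2 * N))) (by linarith) N
    have e : (1 : ℝ) + N * -(ε / (2 * N)) = 1 - ε / 2 := by field_simp; ring
    rw [e] at this
    have e2 : (1 : ℝ) + -(ε / (2 * N)) = r := by rw [hr]; ring
    rw [e2] at this
    linarith
  have main : ∀ t y, ∃ a : ℝ, ∀ x, a ≤ (P ^ t) x y ∧ (P ^ t) x y ≤ a + (r ^ N)⁻¹ * r ^ t := by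
    intro t y
    induction t using Nat.strong_induction_on with
    | _ t ih =>
      rcases lt_or_ge t N with h | h
      · refine ⟨0, fun x => ⟨pow_entry_nonneg h0 t x y, ?_⟩⟩
        have h2 := pow_entry_le_one h0 h1 t x y
        have h3 : r ^ N ≤ r ^ t := pow_le_pow_of_le_one hr0.le hr1.le h.le
        have h4 : 1 ≤ (r ^ N)⁻¹ * r ^ t := by
          rw [inv_mul_eq_div, le_div_iff₀ (by positivity)]; linarith
        linarith
      · obtain ⟨a, ha⟩ := ih (t - N) (by omega)
        set B := (r ^ N)⁻¹ * r ^ (t - N) with hB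
        have hB0 : 0 ≤ B := by positivity
        set c := (P ^ (t - N)) o y with hc
        have e : ∀ x, (P ^ t) x y = ∑ z, (P ^ N) x z * (P ^ (t - N)) z y := by
          intro x
          conv_lhs => rw [← Nat.add_sub_cancel' h, pow_add, Matrix.mul_apply]
        have hBt : r ^ N * B = (r ^ N)⁻¹ * r ^ t := by
          rw [hB]
          conv_rhs => rw [← Nat.add_sub_cancel' h, pow_add]
          ring
        have low : ∀ x, ε * (c - a) ≤ (P ^ t) x y - a := by
          intro x
          have e3 : (P ^ t) x y - a = ∑ z, (P ^ N) x z * ((P ^ (t - N)) z y - a) := by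
            simp [mul_sub, Finset.sum_sub_distrib, ← Finset.sum_mul, pow_row_sum h1, e]
          rw [e3]
          refine le_trans (mul_le_mul_of_nonneg_right (hPN x) (by linarith [(ha o).1])) ?_
          exact Finset.single_le_sum (f := fun z => (P ^ N) x z * ((P ^ (t - N)) z y - a))
            (fun z _ => mul_nonneg (pow_entry_nonneg h0 _ _ _) (by linarith [(ha z).1]))
            (Finset.mem_univ o)
        have upp : ∀ x, ε * (a + B - c) ≤ a + B - (P ^ t) x y := by
          intro x
          have e3 : a + B - (P ^ t) x y = ∑ z, (P ^ N) x z * (a + B - (P ^ (t - N)) z y) := by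
            simp [mul_sub, Finset.sum_sub_distrib, ← Finset.sum_mul, pow_row_sum h1, e]
          rw [e3]
          refine le_trans (mul_le_mul_of_nonneg_right (hPN x) (by linarith [(ha o).2])) ?_
          exact Finset.single_le_sum
            (f := fun z => (P ^ N) x z * (a + B - (P ^ (t - N)) z y))
            (fun z _ => mul_nonneg (pow_entry_nonneg h0 _ _ _) (by linarith [(ha z).2]))
            (Finset.mem_univ o)
        refine ⟨a + ε * (c - a), fun x => ⟨by linarith [low x], ?_⟩⟩
        rw [← hBt]
        have h5 := mul_le_mul_of_nonneg_right hrN hB0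
        linarith [upp x]
  refine ⟨(r ^ N)⁻¹, r, by positivity, hr0.le, hr1, fun t x x' y => ?_⟩
  obtain ⟨a, ha⟩ := main t y
  have hx := ha x
  have hx' := ha x'
  rw [abs_le]; constructor <;> linarith

/-- A stationary distribution attracts every starting state as fast as the oscillation decays. -/
lemma abs_pow_sub_stationary_le {π : V → ℝ} (hπ0 : ∀ v, 0 ≤ π v) (hπ1 : ∑ v, π v = 1)
    (hπ : ∀ y, ∑ x, π x * P x y = π y) {t : ℕ} {y : V} {B : ℝ} {x : V}
    (hB : ∀ x', |(P ^ t) x y - (P ^ t) x' y| ≤ B) : |(P ^ t) x y - π y| ≤ B := by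
  have hst : ∀ s y, ∑ x, π x * (P ^ s) x y = π y := by
    intro s
    induction s with
    | zero => intro y; simp [Matrix.one_apply]
    | succ s ih =>
      intro y
      simp only [pow_succ, Matrix.mul_apply, Finset.mul_sum]
      rw [Finset.sum_comm]
      simp only [← mul_assoc, ← Finset.sum_mul, ih, hπ]
  have e : (P ^ t) x y - π y = ∑ x', π x' * ((P ^ t) x y - (P ^ t) x' y) := by
    simp [mul_sub, Finset.sum_sub_distrib, ← Finset.sum_mul, hπ1, hst]
  rw [e]
  calc |∑ x', π x' * ((P ^ t) x y - (P ^ t) x' y)|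
      ≤ ∑ x', |π x' * ((P ^ t) x y - (P ^ t) x' y)| := Finset.abs_sum_le_sum_abs _ _
    _ ≤ ∑ x', π x' * B := by
        refine Finset.sum_le_sum fun x' _ => ?_
        rw [abs_mul, abs_of_nonneg (hπ0 x')]
        exact mul_le_mul_of_nonneg_left (hB x') (hπ0 x')
    _ = B := by rw [← Finset.sum_mul, hπ1, one_mul]

end Chain

end TwoCycle

namespace TwoCycle

open Complex

/-- The Fourier series with coefficients `c`. -/
noncomputable def fser (c : ℕ → ℝ) (θ : ℝ) : ℂ := ∑' t : ℕ, (c t : ℂ) * exp (t * θ * I)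

/-- All polynomial moments of the sequence are summable. -/
def Rapid (c : ℕ → ℝ) : Prop := ∀ k : ℕ, Summable fun t : ℕ => (t : ℝ) ^ k * |c t|

lemma Rapid.mul_nat {c : ℕ → ℝ} (h : Rapid c) : Rapid fun t => t * c t := fun k => by
  refine (h (k + 1)).congr fun t => ?_
  rw [abs_mul, Nat.abs_cast]; ring

lemma Rapid.abs {c : ℕ → ℝ} (h : Rapid c) : Summable fun t => |c t| := by simpa using h 0

lemma Rapid.of_le_geometric {c : ℕ → ℝ} {C r : ℝ} (hr0 : 0 ≤ r) (hr : r < 1)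
    (h : ∀ t, |c t| ≤ C * r ^ t) : Rapid c := fun k => by
  have : Summable fun t : ℕ => (t : ℝ) ^ k * r ^ t :=
    summable_pow_mul_geometric_of_norm_lt_one k (by rwa [Real.norm_of_nonneg hr0])
  refine Summable.of_nonneg_of_le (fun t => by positivity) (fun t => ?_) (this.mul_left C)
  calc (t : ℝ) ^ k * |c t| ≤ (t : ℝ) ^ k * (C * r ^ t) := by gcongr; exact h t
    _ = C * ((t : ℝ) ^ k * r ^ t) := by ring

lemma norm_term (c : ℕ → ℝ) (θ : ℝ) (t : ℕ) : ‖(c t : ℂ) * exp (t * θ * I)‖ = |c t| := by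
  have : ‖exp (t * θ * I)‖ = 1 := by
    have := norm_exp_ofReal_mul_I (t * θ)
    push_cast at this
    exact this
  rw [norm_mul, this, mul_one, norm_real, Real.norm_eq_abs]

lemma Rapid.summable_norm {c : ℕ → ℝ} (h : Rapid c) (θ : ℝ) :
    Summable fun t : ℕ => ‖(c t : ℂ) * exp (t * θ * I)‖ := by
  simpa only [norm_term] using h.abs

lemma norm_fser_le {c : ℕ → ℝ} (h : Rapid c) (θ : ℝ) : ‖fser c θ‖ ≤ ∑' t, |c t| := by
  refine (norm_tsum_le_tsum_norm (h.summable_norm θ)).trans_eq ?_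
  simp only [norm_term]

lemma hasDerivAt_fser {c : ℕ → ℝ} (h : Rapid c) (θ : ℝ) :
    HasDerivAt (fser c) (I * fser (fun t => t * c t) θ) θ := by
  have key := hasDerivAt_tsum (𝕜 := ℝ) (F := ℂ) (u := fun t : ℕ => (t : ℝ) * |c t|)
    (g := fun (t : ℕ) (x : ℝ) => (c t : ℂ) * exp (t * x * I))
    (g' := fun (t : ℕ) (x : ℝ) => I * (((t * c t : ℝ) : ℂ) * exp (t * x * I)))
    (y₀ := θ) (by simpa using h 1) (fun t y => ?_) (fun t y => ?_)
    (h.summable_norm θ).of_norm θ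
  · rw [tsum_mul_left] at key
    exact key
  · have h1 : HasDerivAt (fun x : ℝ => ((t : ℂ) * x * I)) (t * 1 * I) y :=
      ((ofRealCLM.hasDerivAt (x := y)).const_mul (t : ℂ)).mul_const I
    have h2 := (h1.cexp).const_mul (c t : ℂ)
    refine h2.congr_deriv ?_
    push_cast
    ring
  · rw [norm_mul, norm_I, one_mul, norm_term (fun t => (t : ℝ) * c t) y t, abs_mul, Nat.abs_cast]

lemma continuous_fser {c : ℕ → ℝ} (h : Rapid c) : Continuous (fser c) :=
  continuous_iff_continuousAt.2 fun θ => (hasDerivAt_fser h θ).continuousAt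

lemma fser_mul {c d e : ℕ → ℝ} (hc : Rapid c) (hd : Rapid d)
    (h : ∀ t, ∑ s ∈ Finset.range (t + 1), c s * d (t - s) = e t) (θ : ℝ) :
    fser c θ * fser d θ = fser e θ := by
  rw [fser, fser, tsum_mul_tsum_eq_tsum_sum_range_of_summable_norm (hc.summable_norm θ)
    (hd.summable_norm θ), fser]
  refine tsum_congr fun t => ?_
  rw [← h t, ofReal_sum, Finset.sum_mul]
  refine Finset.sum_congr rfl fun s hs => ?_
  have hs' : s ≤ t := by simpa [Nat.lt_succ_iff] using hs
  have : exp (t * θ * I) = exp (s * θ * I) * exp ((t - s : ℕ) * θ * I) := by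
    rw [← exp_add]
    congr 1
    push_cast [hs']
    ring
  rw [this]
  push_cast
  ring

/-- Coefficients of `(1 - z) * ∑ p t * z ^ t`. -/
def backDiff (p : ℕ → ℝ) : ℕ → ℝ
  | 0 => p 0
  | t + 1 => p (t + 1) - p t

lemma summable_shift {p : ℕ → ℝ} (hp : Rapid p) (k : ℕ) :
    Summable fun t : ℕ => ((t : ℝ) + 1) ^ k * |p t| := by
  refine Summable.of_nonneg_of_le (fun t => by positivity) (fun t => ?_)
    (((hp k).add hp.abs).mul_left (2 ^ k))
  have h1 : ((t : ℝ) + 1) ^ k ≤ 2 ^ k * (t ^ k + 1) := by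
    rcases Nat.eq_zero_or_pos t with h | h
    · subst h
      have : (1 : ℝ) ≤ 2 ^ k := one_le_pow₀ (by norm_num)
      have h0 : (0 : ℝ) ≤ 0 ^ k := by positivity
      simp only [Nat.cast_zero, zero_add, one_pow]
      nlinarith
    · have h' : (1 : ℝ) ≤ t := by exact_mod_cast h
      calc ((t : ℝ) + 1) ^ k ≤ (2 * t) ^ k := by gcongr; linarith
        _ = 2 ^ k * t ^ k := by rw [mul_pow]
        _ ≤ _ := by gcongr; linarith
  calc ((t : ℝ) + 1) ^ k * |p t| ≤ 2 ^ k * (t ^ k + 1) * |p t| := by gcongr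
    _ = _ := by ring

lemma Rapid.backDiff {p : ℕ → ℝ} (hp : Rapid p) : Rapid (backDiff p) := fun k => by
  rw [← summable_nat_add_iff 1]
  refine Summable.of_nonneg_of_le (fun t => by positivity) (fun t => ?_)
    (((summable_nat_add_iff 1).2 (hp k)).add (summable_shift hp k))
  simp only [TwoCycle.backDiff]
  push_cast
  rw [← mul_add]
  gcongr
  exact abs_sub _ _

lemma fser_backDiff {p : ℕ → ℝ} (hp : Rapid p) (θ : ℝ) :
    fser (backDiff p) θ = (1 - exp (θ * I)) * fser p θ := by
  have h1 := (hp.backDiff.summable_norm θ).of_norm.tsum_eq_zero_add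
  have h2 := (hp.summable_norm θ).of_norm.tsum_eq_zero_add
  have s1 := (summable_nat_add_iff 1).2 (hp.summable_norm θ).of_norm
  have s2 := ((hp.summable_norm θ).of_norm.mul_left (exp (θ * I)))
  have h3 : ∑' t : ℕ, ((backDiff p (t + 1) : ℝ) : ℂ) * exp ((t + 1 : ℕ) * θ * I)
      = ∑' t : ℕ, (p (t + 1) : ℂ) * exp ((t + 1 : ℕ) * θ * I) - exp (θ * I) * fser p θ := by
    rw [fser, ← tsum_mul_left, ← s1.tsum_sub s2]
    refine tsum_congr fun t => ?_
    have : exp ((t + 1 : ℕ) * θ * I) = exp (θ * I) * exp (t * θ * I) := by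
      rw [← exp_add]; congr 1; push_cast; ring
    rw [this]
    simp only [backDiff]
    push_cast
    ring
  have h4 : fser (backDiff p) θ = p 0 + ∑' t : ℕ, ((backDiff p (t + 1) : ℝ) : ℂ)
      * exp ((t + 1 : ℕ) * θ * I) := by
    rw [fser, h1]; simp [backDiff]
  have h5 : fser p θ = p 0 + ∑' t : ℕ, (p (t + 1) : ℂ) * exp ((t + 1 : ℕ) * θ * I) := by
    conv_lhs => rw [fser, h2]
    simp
  rw [h4, h3]
  linear_combination (-1 : ℂ) * h5

lemma two_pi_mul_abs_le {c : ℕ → ℝ} (h : Rapid c) (t : ℕ) :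
    2 * Real.pi * |c t| ≤ ∫ θ in (-Real.pi)..Real.pi, ‖fser c θ‖ := by
  have hsum : HasSum (fun s : ℕ => ∫ θ in (-Real.pi)..Real.pi,
      (c s : ℂ) * exp (s * θ * I) * exp (-(t * θ * I)))
      (∫ θ in (-Real.pi)..Real.pi, fser c θ * exp (-(t * θ * I))) := by
    have hn : ∀ θ : ℝ, ‖exp (-(t * θ * I))‖ = 1 := fun θ => by
      have := norm_exp_ofReal_mul_I (-(t * θ))
      push_cast at this
      rw [← this]; congr 2; ring
    refine intervalIntegral.hasSum_integral_of_dominated_convergence (fun s _ => |c s|)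
      (fun s => ?_) (fun s => ?_) ?_ ?_ ?_
    · exact (Continuous.aestronglyMeasurable (by fun_prop))
    · refine Filter.Eventually.of_forall fun θ _ => ?_
      rw [norm_mul, norm_term, hn, mul_one]
    · exact Filter.Eventually.of_forall fun θ _ => h.abs
    · exact intervalIntegrable_const
    · refine Filter.Eventually.of_forall fun θ _ => ?_
      exact (h.summable_norm θ).of_norm.hasSum.mul_right _
  have horth : ∀ s : ℕ, s ≠ t → ∫ θ in (-Real.pi)..Real.pi,
      (c s : ℂ) * exp (s * θ * I) * exp (-(t * θ * I)) = 0 := by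
    intro s hst
    have e : ∀ θ : ℝ, (c s : ℂ) * exp (s * θ * I) * exp (-(t * θ * I))
        = c s * exp ((((s : ℂ) - t) * I) * θ) := fun θ => by
      rw [mul_assoc, ← exp_add]; congr 2; ring
    have hne : ((s : ℂ) - t) * I ≠ 0 := by
      refine mul_ne_zero (sub_ne_zero.2 ?_) I_ne_zero
      exact_mod_cast hst
    simp only [e]
    rw [intervalIntegral.integral_const_mul, integral_exp_mul_complex hne]
    have : exp (((s : ℂ) - t) * I * (Real.pi : ℝ)) = exp (((s : ℂ) - t) * I * (-Real.pi : ℝ)) := by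
      rw [exp_eq_exp_iff_exists_int]
      exact ⟨(s : ℤ) - t, by push_cast; ring⟩
    rw [this]; simp
  have hdiag : ∫ θ in (-Real.pi)..Real.pi,
      (c t : ℂ) * exp (t * θ * I) * exp (-(t * θ * I)) = 2 * Real.pi * c t := by
    have e : ∀ θ : ℝ, (c t : ℂ) * exp (t * θ * I) * exp (-(t * θ * I)) = c t := fun θ => by
      rw [mul_assoc, ← exp_add, add_neg_cancel, exp_zero, mul_one]
    simp only [e, intervalIntegral.integral_const, sub_neg_eq_add, real_smul]
    push_cast; ring
  have hval := hsum.unique (hasSum_single t horth)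
  rw [hdiag] at hval
  have e1 : ‖(2 * Real.pi * c t : ℂ)‖ = 2 * Real.pi * |c t| := by
    rw [norm_mul, norm_mul, norm_real, norm_real, Real.norm_eq_abs, Real.norm_eq_abs,
      abs_of_pos Real.pi_pos]
    norm_num
  rw [← e1, ← hval]
  refine (intervalIntegral.norm_integral_le_integral_norm (by linarith [Real.pi_pos])).trans_eq ?_
  refine intervalIntegral.integral_congr fun θ _ => ?_
  have : ‖exp (-(t * θ * I))‖ = 1 := by
    have := norm_exp_ofReal_mul_I (-(t * θ))
    push_cast at this
    rw [← this]; congr 2; ring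
  simp only [norm_mul, this, mul_one]

end TwoCycle

namespace TwoCycle

open Complex

lemma tsum_moment_le {c : ℕ → ℝ} {L : ℝ} (hL : 1 ≤ L) (h : ∀ t, |c t| ≤ 2 * (1 - 1 / L) ^ t)
    (k : ℕ) : ∑' t : ℕ, ((t : ℝ) + 1) ^ k * |c t| ≤ 2 * k.factorial * L ^ (k + 1) := by
  have hL0 : 0 < L := by linarith
  have hr0 : 0 ≤ 1 - 1 / L := by rw [sub_nonneg, div_le_one hL0]; exact hL
  have hr1 : 1 - 1 / L < 1 := by have : 0 < 1 / L := by positivity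
                                 linarith
  have hs := hasSum_choose_mul_geometric_of_norm_lt_one (𝕜 := ℝ) k
    (r := 1 - 1 / L) (by rwa [Real.norm_of_nonneg hr0])
  have hs2 := hs.mul_left (2 * (k.factorial : ℝ))
  have hle : ∀ t : ℕ, ((t : ℝ) + 1) ^ k * |c t| ≤
      2 * (k.factorial : ℝ) * (((t + k).choose k : ℕ) * (1 - 1 / L) ^ t) := fun t => by
    have h1 : ((t : ℝ) + 1) ^ k ≤ k.factorial * ((t + k).choose k : ℕ) := by
      have := Nat.pow_succ_le_ascFactorial (t + 1) k
      rw [Nat.ascFactorial_eq_factorial_mul_choose'] at this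
      have e : t + 1 + k - 1 = t + k := by omega
      rw [e] at this
      exact_mod_cast this
    calc ((t : ℝ) + 1) ^ k * |c t| ≤ (k.factorial * ((t + k).choose k : ℕ)) *
          (2 * (1 - 1 / L) ^ t) := by gcongr; exact h t
      _ = _ := by ring
  have hsum : Summable fun t : ℕ => ((t : ℝ) + 1) ^ k * |c t| :=
    Summable.of_nonneg_of_le (fun t => by positivity) hle hs2.summable
  refine (hsum.tsum_le_tsum hle hs2.summable).trans_eq ?_
  rw [hs2.tsum_eq]
  congr 1
  have : 1 - (1 - 1 / L) = 1 / L := by ring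
  rw [this, div_pow, one_pow, one_div_one_div]

lemma Rapid.of_le {c : ℕ → ℝ} {L : ℝ} (hL : 1 ≤ L) (h : ∀ t, |c t| ≤ 2 * (1 - 1 / L) ^ t) :
    Rapid c := by
  have hL0 : 0 < L := by linarith
  refine Rapid.of_le_geometric (r := 1 - 1 / L) ?_ ?_ h
  · rw [sub_nonneg, div_le_one hL0]; exact hL
  · have : 0 < 1 / L := by positivity
    linarith

lemma tsum_pow_backDiff {p : ℕ → ℝ} (hp : Rapid p) (h0 : ∀ t, 0 ≤ p t)
    (hanti : ∀ t, p (t + 1) ≤ p t) (k : ℕ) :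
    ∑' t : ℕ, (t : ℝ) ^ k * |backDiff p t| =
      2 * 0 ^ k * p 0 + ∑' t : ℕ, (((t : ℝ) + 1) ^ k - t ^ k) * |p t| := by
  have hs := hp.backDiff k
  have s1 := summable_shift hp k
  have s2 := hp k
  have s3 := (summable_nat_add_iff 1).2 s2
  have e2 := s2.tsum_eq_zero_add
  rw [hs.tsum_eq_zero_add]
  have : ∀ t : ℕ, ((t + 1 : ℕ) : ℝ) ^ k * |backDiff p (t + 1)| =
      ((t : ℝ) + 1) ^ k * |p t| - ((t + 1 : ℕ) : ℝ) ^ k * |p (t + 1)| := fun t => by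
    simp only [backDiff]
    rw [abs_sub_comm, abs_of_nonneg (sub_nonneg.2 (hanti t)), abs_of_nonneg (h0 t),
      abs_of_nonneg (h0 (t + 1))]
    push_cast
    ring
  simp only [this]
  rw [s1.tsum_sub s3]
  have e3 : ∀ t : ℕ, (((t : ℝ) + 1) ^ k - t ^ k) * |p t| =
    ((t : ℝ) + 1) ^ k * |p t| - (t : ℝ) ^ k * |p t| := fun t => by ring
  simp only [e3]
  rw [s1.tsum_sub s2, e2]
  simp only [backDiff, abs_of_nonneg (h0 0), Nat.cast_zero]
  ring

/-- The quantitative hypotheses on survival sequences. -/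
structure SurvBound (p : ℕ → ℝ) (L : ℝ) : Prop where
  one_le : 1 ≤ L
  nonneg : ∀ t, 0 ≤ p t
  zero : p 0 = 1
  anti : ∀ t, p (t + 1) ≤ p t
  le : ∀ t, p t ≤ 2 * (1 - 1 / L) ^ t

lemma SurvBound.abs_le {p : ℕ → ℝ} {L : ℝ} (h : SurvBound p L) (t : ℕ) :
    |p t| ≤ 2 * (1 - 1 / L) ^ t := by rw [abs_of_nonneg (h.nonneg t)]; exact h.le t

lemma SurvBound.rapid {p : ℕ → ℝ} {L : ℝ} (h : SurvBound p L) : Rapid p :=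
  Rapid.of_le h.one_le h.abs_le

/-- `b t` has `k`-th moment at most `6 * B * L ^ k` for `k = 0, 1, 2`. -/
def MomentBound (c : ℕ → ℝ) (B L : ℝ) : Prop :=
  (∑' t, |c t| ≤ 6 * B) ∧ (∑' t : ℕ, |t * c t| ≤ 6 * B * L) ∧
    (∑' t : ℕ, |t * (t * c t)| ≤ 6 * B * L ^ 2)

lemma SurvBound.moment {p : ℕ → ℝ} {L : ℝ} (h : SurvBound p L) : MomentBound p L L := by
  have m := fun k => tsum_moment_le h.one_le h.abs_le k
  have hr := h.rapid
  have hL : 0 < L := by linarith [h.one_le]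
  have key : ∀ k : ℕ, ∑' t : ℕ, (t : ℝ) ^ k * |p t| ≤ 2 * k.factorial * L ^ (k + 1) := fun k =>
    ((hr k).tsum_le_tsum (fun t => by gcongr; linarith) (summable_shift hr k)).trans (m k)
  have k0 := key 0
  have k1 := key 1
  have k2 := key 2
  simp only [pow_zero, one_mul, Nat.factorial, pow_one] at k0 k1 k2
  refine ⟨?_, ?_, ?_⟩
  · refine k0.trans ?_
    norm_num
    linarith
  · have : ∀ t : ℕ, |t * p t| = t * |p t| := fun t => by rw [abs_mul, Nat.abs_cast]
    simp only [this]
    refine k1.trans ?_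
    norm_num
    nlinarith
  · have : ∀ t : ℕ, |t * (t * p t)| = (t : ℝ) ^ 2 * |p t| := fun t => by
      rw [abs_mul, abs_mul, Nat.abs_cast]; ring
    simp only [this]
    refine k2.trans ?_
    norm_num
    have : 0 < L ^ 3 := by positivity
    nlinarith

lemma SurvBound.moment_backDiff {p : ℕ → ℝ} {L : ℝ} (h : SurvBound p L) :
    MomentBound (backDiff p) 1 L := by
  have m := fun k => tsum_moment_le h.one_le h.abs_le k
  have hr := h.rapid
  have hL : 0 < L := by linarith [h.one_le]
  have key := tsum_pow_backDiff hr h.nonneg h.anti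
  have k0 := key 0
  have k1 := key 1
  have k2 := key 2
  have m0 := m 0
  have m1 := m 1
  simp only [pow_zero, one_mul, sub_self, zero_mul, tsum_zero, h.zero, mul_one, add_zero, pow_one,
    mul_zero, zero_add, add_sub_cancel_left, Nat.factorial, Nat.cast_one] at k0 k1 k2 m0 m1
  refine ⟨?_, ?_, ?_⟩
  · rw [k0]; norm_num
  · have : ∀ t : ℕ, |t * backDiff p t| = t * |backDiff p t| := fun t => by
      rw [abs_mul, Nat.abs_cast]
    simp only [this]
    rw [k1]
    refine m0.trans ?_
    linarith
  · have : ∀ t : ℕ, |t * (t * backDiff p t)| = (t : ℝ) ^ 2 * |backDiff p t| := fun t => by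
      rw [abs_mul, abs_mul, Nat.abs_cast]; ring
    simp only [this]
    rw [k2]
    have s1 := (summable_shift hr 1).mul_left 2
    have : ∑' t : ℕ, (((t : ℝ) + 1) ^ 2 - t ^ 2) * |p t| ≤
        ∑' t : ℕ, 2 * (((t : ℝ) + 1) ^ 1 * |p t|) := by
      have hle : ∀ t : ℕ, (((t : ℝ) + 1) ^ 2 - t ^ 2) * |p t| ≤
          2 * (((t : ℝ) + 1) ^ 1 * |p t|) := fun t => by
        nlinarith [abs_nonneg (p t)]
      refine Summable.tsum_le_tsum hle ?_ s1
      refine Summable.of_nonneg_of_le (fun t => ?_) hle s1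
      have : (0 : ℝ) ≤ t := t.cast_nonneg
      have : (0 : ℝ) ≤ ((t : ℝ) + 1) ^ 2 - t ^ 2 := by nlinarith
      positivity
    rw [tsum_mul_left] at this
    simp only [pow_one] at this
    norm_num at this ⊢
    refine this.trans ?_
    norm_num at m1
    nlinarith [sq_nonneg L]

lemma norm_second_le {V0 V1 V2 S0 S1 S2 X0 X1 X2 : ℂ} {b L σ : ℝ} (hσ : 0 < σ) (hL : 0 ≤ L)
    (h0 : V0 * S0 = X0) (h1 : V1 * S0 + V0 * S1 = X1)
    (h2 : V2 * S0 + 2 * (V1 * S1) + V0 * S2 = X2)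
    (hs : σ ≤ ‖S0‖) (s0 : ‖S0‖ ≤ b) (s1 : ‖S1‖ ≤ b * L) (s2 : ‖S2‖ ≤ b * L ^ 2)
    (x0 : ‖X0‖ ≤ b) (x1 : ‖X1‖ ≤ b * L) (x2 : ‖X2‖ ≤ b * L ^ 2) :
    ‖V2‖ ≤ 6 * b ^ 3 * L ^ 2 * (1 / σ ^ 3) := by
  have hb : 0 < b := by linarith
  have hu : 1 ≤ b / σ := by rw [one_le_div hσ]; linarith
  have hbase : ∀ {V X : ℂ}, V * S0 = X → ∀ {B : ℝ}, ‖X‖ ≤ B → ‖V‖ ≤ B / σ := by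
    intro V X h B hB
    rw [le_div_iff₀ hσ]
    calc ‖V‖ * σ ≤ ‖V‖ * ‖S0‖ := by gcongr
      _ = ‖X‖ := by rw [← norm_mul, h]
      _ ≤ B := hB
  set u := b / σ with hu'
  have hbu : b = u * σ := by rw [hu']; field_simp
  have v0 : ‖V0‖ ≤ u := hbase h0 x0
  have v1 : ‖V1‖ ≤ 2 * u ^ 2 * L := by
    have h1' : V1 * S0 = X1 - V0 * S1 := by linear_combination h1
    have : ‖X1 - V0 * S1‖ ≤ b * L + u * (b * L) := by
      refine (norm_sub_le _ _).trans ?_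
      rw [norm_mul]
      gcongr
    refine (hbase h1' this).trans ?_
    rw [div_le_iff₀ hσ, hbu]
    have : 0 ≤ u * σ * L * (u - 1) := by
      have : 0 ≤ u - 1 := by linarith
      positivity
    nlinarith
  have h2' : V2 * S0 = X2 - 2 * (V1 * S1) - V0 * S2 := by linear_combination h2
  have : ‖X2 - 2 * (V1 * S1) - V0 * S2‖ ≤
      b * L ^ 2 + 2 * (2 * u ^ 2 * L * (b * L)) + u * (b * L ^ 2) := by
    refine (norm_sub_le _ _).trans (add_le_add ((norm_sub_le _ _).trans ?_) ?_)
    · rw [norm_mul, norm_mul, RCLike.norm_ofNat]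
      gcongr
    · rw [norm_mul]; gcongr
  refine (hbase h2' this).trans ?_
  have e : 6 * b ^ 3 * L ^ 2 * (1 / σ ^ 3) = 6 * u ^ 3 * L ^ 2 := by
    rw [hu']; field_simp
  rw [e, div_le_iff₀ hσ, hbu]
  have h3 : 0 ≤ u * σ * L ^ 2 * (2 * u ^ 2 - 1 - u) := by
    have : 0 ≤ 2 * u ^ 2 - 1 - u := by nlinarith
    positivity
  nlinarith

lemma fser_mul_deriv {c d e : ℕ → ℝ} (hc : Rapid c) (hd : Rapid d) (he : Rapid e)
    (h : ∀ θ, fser c θ * fser d θ = fser e θ) (θ : ℝ) :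
    fser (fun t => t * c t) θ * fser d θ + fser c θ * fser (fun t => t * d t) θ =
      fser (fun t => t * e t) θ := by
  have h1 := (hasDerivAt_fser hc θ).mul (hasDerivAt_fser hd θ)
  have h2 := hasDerivAt_fser he θ
  have h3 : fser e = fser c * fser d := by funext θ; exact (h θ).symm
  rw [h3] at h2
  have := h1.unique h2
  have hI := I_ne_zero
  apply mul_left_cancel₀ hI
  linear_combination this

lemma fser_mul_deriv2 {c d e : ℕ → ℝ} (hc : Rapid c) (hd : Rapid d) (he : Rapid e)
    (h : ∀ θ, fser c θ * fser d θ = fser e θ) (θ : ℝ) :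
    fser (fun t => t * (t * c t)) θ * fser d θ +
      2 * (fser (fun t => t * c t) θ * fser (fun t => t * d t) θ) +
      fser c θ * fser (fun t => t * (t * d t)) θ = fser (fun t => t * (t * e t)) θ := by
  have h1 := ((hasDerivAt_fser hc.mul_nat θ).mul (hasDerivAt_fser hd θ)).add
    ((hasDerivAt_fser hc θ).mul (hasDerivAt_fser hd.mul_nat θ))
  have h2 := hasDerivAt_fser he.mul_nat θ
  have h3 : fser (fun t => t * e t) = fser (fun t => t * c t) * fser d +
      fser c * fser (fun t => t * d t) := by
    funext θ; exact (fser_mul_deriv hc hd he h θ).symm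
  rw [h3] at h2
  have := h1.unique h2
  have hI := I_ne_zero
  apply mul_left_cancel₀ hI
  linear_combination this

lemma MomentBound.norm_le {c : ℕ → ℝ} {B L : ℝ} (h : MomentBound c B L) (hc : Rapid c) (θ : ℝ) :
    ‖fser c θ‖ ≤ 6 * B ∧ ‖fser (fun t => t * c t) θ‖ ≤ 6 * B * L ∧
      ‖fser (fun t => t * (t * c t)) θ‖ ≤ 6 * B * L ^ 2 :=
  ⟨(norm_fser_le hc θ).trans h.1, (norm_fser_le hc.mul_nat θ).trans h.2.1,
    (norm_fser_le hc.mul_nat.mul_nat θ).trans h.2.2⟩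

lemma norm_second_fser_le {d p q : ℕ → ℝ} {B L σ : ℝ} (hB : 0 < B) (hL : 0 ≤ L) (hσ : 0 < σ)
    (hd : Rapid d) (hp : Rapid p) (hq : Rapid q)
    (mp : MomentBound p B L) (mq : MomentBound q B L)
    (h : ∀ θ, fser d θ * fser p θ = fser q θ) (θ : ℝ) (hs : σ * B ≤ ‖fser p θ‖) :
    ‖fser (fun t => t * (t * d t)) θ‖ ≤ 1296 * L ^ 2 * (1 / σ ^ 3) := by
  obtain ⟨p0, p1, p2⟩ := mp.norm_le hp θ
  obtain ⟨q0, q1, q2⟩ := mq.norm_le hq θ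
  have := norm_second_le (σ := σ * B) (b := 6 * B) (L := L) (by positivity) hL (h θ)
    (fser_mul_deriv hd hp hq h θ) (fser_mul_deriv2 hd hp hq h θ) hs p0 p1 p2 q0 q1 q2
  refine this.trans_eq ?_
  field_simp
  ring

/-- Decay of renewal differences from a lower bound on the transform of the survival sequence. -/
lemma sq_mul_abs_le_integral {d p q : ℕ → ℝ} {L : ℝ} (hd : Rapid d) (hp : SurvBound p L)
    (hq : SurvBound q L) (hconv : ∀ t, ∑ s ∈ Finset.range (t + 1), d s * p (t - s) = q t)
    {G : ℝ → ℝ} (hG : Continuous G)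
    (h : ∀ θ ∈ Set.Icc (-Real.pi) Real.pi, θ ≠ 0 → ∃ σ : ℝ, 0 < σ ∧ 1 / σ ^ 3 ≤ G θ ∧
      (σ * L ≤ ‖fser p θ‖ ∨ σ ≤ ‖(1 - exp (θ * I)) * fser p θ‖)) (t : ℕ) :
    2 * Real.pi * ((t : ℝ) ^ 2 * |d t|) ≤
      1296 * L ^ 2 * ∫ θ in (-Real.pi)..Real.pi, G θ := by
  have hL : 0 < L := by linarith [hp.one_le]
  have hm := fser_mul hd hp.rapid hconv
  have hm2 : ∀ θ, fser d θ * fser (backDiff p) θ = fser (backDiff q) θ := fun θ => by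
    rw [fser_backDiff hp.rapid, fser_backDiff hq.rapid, ← hm]; ring
  have hb : ∀ θ ∈ Set.Icc (-Real.pi) Real.pi, θ ≠ 0 →
      ‖fser (fun t => t * (t * d t)) θ‖ ≤ 1296 * L ^ 2 * G θ := by
    intro θ hθ h0
    obtain ⟨σ, hσ, hσG, hs | hs⟩ := h θ hθ h0
    · refine (norm_second_fser_le hL hL.le hσ hd hp.rapid hq.rapid hp.moment hq.moment hm θ
        hs).trans ?_
      gcongr
    · rw [← fser_backDiff hp.rapid] at hs
      refine (norm_second_fser_le one_pos hL.le hσ hd hp.rapid.backDiff hq.rapid.backDiff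
        hp.moment_backDiff hq.moment_backDiff hm2 θ (by rwa [mul_one])).trans ?_
      gcongr
  have h1 := two_pi_mul_abs_le hd.mul_nat.mul_nat t
  have e : |(t : ℝ) * (t * d t)| = (t : ℝ) ^ 2 * |d t| := by
    rw [abs_mul, abs_mul, Nat.abs_cast]; ring
  simp only [e] at h1
  refine h1.trans ?_
  rw [← intervalIntegral.integral_const_mul]
  refine intervalIntegral.integral_mono_ae_restrict (by linarith [Real.pi_pos])
    ((continuous_fser hd.mul_nat.mul_nat).norm.intervalIntegrable _ _)
    ((continuous_const.mul hG).intervalIntegrable _ _) ?_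
  have hne : ∀ᵐ θ : ℝ, θ ≠ 0 := by
    rw [MeasureTheory.ae_iff]; simp
  rw [Filter.EventuallyLE, MeasureTheory.ae_restrict_iff' measurableSet_Icc]
  filter_upwards [hne] with θ hθ hmem using hb θ hmem hθ

end TwoCycle

namespace TwoCycle

open Complex

/-- Upward Riccati recursion. -/
noncomputable def riccM (κ : ℕ → ℂ) (m₀ : ℂ) : ℕ → ℂ
  | 0 => m₀
  | l + 1 => (2 / 3) / (κ l - riccM κ m₀ l / 3)

/-- Downward Riccati recursion. -/
noncomputable def riccD (ν : ℕ → ℂ) : ℕ → ℂ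
  | 0 => 0
  | k + 1 => (1 / 3) / (ν k - 2 / 3 * riccD ν k)

lemma norm_riccM_den {κ m : ℂ} {η : ℝ} (hκ : 1 + η ≤ ‖κ‖) (hm : ‖m‖ ≤ 1) :
    2 / 3 + η ≤ ‖κ - m / 3‖ := by
  have h1 := norm_sub_norm_le κ (m / 3)
  have h2 : ‖m / 3‖ ≤ 1 / 3 := by
    rw [norm_div, RCLike.norm_ofNat]; linarith
  linarith

lemma norm_ricc_step_le {κ m : ℂ} {η : ℝ} (hη : 0 ≤ η) (hκ : 1 + η ≤ ‖κ‖) (hm : ‖m‖ ≤ 1) :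
    ‖(2 / 3 : ℂ) / (κ - m / 3)‖ ≤ 1 / (1 + 3 / 2 * η) := by
  have h := norm_riccM_den hκ hm
  rw [norm_div, norm_div, RCLike.norm_ofNat, RCLike.norm_ofNat, div_le_div_iff₀ (by linarith)
    (by linarith)]
  linarith

lemma norm_ricc_step_sub_one_le {κ m : ℂ} {δ : ℝ} (hκ : 1 ≤ ‖κ‖) (hκ1 : ‖κ - 1‖ ≤ δ)
    (hm : ‖m‖ ≤ 1) (hm1 : ‖m - 1‖ ≤ 3 * δ) : ‖(2 / 3 : ℂ) / (κ - m / 3) - 1‖ ≤ 3 * δ := by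
  have h := norm_riccM_den (η := 0) (by simpa using hκ) hm
  have h0 : κ - m / 3 ≠ 0 := by
    rw [← norm_pos_iff]; linarith
  have e : (2 / 3 : ℂ) / (κ - m / 3) - 1 = (-(κ - 1) + (m - 1) / 3) / (κ - m / 3) := by
    rw [div_sub_one h0]; congr 1; ring
  rw [e, norm_div, div_le_iff₀ (by linarith)]
  have h2 : ‖-(κ - 1) + (m - 1) / 3‖ ≤ δ + δ := by
    refine (norm_add_le _ _).trans (add_le_add ?_ ?_)
    · rwa [norm_neg]
    · rw [norm_div, RCLike.norm_ofNat]; linarith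
  have : 0 ≤ δ := (norm_nonneg _).trans hκ1
  nlinarith

lemma norm_ricc_step_sub_le {κ m m' : ℂ} (hκ : 1 ≤ ‖κ‖) (hm : ‖m‖ ≤ 1) (hm' : ‖m'‖ ≤ 1) :
    ‖(2 / 3 : ℂ) / (κ - m / 3) - (2 / 3 : ℂ) / (κ - m' / 3)‖ ≤ 1 / 2 * ‖m - m'‖ := by
  have h := norm_riccM_den (η := 0) (by simpa using hκ) hm
  have h' := norm_riccM_den (η := 0) (by simpa using hκ) hm'
  have h0 : κ - m / 3 ≠ 0 := by
    rw [← norm_pos_iff]; linarith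
  have h0' : κ - m' / 3 ≠ 0 := by
    rw [← norm_pos_iff]; linarith
  have e : (2 / 3 : ℂ) / (κ - m / 3) - (2 / 3 : ℂ) / (κ - m' / 3) =
      (2 / 9 : ℂ) * (m - m') / ((κ - m / 3) * (κ - m' / 3)) := by
    rw [div_sub_div _ _ h0 h0']
    congr 1
    ring
  rw [e, norm_div, norm_mul, norm_mul, div_le_iff₀ (by nlinarith)]
  have : ‖(2 / 9 : ℂ)‖ = 2 / 9 := by rw [norm_div, RCLike.norm_ofNat, RCLike.norm_ofNat]
  rw [this]
  have hp : 4 / 9 ≤ ‖κ - m / 3‖ * ‖κ - m' / 3‖ := by nlinarith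
  nlinarith [norm_nonneg (m - m')]

/-- Bounds on the coefficients of the recursion. -/
structure RiccCoeff (κ : ℕ → ℂ) (η δ : ℝ) : Prop where
  nonneg : 0 ≤ η
  norm_ge : ∀ l, 1 + η ≤ ‖κ l‖
  norm_sub : ∀ l, ‖κ l - 1‖ ≤ δ

lemma RiccCoeff.one_le {κ : ℕ → ℂ} {η δ : ℝ} (h : RiccCoeff κ η δ) (l : ℕ) : 1 ≤ ‖κ l‖ := by
  linarith [h.norm_ge l, h.nonneg]

lemma RiccCoeff.delta_nonneg {κ : ℕ → ℂ} {η δ : ℝ} (h : RiccCoeff κ η δ) : 0 ≤ δ :=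
  (norm_nonneg _).trans (h.norm_sub 0)

lemma RiccCoeff.riccM_bound {κ : ℕ → ℂ} {η δ : ℝ} (h : RiccCoeff κ η δ) {m₀ : ℂ}
    (h0 : ‖m₀‖ ≤ 1) (h1 : ‖m₀ - 1‖ ≤ 3 * δ) (l : ℕ) :
    ‖riccM κ m₀ l‖ ≤ 1 ∧ ‖riccM κ m₀ l - 1‖ ≤ 3 * δ := by
  induction l with
  | zero => exact ⟨h0, h1⟩
  | succ l ih =>
    refine ⟨(norm_ricc_step_le h.nonneg (h.norm_ge l) ih.1).trans ?_,
      norm_ricc_step_sub_one_le (h.one_le l) (h.norm_sub l) ih.1 ih.2⟩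
    have := h.nonneg
    rw [div_le_one (by positivity)]
    linarith

lemma RiccCoeff.riccM_succ_le {κ : ℕ → ℂ} {η δ : ℝ} (h : RiccCoeff κ η δ) {m₀ : ℂ}
    (h0 : ‖m₀‖ ≤ 1) (h1 : ‖m₀ - 1‖ ≤ 3 * δ) (l : ℕ) :
    ‖riccM κ m₀ (l + 1)‖ ≤ 1 / (1 + 3 / 2 * η) :=
  norm_ricc_step_le h.nonneg (h.norm_ge l) (h.riccM_bound h0 h1 l).1

lemma RiccCoeff.riccM_lipschitz {κ : ℕ → ℂ} {η δ : ℝ} (h : RiccCoeff κ η δ) {m₀ m₁ : ℂ}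
    (h0 : ‖m₀‖ ≤ 1) (h1 : ‖m₀ - 1‖ ≤ 3 * δ) (h0' : ‖m₁‖ ≤ 1) (h1' : ‖m₁ - 1‖ ≤ 3 * δ) (l : ℕ) :
    ‖riccM κ m₀ (l + 1) - riccM κ m₁ (l + 1)‖ ≤ 1 / 2 * ‖m₀ - m₁‖ := by
  induction l with
  | zero => exact norm_ricc_step_sub_le (h.one_le 0) h0 h0'
  | succ l ih =>
    have := norm_ricc_step_sub_le (h.one_le (l + 1)) (h.riccM_bound h0 h1 (l + 1)).1
      (h.riccM_bound h0' h1' (l + 1)).1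
    refine this.trans ?_
    nlinarith [norm_nonneg (m₀ - m₁)]

lemma RiccCoeff.exists_periodic {κ : ℕ → ℂ} {η δ : ℝ} (h : RiccCoeff κ η δ) (n : ℕ) :
    ∃ m₀ : ℂ, ‖m₀‖ ≤ 1 ∧ ‖m₀ - 1‖ ≤ 3 * δ ∧ riccM κ m₀ (n + 1) = m₀ := by
  set s : Set ℂ := Metric.closedBall 0 1 ∩ Metric.closedBall 1 (3 * δ) with hs
  have hmem : ∀ m, m ∈ s ↔ ‖m‖ ≤ 1 ∧ ‖m - 1‖ ≤ 3 * δ := fun m => by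
    rw [hs, Set.mem_inter_iff, mem_closedBall_zero_iff, Metric.mem_closedBall, dist_eq_norm]
  have hsc : IsComplete s :=
    (Metric.isClosed_closedBall.inter Metric.isClosed_closedBall).isComplete
  have hmaps : Set.MapsTo (fun m => riccM κ m (n + 1)) s s := fun m hm => by
    rw [hmem] at hm ⊢
    exact h.riccM_bound hm.1 hm.2 (n + 1)
  have hc : ContractingWith (1 / 2) (hmaps.restrict (fun m => riccM κ m (n + 1)) s s) := by
    refine ⟨by norm_num, LipschitzWith.of_dist_le_mul fun a b => ?_⟩
    have ha := (hmem _).1 a.2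
    have hb := (hmem _).1 b.2
    have := h.riccM_lipschitz ha.1 ha.2 hb.1 hb.2 n
    simpa [Subtype.dist_eq, dist_eq_norm] using this
  have h1 : (1 : ℂ) ∈ s := by
    rw [hmem]; simpa using h.delta_nonneg
  obtain ⟨m, hm, hfix, -⟩ := hc.exists_fixedPoint' hsc hmaps h1 (edist_ne_top _ _)
  have := (hmem m).1 hm
  exact ⟨m, this.1, this.2, hfix⟩

lemma norm_riccD_den {ν d : ℂ} (hν : 1 ≤ ‖ν‖) (hd : ‖d‖ ≤ 1 / 2) : 2 / 3 ≤ ‖ν - 2 / 3 * d‖ := by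
  have h1 := norm_sub_norm_le ν (2 / 3 * d)
  have h2 : ‖2 / 3 * d‖ ≤ 1 / 3 := by
    rw [norm_mul, norm_div, RCLike.norm_ofNat, RCLike.norm_ofNat]; linarith
  linarith

lemma norm_riccD_le {ν : ℕ → ℂ} (hν : ∀ l, 1 ≤ ‖ν l‖) (k : ℕ) : ‖riccD ν k‖ ≤ 1 / 2 := by
  induction k with
  | zero => simp [riccD]
  | succ k ih =>
    have h := norm_riccD_den (hν k) ih
    rw [riccD, norm_div, norm_div, norm_one, RCLike.norm_ofNat, div_le_div_iff₀ (by linarith)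
      (by norm_num)]
    linarith

lemma norm_riccD_sub_le {ν ν' : ℕ → ℂ} {δ : ℝ} (hν : ∀ l, 1 ≤ ‖ν l‖) (hν' : ∀ l, 1 ≤ ‖ν' l‖)
    (h : ∀ l, ‖ν l - ν' l‖ ≤ δ) (k : ℕ) : ‖riccD ν k - riccD ν' k‖ ≤ 3 / 2 * δ := by
  have hδ : 0 ≤ δ := (norm_nonneg _).trans (h 0)
  induction k with
  | zero => simp [riccD, hδ]
  | succ k ih =>
    have g := norm_riccD_den (hν k) (norm_riccD_le hν k)
    have g' := norm_riccD_den (hν' k) (norm_riccD_le hν' k)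
    have h0 : ν k - 2 / 3 * riccD ν k ≠ 0 := by
      rw [← norm_pos_iff]; linarith
    have h0' : ν' k - 2 / 3 * riccD ν' k ≠ 0 := by
      rw [← norm_pos_iff]; linarith
    have e : riccD ν (k + 1) - riccD ν' (k + 1) =
        (1 / 3) * (-(ν k - ν' k) + 2 / 3 * (riccD ν k - riccD ν' k)) /
          ((ν k - 2 / 3 * riccD ν k) * (ν' k - 2 / 3 * riccD ν' k)) := by
      rw [riccD, riccD, div_sub_div _ _ h0 h0']
      congr 1
      ring
    rw [e, norm_div, norm_mul, norm_mul, norm_div, norm_one, RCLike.norm_ofNat,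
      div_le_iff₀ (by nlinarith)]
    have h1 : ‖-(ν k - ν' k) + 2 / 3 * (riccD ν k - riccD ν' k)‖ ≤ δ + δ := by
      refine (norm_add_le _ _).trans (add_le_add ?_ ?_)
      · rw [norm_neg]; exact h k
      · rw [norm_mul, norm_div, RCLike.norm_ofNat, RCLike.norm_ofNat]; linarith
    have hp : 4 / 9 ≤ ‖ν k - 2 / 3 * riccD ν k‖ * ‖ν' k - 2 / 3 * riccD ν' k‖ := by nlinarith
    nlinarith

/-- Product of the downward Riccati values. -/
noncomputable def riccE (ν : ℕ → ℂ) (n j : ℕ) : ℂ := ∏ l ∈ Finset.range j, riccD ν (n - 1 - l)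

lemma norm_riccE_le {ν : ℕ → ℂ} (hν : ∀ l, 1 ≤ ‖ν l‖) (n j : ℕ) :
    ‖riccE ν n j‖ ≤ (1 / 2) ^ j := by
  rw [riccE, norm_prod]
  calc ∏ l ∈ Finset.range j, ‖riccD ν (n - 1 - l)‖ ≤ ∏ l ∈ Finset.range j, (1 / 2 : ℝ) :=
        Finset.prod_le_prod (fun _ _ => norm_nonneg _) fun _ _ => norm_riccD_le hν _
    _ = _ := by simp

lemma norm_riccE_sub_le {ν ν' : ℕ → ℂ} {δ : ℝ} (hν : ∀ l, 1 ≤ ‖ν l‖) (hν' : ∀ l, 1 ≤ ‖ν' l‖)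
    (h : ∀ l, ‖ν l - ν' l‖ ≤ δ) (n j : ℕ) : ‖riccE ν n j - riccE ν' n j‖ ≤ 3 * δ := by
  have hδ : 0 ≤ δ := (norm_nonneg _).trans (h 0)
  induction j with
  | zero => simp [riccE, hδ]
  | succ j ih =>
    have s : ∀ μ, riccE μ n (j + 1) = riccE μ n j * riccD μ (n - 1 - j) := fun μ =>
      Finset.prod_range_succ _ _
    rw [s, s]
    have e : riccE ν n j * riccD ν (n - 1 - j) - riccE ν' n j * riccD ν' (n - 1 - j) =
      (riccE ν n j - riccE ν' n j) * riccD ν (n - 1 - j) +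
        riccE ν' n j * (riccD ν (n - 1 - j) - riccD ν' (n - 1 - j)) := by ring
    rw [e]
    refine (norm_add_le _ _).trans ?_
    rw [norm_mul, norm_mul]
    have h1 := norm_riccD_le hν (n - 1 - j)
    have h2 := norm_riccE_le hν' n j
    have h3 := norm_riccD_sub_le hν hν' h (n - 1 - j)
    have h4 : ‖riccE ν' n j‖ ≤ 1 := h2.trans (pow_le_one₀ (by norm_num) (by norm_num))
    calc ‖riccE ν n j - riccE ν' n j‖ * ‖riccD ν (n - 1 - j)‖ +
          ‖riccE ν' n j‖ * ‖riccD ν (n - 1 - j) - riccD ν' (n - 1 - j)‖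
        ≤ 3 * δ * (1 / 2) + 1 * (3 / 2 * δ) := by gcongr
      _ = _ := by ring

/-- The Wronskian-type constant at frequency zero. -/
noncomputable def wronsk (n : ℕ) : ℝ :=
  (2 / 3 - 2 / 3 * riccD (fun _ => 1) (n - 1) - 1 / 3 * riccE (fun _ => 1) n (n - 1) : ℂ).re

lemma riccD_one_ofReal (k : ℕ) : ((riccD (fun _ => 1) k).re : ℂ) = riccD (fun _ => 1) k := by
  have : ∃ r : ℝ, riccD (fun _ => 1) k = r := by
    induction k with
    | zero => exact ⟨0, by simp [riccD]⟩
    | succ k ih =>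
      obtain ⟨r, hr⟩ := ih
      exact ⟨(1 / 3) / (1 - 2 / 3 * r), by rw [riccD, hr]; push_cast; rfl⟩
  obtain ⟨r, hr⟩ := this
  rw [hr, ofReal_re]

lemma wronsk_ofReal (n : ℕ) : (wronsk n : ℂ) =
    2 / 3 - 2 / 3 * riccD (fun _ => 1) (n - 1) - 1 / 3 * riccE (fun _ => 1) n (n - 1) := by
  have : ∃ r : ℝ, (2 / 3 - 2 / 3 * riccD (fun _ => 1) (n - 1) -
      1 / 3 * riccE (fun _ => 1) n (n - 1) : ℂ) = r := by
    refine ⟨2 / 3 - 2 / 3 * (riccD (fun _ => 1) (n - 1)).re - 1 / 3 *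
      ∏ l ∈ Finset.range (n - 1), (riccD (fun _ => 1) (n - 1 - l)).re, ?_⟩
    rw [riccE]
    push_cast
    simp only [riccD_one_ofReal]
  obtain ⟨r, hr⟩ := this
  rw [wronsk, hr, ofReal_re]

lemma wronsk_bounds {n : ℕ} (hn : 4 ≤ n) : 7 / 24 ≤ wronsk n ∧ wronsk n ≤ 2 := by
  have h1 := norm_riccD_le (ν := fun _ => 1) (by simp) (n - 1)
  have h2 := norm_riccE_le (ν := fun _ => 1) (by simp) n (n - 1)
  have h3 : ((1 : ℝ) / 2) ^ (n - 1) ≤ (1 / 2) ^ 3 :=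
    pow_le_pow_of_le_one (by norm_num) (by norm_num) (by omega)
  have a1 := abs_le.1 ((abs_re_le_norm _).trans h1)
  have a2 := abs_le.1 ((abs_re_le_norm _).trans h2)
  have e : wronsk n = 2 / 3 - 2 / 3 * (riccD (fun _ => 1) (n - 1)).re -
      1 / 3 * (riccE (fun _ => 1) n (n - 1)).re := by
    rw [wronsk]
    simp
  rw [e]
  norm_num at h3
  constructor <;> linarith

lemma norm_exp_sub_one_le_of_re_nonpos {z : ℂ} (hz : z.re ≤ 0) : ‖exp z - 1‖ ≤ ‖z‖ := by
  have := (convex_halfSpace_re_le 0).norm_image_sub_le_of_norm_deriv_le (𝕜 := ℂ) (f := exp)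
    (C := 1) (x := 0) (y := z) (fun x _ => differentiable_exp x) (fun x hx => ?_) (by simp) hz
  · simpa using this
  · rw [Complex.deriv_exp, norm_exp]
    exact Real.exp_le_one_iff.2 hx

lemma norm_prod_sub_prod_le {ι : Type*} (s : Finset ι) {a b : ι → ℂ} (ha : ∀ i, ‖a i‖ ≤ 1)
    (hb : ∀ i, ‖b i‖ ≤ 1) : ‖∏ i ∈ s, a i - ∏ i ∈ s, b i‖ ≤ ∑ i ∈ s, ‖a i - b i‖ := by
  classical
  induction s using Finset.induction_on with
  | empty => simp
  | insert i s hi ih =>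
    rw [Finset.prod_insert hi, Finset.prod_insert hi, Finset.sum_insert hi]
    have e : a i * ∏ i ∈ s, a i - b i * ∏ i ∈ s, b i =
      (a i - b i) * ∏ i ∈ s, a i + b i * (∏ i ∈ s, a i - ∏ i ∈ s, b i) := by ring
    rw [e]
    refine (norm_add_le _ _).trans (add_le_add ?_ ?_)
    · rw [norm_mul, norm_prod]
      exact mul_le_of_le_one_right (norm_nonneg _)
        (Finset.prod_le_one (fun _ _ => norm_nonneg _) fun i _ => ha i)
    · rw [norm_mul]
      exact (mul_le_of_le_one_left (norm_nonneg _) (hb i)).trans ih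

lemma RiccCoeff.norm_sum_add_le {κ : ℕ → ℂ} {η δ : ℝ} (h : RiccCoeff κ η δ) {m₀ : ℂ}
    (h0 : ‖m₀‖ ≤ 1) (h1 : ‖m₀ - 1‖ ≤ 3 * δ) {n : ℕ} (hper : riccM κ m₀ n = m₀) :
    ‖∑ l ∈ Finset.range n, (riccM κ m₀ (l + 1) - 1) + 3 * ∑ l ∈ Finset.range n, (κ l - 1)‖ ≤
      n * (18 * δ ^ 2) := by
  have hδ := h.delta_nonneg
  set ε : ℕ → ℂ := fun l => riccM κ m₀ l - 1 with hε
  have hb : ∀ l, ‖ε l‖ ≤ 3 * δ := fun l => (h.riccM_bound h0 h1 l).2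
  have hshift : ∑ l ∈ Finset.range n, ε (l + 1) = ∑ l ∈ Finset.range n, ε l := by
    have a := Finset.sum_range_succ ε n
    have b := Finset.sum_range_succ' ε n
    have c : ε n = ε 0 := by simp only [hε, hper, riccM]
    rw [a, c] at b
    exact (add_right_cancel b).symm
  have hrel : ∀ l, (κ l - 1) + 2 / 3 * ε (l + 1) - ε l / 3 =
      -(ε (l + 1) * ((κ l - 1) - ε l / 3)) := fun l => by
    have g := norm_riccM_den (η := 0) (by simpa using h.one_le l) (h.riccM_bound h0 h1 l).1
    have g0 : κ l - riccM κ m₀ l / 3 ≠ 0 := by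
      rw [← norm_pos_iff]; linarith
    have : riccM κ m₀ (l + 1) * (κ l - riccM κ m₀ l / 3) = 2 / 3 := by
      rw [riccM]; exact div_mul_cancel₀ _ g0
    simp only [hε]
    linear_combination this
  have hsum : ∑ l ∈ Finset.range n, ε (l + 1) + 3 * ∑ l ∈ Finset.range n, (κ l - 1) =
      ∑ l ∈ Finset.range n, -(3 * (ε (l + 1) * ((κ l - 1) - ε l / 3))) := by
    have : ∀ l, -(3 * (ε (l + 1) * ((κ l - 1) - ε l / 3))) =
        3 * (κ l - 1) + 2 * ε (l + 1) - ε l := fun l => by linear_combination (-3) * hrel l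
    rw [Finset.sum_congr rfl fun l _ => this l,
      Finset.sum_sub_distrib (fun l => 3 * (κ l - 1) + 2 * ε (l + 1)) ε, Finset.sum_add_distrib,
      ← Finset.mul_sum, ← Finset.mul_sum, ← hshift]
    ring
  rw [hsum]
  refine (norm_sum_le _ _).trans ?_
  have : ∀ l ∈ Finset.range n, ‖-(3 * (ε (l + 1) * ((κ l - 1) - ε l / 3)))‖ ≤ 18 * δ ^ 2 := by
    intro l _
    rw [norm_neg, norm_mul, norm_mul, RCLike.norm_ofNat]
    have a : ‖(κ l - 1) - ε l / 3‖ ≤ δ + δ := by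
      refine (norm_sub_le _ _).trans (add_le_add (h.norm_sub l) ?_)
      rw [norm_div, RCLike.norm_ofNat]
      linarith [hb l]
    calc 3 * (‖ε (l + 1)‖ * ‖(κ l - 1) - ε l / 3‖) ≤ 3 * ((3 * δ) * (δ + δ)) := by
          gcongr; exact hb _
      _ = _ := by ring
  refine (Finset.sum_le_sum this).trans ?_
  simp

lemma norm_sub_exp_sum_le {ε : ℕ → ℂ} {γ : ℝ} (n : ℕ) (h : ∀ l, ‖1 + ε l‖ ≤ 1)
    (hγ : ∀ l, ‖ε l‖ ≤ γ) (hγ1 : γ ≤ 1) :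
    ‖∏ l ∈ Finset.range n, (1 + ε l) - exp (∑ l ∈ Finset.range n, ε l)‖ ≤ n * γ ^ 2 := by
  rw [exp_sum]
  have hre : ∀ l, (ε l).re ≤ 0 := fun l => by
    have := (re_le_norm (1 + ε l)).trans (h l)
    simp at this
    exact this
  refine (norm_prod_sub_prod_le _ h fun l => ?_).trans ?_
  · rw [norm_exp]; exact Real.exp_le_one_iff.2 (hre l)
  · calc ∑ l ∈ Finset.range n, ‖1 + ε l - exp (ε l)‖ ≤ ∑ l ∈ Finset.range n, γ ^ 2 := by
          refine Finset.sum_le_sum fun l _ => ?_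
          have := norm_exp_sub_one_sub_id_le ((hγ l).trans hγ1)
          rw [← norm_neg] at this
          calc ‖1 + ε l - exp (ε l)‖ = ‖-(exp (ε l) - 1 - ε l)‖ := by congr 1; ring
            _ ≤ ‖ε l‖ ^ 2 := this
            _ ≤ _ := by gcongr; exact hγ l
      _ = _ := by simp

end TwoCycle

namespace TwoCycle

open Complex

/-- The coefficient `(e^{-iθ} - h) / (1 - h)` for `w = 1 / (1 - h)`. -/
noncomputable def kap (θ : ℝ) (w : ℝ) : ℂ := 1 + (exp (-(θ * I)) - 1) * w

lemma norm_exp_neg_sub_one_le (θ : ℝ) : ‖exp (-(θ * I)) - 1‖ ≤ |θ| := by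
  have := Real.norm_exp_I_mul_ofReal_sub_one_le (x := -θ)
  rw [Real.norm_eq_abs, abs_neg] at this
  convert this using 4
  push_cast; ring

lemma exp_neg_mul_I (θ : ℝ) : exp (-(θ * I)) = Real.cos θ - Real.sin θ * I := by
  have : (-(θ * I) : ℂ) = ((-θ : ℝ) : ℂ) * I := by push_cast; ring
  rw [this, exp_mul_I, ← ofReal_cos, ← ofReal_sin, Real.cos_neg, Real.sin_neg]
  push_cast; ring

lemma kap_bounds {θ w : ℝ} (hθ : |θ| ≤ Real.pi) (h2 : 2 ≤ w) (h3 : w ≤ 3) :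
    1 + θ ^ 2 / 10 ≤ ‖kap θ w‖ ∧ ‖kap θ w - 1‖ ≤ 3 * |θ| := by
  constructor
  · have hsq : ‖kap θ w‖ ^ 2 = 1 + 2 * (w * (w - 1)) * (1 - Real.cos θ) := by
      rw [← normSq_eq_norm_sq, kap, exp_neg_mul_I, normSq_apply]
      simp only [add_re, one_re, mul_re, sub_re, ofReal_re, I_re, I_im, ofReal_im, add_im, one_im,
        mul_im, sub_im]
      linear_combination w ^ 2 * Real.sin_sq_add_cos_sq θ
    have hc : Real.cos θ ≤ 1 - 2 / Real.pi ^ 2 * θ ^ 2 := Real.cos_le_one_sub_mul_cos_sq hθ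
    have hpi : Real.pi ^ 2 ≤ 10 := by nlinarith [Real.pi_lt_d2, Real.pi_pos]
    have h5 : 1 / 5 * θ ^ 2 ≤ 2 / Real.pi ^ 2 * θ ^ 2 := by
      refine mul_le_mul_of_nonneg_right ?_ (sq_nonneg θ)
      rw [div_le_div_iff₀ (by norm_num) (by positivity)]
      linarith
    have hθ2 : θ ^ 2 ≤ 10 := by
      have : θ ^ 2 ≤ Real.pi ^ 2 := sq_le_sq' (by linarith [(abs_le.1 hθ).1]) (abs_le.1 hθ).2
      linarith
    have h6 : θ ^ 2 / 5 ≤ 1 - Real.cos θ := by linarith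
    have hw : 2 ≤ w * (w - 1) := by nlinarith
    have h7 : (1 + θ ^ 2 / 10) ^ 2 ≤ ‖kap θ w‖ ^ 2 := by
      rw [hsq]
      nlinarith [sq_nonneg θ]
    exact le_of_sq_le_sq h7 (norm_nonneg _)
  · have e : kap θ w - 1 = (exp (-(θ * I)) - 1) * w := by rw [kap]; ring
    rw [e, norm_mul, norm_real, Real.norm_eq_abs, abs_of_nonneg (by linarith), mul_comm]
    gcongr
    exact norm_exp_neg_sub_one_le θ

lemma riccCoeff_kap {θ : ℝ} {w : ℕ → ℝ} (hθ : |θ| ≤ Real.pi) (hw : ∀ l, 2 ≤ w l ∧ w l ≤ 3) :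
    RiccCoeff (fun l => kap θ (w l)) (θ ^ 2 / 10) (3 * |θ|) where
  nonneg := by positivity
  norm_ge l := (kap_bounds hθ (hw l).1 (hw l).2).1
  norm_sub l := (kap_bounds hθ (hw l).1 (hw l).2).2

lemma norm_exp_sub_one_sub_le (θ : ℝ) : ‖exp (-(θ * I)) - 1 + θ * I‖ ≤ 3 * θ ^ 2 := by
  rcases le_total |θ| 1 with h | h
  · have hn : ‖(-(θ * I) : ℂ)‖ = |θ| := by simp
    have := norm_exp_sub_one_sub_id_le (x := -(θ * I)) (by rwa [hn])
    rw [hn, sq_abs, sub_neg_eq_add] at this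
    nlinarith [sq_nonneg θ]
  · have h1 := norm_exp_neg_sub_one_le θ
    have h2 : ‖(θ * I : ℂ)‖ = |θ| := by simp
    refine (norm_add_le _ _).trans ?_
    rw [h2]
    nlinarith [sq_abs θ]

/-- On one cycle of length `n`, there is a solution of the eigenvalue equation with value `1` at
both ends, and the defect at the glued vertex factors as `(1 - m) * W`. -/
lemma exists_cycle_solution {n : ℕ} (hn : 4 ≤ n) {w : ℕ → ℝ} (hw : ∀ l, 2 ≤ w l ∧ w l ≤ 3)
    {θ : ℝ} (hθ : |θ| ≤ Real.pi) :
    ∃ (f : ℕ → ℂ) (m W : ℂ), f 0 = 1 ∧ f n = 1 ∧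
      (∀ j, j + 1 < n → kap θ (w (j + 1)) * f (j + 1) = 2 / 3 * f (j + 2) + 1 / 3 * f j) ∧
      kap θ (w 0) - (2 / 3 * f 1 + 1 / 3 * f (n - 1)) = (1 - m) * W ∧
      ‖m‖ ≤ 1 / (1 + 3 / 20 * (n * θ ^ 2)) ∧
      (|θ| ≤ 1 / 9 → ‖m - exp ((θ * (3 * ∑ l ∈ Finset.range n, w l) : ℝ) * I)‖ ≤
        270 * (n * θ ^ 2)) ∧
      ‖W - wronsk n‖ ≤ 12 * |θ| := by
  set κ : ℕ → ℂ := fun l => kap θ (w l) with hκ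
  have hc : RiccCoeff κ (θ ^ 2 / 10) (3 * |θ|) := riccCoeff_kap hθ hw
  obtain ⟨m₀, h0, h1, hper⟩ := hc.exists_periodic (n - 1)
  have hn1 : n - 1 + 1 = n := by omega
  rw [hn1] at hper
  set M : ℕ → ℂ := riccM κ m₀ with hM
  set ν : ℕ → ℂ := fun k => κ (n - 1 - k) with hν
  have hν1 : ∀ l, 1 ≤ ‖ν l‖ := fun l => hc.one_le _
  have hMstep : ∀ l, M (l + 1) * (κ l - M l / 3) = 2 / 3 := fun l => by
    have g := norm_riccM_den (η := 0) (by simpa using hc.one_le l) (hc.riccM_bound h0 h1 l).1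
    have g0 : κ l - riccM κ m₀ l / 3 ≠ 0 := by
      rw [← norm_pos_iff]; linarith
    rw [hM, riccM]; exact div_mul_cancel₀ _ g0
  have hDstep : ∀ k, riccD ν (k + 1) * (ν k - 2 / 3 * riccD ν k) = 1 / 3 := fun k => by
    have g := norm_riccD_den (hν1 k) (norm_riccD_le hν1 k)
    have g0 : ν k - 2 / 3 * riccD ν k ≠ 0 := by
      rw [← norm_pos_iff]; linarith
    rw [riccD]; exact div_mul_cancel₀ _ g0
  set y : ℕ → ℂ := fun j => ∏ l ∈ Finset.Ico j n, M (l + 1) with hy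
  set e : ℕ → ℂ := riccE ν n with he
  have hyn : y n = 1 := by simp [hy]
  have hys : ∀ j, j < n → y j = M (j + 1) * y (j + 1) := fun j hj => by
    simp only [hy]; rw [Finset.prod_eq_prod_Ico_succ_bot hj]
  have hes : ∀ j, e (j + 1) = e j * riccD ν (n - 1 - j) := fun j => Finset.prod_range_succ _ _
  have he0 : e 0 = 1 := by simp [he, riccE]
  have hen : e n = 0 := by
    have := hes (n - 1)
    rw [hn1] at this
    rw [this]; simp [riccD]
  have hM0 : M 0 = m₀ := rfl
  have hMn : M n = M 0 := by rw [hM0]; exact hper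
  have hyrec : ∀ j, j + 1 < n → κ (j + 1) * y (j + 1) = 2 / 3 * y (j + 2) + 1 / 3 * y j := by
    intro j hj
    rw [hys j (by omega), hys (j + 1) hj]
    linear_combination (y (j + 2)) * hMstep (j + 1)
  have herec : ∀ j, j + 1 < n → κ (j + 1) * e (j + 1) = 2 / 3 * e (j + 2) + 1 / 3 * e j := by
    intro j hj
    have a := hes j
    have b := hes (j + 1)
    have c := hDstep (n - 1 - (j + 1))
    have d1 : n - 1 - (j + 1) + 1 = n - 1 - j := by omega
    have d2 : ν (n - 1 - (j + 1)) = κ (j + 1) := by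
      simp only [hν]; congr 1; omega
    rw [d1, d2] at c
    rw [b, a]
    linear_combination (e j) * c
  refine ⟨fun j => y j + (1 - y 0) * e j, y 0,
    κ 0 - M 0 / 3 - 2 / 3 * riccD ν (n - 1) - 1 / 3 * e (n - 1), ?_, ?_, ?_, ?_, ?_, ?_, ?_⟩
  · simp only [he0]; ring
  · simp only [hen, hyn]; ring
  · intro j hj
    have a := hyrec j hj
    have b := herec j hj
    simp only [hκ] at a b
    linear_combination a + (1 - y 0) * b
  · have a := hys 0 (by omega)
    have b := hys (n - 1) (by omega)
    rw [hn1, hyn, mul_one, hMn] at b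
    have c := hes 0
    rw [he0, Nat.sub_zero, one_mul] at c
    have d := hMstep 0
    simp only [zero_add] at a c d
    simp only [b, c]
    change κ 0 - _ = _
    linear_combination (κ 0 - M 0 / 3) * a + (y 1) * d
  · have : ‖y 0‖ ≤ ∏ l ∈ Finset.Ico 0 n, (1 / (1 + 3 / 2 * (θ ^ 2 / 10)) : ℝ) := by
      simp only [hy]
      rw [norm_prod]
      exact Finset.prod_le_prod (fun _ _ => norm_nonneg _) fun l _ => hc.riccM_succ_le h0 h1 l
    refine this.trans ?_
    rw [Finset.prod_const, Nat.card_Ico, Nat.sub_zero, div_pow, one_pow]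
    apply one_div_le_one_div_of_le (by positivity)
    have := one_add_mul_le_pow (a := 3 / 2 * (θ ^ 2 / 10)) (by linarith [sq_nonneg θ]) n
    refine le_trans (le_of_eq ?_) this
    ring
  · intro hθ9
    have b1 : ∀ l, ‖1 + (M (l + 1) - 1)‖ ≤ 1 := fun l => by
      rw [add_sub_cancel]; exact (hc.riccM_bound h0 h1 (l + 1)).1
    have b2 : ∀ l, ‖M (l + 1) - 1‖ ≤ 9 * |θ| := fun l => by
      have := (hc.riccM_bound h0 h1 (l + 1)).2
      refine this.trans (le_of_eq ?_); ring
    have p1 := norm_sub_exp_sum_le (ε := fun l => M (l + 1) - 1) n b1 b2 (by linarith)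
    have p2 := hc.norm_sum_add_le h0 h1 hper
    set E : ℂ := ∑ l ∈ Finset.range n, (M (l + 1) - 1) with hE
    set T : ℝ := 3 * ∑ l ∈ Finset.range n, w l with hT
    have hTn : |T| ≤ 9 * n := by
      have : ∑ l ∈ Finset.range n, w l ≤ ∑ l ∈ Finset.range n, 3 :=
        Finset.sum_le_sum fun l _ => (hw l).2
      have h' : 0 ≤ ∑ l ∈ Finset.range n, w l :=
        Finset.sum_nonneg fun l _ => by linarith [(hw l).1]
      rw [abs_of_nonneg (by positivity)]
      simp at this
      rw [hT]; linarith
    have p3 : ‖E - (θ * T : ℝ) * I‖ ≤ n * (18 * (3 * |θ|) ^ 2) + 9 * n * (3 * θ ^ 2) := by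
      have e1 : 3 * ∑ l ∈ Finset.range n, (κ l - 1) = (exp (-(θ * I)) - 1) * T := by
        have : ∀ l, κ l - 1 = (exp (-(θ * I)) - 1) * w l := fun l => by
          simp only [hκ, kap]; ring
        simp only [this]
        rw [← Finset.mul_sum, hT]; push_cast; ring
      have e2 : E - (θ * T : ℝ) * I = (E + 3 * ∑ l ∈ Finset.range n, (κ l - 1)) -
          T * (exp (-(θ * I)) - 1 + θ * I) := by
        rw [e1]; push_cast; ring
      rw [e2]
      refine (norm_sub_le _ _).trans (add_le_add p2 ?_)
      rw [norm_mul, norm_real, Real.norm_eq_abs]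
      exact mul_le_mul hTn (norm_exp_sub_one_sub_le θ) (norm_nonneg _) (by positivity)
    have hre : E.re ≤ 0 := by
      rw [hE, re_sum]
      refine Finset.sum_nonpos fun l _ => ?_
      have := (re_le_norm _).trans (b1 l)
      rw [add_re, one_re] at this
      linarith
    have p4 : ‖exp E - exp ((θ * T : ℝ) * I)‖ ≤ ‖E - (θ * T : ℝ) * I‖ := by
      have e3 : exp E - exp ((θ * T : ℝ) * I) =
          exp ((θ * T : ℝ) * I) * (exp (E - (θ * T : ℝ) * I) - 1) := by
        rw [mul_sub, ← exp_add, mul_one]; congr 2; ring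
      rw [e3, norm_mul, norm_exp_ofReal_mul_I, one_mul]
      refine norm_exp_sub_one_le_of_re_nonpos ?_
      simpa using hre
    have e4 : y 0 = ∏ l ∈ Finset.range n, (1 + (M (l + 1) - 1)) := by
      simp only [hy, add_sub_cancel]
      rw [Finset.range_eq_Ico]
    have e5 : y 0 - exp ((θ * T : ℝ) * I) = (y 0 - exp E) + (exp E - exp ((θ * T : ℝ) * I)) := by
      ring
    rw [e5]
    refine (norm_add_le _ _).trans ?_
    rw [← e4] at p1
    have := add_le_add p1 (p4.trans p3)
    refine this.trans (le_of_eq ?_)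
    rw [mul_pow, mul_pow, sq_abs]; ring
  · rw [wronsk_ofReal]
    have hone : ∀ l : ℕ, 1 ≤ ‖(fun _ : ℕ => (1 : ℂ)) l‖ := by simp
    have hd : ∀ l, ‖ν l - (fun _ => (1 : ℂ)) l‖ ≤ 3 * |θ| := fun l => hc.norm_sub _
    have a := norm_riccD_sub_le hν1 hone hd (n - 1)
    have b := norm_riccE_sub_le hν1 hone hd n (n - 1)
    have c := hc.norm_sub 0
    have e6 : κ 0 - M 0 / 3 - 2 / 3 * riccD ν (n - 1) - 1 / 3 * e (n - 1) -
        (2 / 3 - 2 / 3 * riccD (fun _ => 1) (n - 1) - 1 / 3 * riccE (fun _ => 1) n (n - 1)) =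
        ((κ 0 - 1) - (m₀ - 1) / 3) - (2 / 3 * (riccD ν (n - 1) - riccD (fun _ => 1) (n - 1)) +
          1 / 3 * (riccE ν n (n - 1) - riccE (fun _ => 1) n (n - 1))) := by
      rw [he, hM0]; ring
    rw [e6]
    have t1 : ‖(κ 0 - 1) - (m₀ - 1) / 3‖ ≤ 3 * |θ| + 3 * |θ| := by
      refine (norm_sub_le _ _).trans (add_le_add c ?_)
      rw [norm_div, RCLike.norm_ofNat]; linarith
    have t2 : ‖2 / 3 * (riccD ν (n - 1) - riccD (fun _ => 1) (n - 1)) +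
          1 / 3 * (riccE ν n (n - 1) - riccE (fun _ => 1) n (n - 1))‖ ≤ 3 * |θ| + 3 * |θ| := by
      refine (norm_add_le _ _).trans (add_le_add ?_ ?_)
      · rw [norm_mul, norm_div, RCLike.norm_ofNat, RCLike.norm_ofNat]; linarith
      · rw [norm_mul, norm_div, norm_one, RCLike.norm_ofNat]; linarith
    refine (norm_sub_le _ _).trans ?_
    linarith

end TwoCycle

namespace TwoCycle

lemma goldenAlpha_eq : goldenAlpha = (Real.sqrt 5 - 1) / 2 := by
  have h5 : Real.sqrt 5 ^ 2 = 5 := Real.sq_sqrt (by norm_num)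
  have h0 : 0 ≤ Real.sqrt 5 := Real.sqrt_nonneg 5
  rw [goldenAlpha, div_eq_div_iff (by linarith) (by norm_num)]
  nlinarith

lemma sqrt_five_bounds : 2.236 ≤ Real.sqrt 5 ∧ Real.sqrt 5 ≤ 2.237 :=
  ⟨Real.le_sqrt_of_sq_le (by norm_num), Real.sqrt_le_iff.2 (by norm_num)⟩

/-- Holding probability as a function of the position on a cycle. -/
noncomputable def chold (n : ℕ) (i : Fin 2) (l : ℕ) : ℝ :=
  if i = 0 ∧ n / 4 ≤ l ∧ l ≤ 3 * n / 4 then goldenAlpha else 1 / 2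

/-- Mean holding time as a function of the position on a cycle. -/
noncomputable def cw (n : ℕ) (i : Fin 2) (l : ℕ) : ℝ :=
  if i = 0 ∧ n / 4 ≤ l ∧ l ≤ 3 * n / 4 then (3 + Real.sqrt 5) / 2 else 2

lemma chold_bounds (n : ℕ) (i : Fin 2) (l : ℕ) : 1 / 2 ≤ chold n i l ∧ chold n i l ≤ 5 / 8 := by
  have := sqrt_five_bounds
  rw [chold, goldenAlpha_eq]
  split_ifs <;> constructor <;> norm_num at * <;> linarith

lemma cw_mul (n : ℕ) (i : Fin 2) (l : ℕ) : (1 - chold n i l) * cw n i l = 1 := by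
  have h5 : Real.sqrt 5 ^ 2 = 5 := Real.sq_sqrt (by norm_num)
  rw [chold, cw, goldenAlpha_eq]
  split_ifs
  · nlinarith
  · norm_num

lemma cw_bounds (n : ℕ) (i : Fin 2) (l : ℕ) : 2 ≤ cw n i l ∧ cw n i l ≤ 3 := by
  have := sqrt_five_bounds
  rw [cw]
  split_ifs <;> constructor <;> norm_num at * <;> linarith

lemma cw_zero {n : ℕ} (hn : 4 ≤ n) (i : Fin 2) : cw n i 0 = 2 := by
  rw [cw, if_neg]
  rintro ⟨-, h, -⟩
  omega

lemma tcHold_inr (n : ℕ) (i : Fin 2) (j : Fin (n - 1)) :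
    tcHold n (Sum.inr (i, j)) = chold n i (j + 1) := rfl

/-- The restriction of a function on states to cycle `i`, in position coordinates. -/
def cyc {n : ℕ} {E : Type*} (g : TwoCycleState n → E) (i : Fin 2) (j : ℕ) : E :=
  if h : j - 1 < n - 1 ∧ j ≠ 0 then g (Sum.inr (i, ⟨j - 1, h.1⟩)) else g (Sum.inl ())

lemma cyc_succ {n : ℕ} {E : Type*} (g : TwoCycleState n → E) (i : Fin 2) (j : Fin (n - 1)) :
    cyc g i (j + 1) = g (Sum.inr (i, j)) := by simp [cyc]

/-- Glue functions on the two cycles to a function on states. -/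
def glue {n : ℕ} {E : Type*} (F : Fin 2 → ℕ → E) : TwoCycleState n → E
  | Sum.inl _ => F 0 0
  | Sum.inr (i, j) => F i (j + 1)

lemma cyc_glue {n : ℕ} (hn : 0 < n) {E : Type*} {F : Fin 2 → ℕ → E}
    (h0 : ∀ i, F i 0 = F 0 0) (h1 : ∀ i, F i n = F 0 0)
    (i : Fin 2) {j : ℕ} (hj : j ≤ n) : cyc (n := n) (glue F) i j = F i j := by
  rw [cyc]
  split_ifs with h
  · simp only [glue]
    congr 1
    omega
  · simp only [glue]
    have : j = 0 ∨ j = n := by omega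
    rcases this with rfl | rfl
    · exact (h0 i).symm
    · exact (h1 i).symm

section sums

variable {E : Type*} [AddCommGroup E] [Module ℝ E]

lemma sum_fin_ite_smul {N : ℕ} (k : ℕ) (c : ℝ) (g : Fin N → E) :
    ∑ j : Fin N, (if (j : ℕ) = k then c else 0) • g j =
      if h : k < N then c • g ⟨k, h⟩ else 0 := by
  split_ifs with h
  · rw [Finset.sum_eq_single ⟨k, h⟩]
    · simp
    · intro j _ hj
      rw [if_neg, zero_smul]
      exact fun h' => hj (Fin.ext h')
    · simp
  · refine Finset.sum_eq_zero fun j _ => ?_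
    rw [if_neg, zero_smul]
    exact fun h' => h (h' ▸ j.2)

lemma sum_tcP_eq (n : ℕ) (x : TwoCycleState n) (g : TwoCycleState n → E) :
    ∑ y, tcP n x y • g y = tcHold n x • g x + (1 - tcHold n x) • ∑ y, tcStep n x y • g y := by
  simp only [tcP, add_smul, Finset.sum_add_distrib, mul_smul, ← Finset.smul_sum]
  simp

lemma sum_tcP_inr {n : ℕ} (hn : 4 ≤ n) (i : Fin 2) (j : Fin (n - 1)) (g : TwoCycleState n → E) :
    ∑ y, tcP n (Sum.inr (i, j)) y • g y = chold n i (j + 1) • cyc g i (j + 1) +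
      (1 - chold n i (j + 1)) • ((2 / 3 : ℝ) • cyc g i (j + 2) + (1 / 3 : ℝ) • cyc g i j) := by
  rw [sum_tcP_eq, cyc_succ, tcHold_inr]
  congr 2
  rw [Fintype.sum_sum_type, Fintype.sum_prod_type]
  simp only [tcStep, Finset.univ_unique, Finset.sum_singleton]
  rw [Finset.sum_eq_single i (by
    intro b _ hb
    refine Finset.sum_eq_zero fun k _ => ?_
    rw [if_neg (Ne.symm hb), zero_smul]) (by simp)]
  simp only [if_true, add_smul, Finset.sum_add_distrib]
  have e1 := sum_fin_ite_smul ((j : ℕ) + 1) (2 / 3) (fun k : Fin (n - 1) => g (Sum.inr (i, k)))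
  have e2 : ∑ k : Fin (n - 1), (if (k : ℕ) + 1 = j then (1 / 3 : ℝ) else 0) • g (Sum.inr (i, k)) =
      if h : (j : ℕ) = 0 then 0 else (1 / 3 : ℝ) • g (Sum.inr (i, ⟨(j : ℕ) - 1, by omega⟩)) := by
    split_ifs with h
    · refine Finset.sum_eq_zero fun k _ => ?_
      rw [if_neg (by omega), zero_smul]
    · have e3 := sum_fin_ite_smul ((j : ℕ) - 1) (1 / 3) (fun k : Fin (n - 1) => g (Sum.inr (i, k)))
      rw [dif_pos (by omega)] at e3
      rw [← e3]
      refine Finset.sum_congr rfl fun k _ => ?_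
      congr 1
      refine if_congr ?_ rfl rfl
      omega
  rw [e1, e2]
  have hj := j.2
  have hd : (default : Unit) = () := rfl
  rw [hd]
  simp only [cyc]
  by_cases h1 : (j : ℕ) + 2 = n <;> by_cases h2 : (j : ℕ) = 0
  · omega
  · have : ¬ (j : ℕ) + 1 < n - 1 := by omega
    have h3 : (j : ℕ) - 1 < n - 1 := by omega
    simp [h1, h2, this, h3]
  · have : 1 < n - 1 := by omega
    have h3 : (2 : ℕ) ≠ n := by omega
    simp [h2, this, h3, add_comm]
  · have : (j : ℕ) + 1 < n - 1 := by omega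
    have h3 : (j : ℕ) - 1 < n - 1 := by omega
    simp [h1, h2, this, h3]

lemma sum_tcP_inl {n : ℕ} (hn : 4 ≤ n) (g : TwoCycleState n → E) :
    ∑ y, tcP n (Sum.inl ()) y • g y = (1 / 2 : ℝ) • g (Sum.inl ()) +
      (1 / 4 : ℝ) • ∑ i, ((2 / 3 : ℝ) • cyc g i 1 + (1 / 3 : ℝ) • cyc g i (n - 1)) := by
  rw [sum_tcP_eq]
  have hh : tcHold n (Sum.inl ()) = 1 / 2 := rfl
  rw [hh]
  congr 1
  rw [Fintype.sum_sum_type, Fintype.sum_prod_type]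
  simp only [tcStep, Finset.univ_unique, Finset.sum_singleton, zero_smul, zero_add, add_smul,
    Finset.sum_add_distrib]
  have e1 : ∀ i, ∑ k : Fin (n - 1), (if (k : ℕ) = 0 then (1 / 3 : ℝ) else 0) • g (Sum.inr (i, k)) =
      (1 / 3 : ℝ) • cyc g i 1 := fun i => by
    rw [sum_fin_ite_smul 0 (1 / 3) (fun k : Fin (n - 1) => g (Sum.inr (i, k))),
      dif_pos (by omega), cyc, dif_pos (by omega)]
  have e2 : ∀ i, ∑ k : Fin (n - 1), (if (k : ℕ) + 2 = n then (1 / 6 : ℝ) else 0) •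
      g (Sum.inr (i, k)) = (1 / 6 : ℝ) • cyc g i (n - 1) := fun i => by
    have := sum_fin_ite_smul (n - 2) (1 / 6) (fun k : Fin (n - 1) => g (Sum.inr (i, k)))
    rw [dif_pos (by omega)] at this
    rw [cyc, dif_pos (by omega)]
    simp only [show n - 1 - 1 = n - 2 by omega]
    rw [← this]
    refine Finset.sum_congr rfl fun k _ => ?_
    congr 1
    refine if_congr ?_ rfl rfl
    omega
  simp only [e1, e2, ← Finset.smul_sum, smul_add, smul_smul]
  norm_num

end sums

lemma tcHold_bounds (n : ℕ) (x : TwoCycleState n) : 1 / 2 ≤ tcHold n x ∧ tcHold n x ≤ 5 / 8 := by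
  rcases x with _ | ⟨i, j⟩
  · exact ⟨le_rfl, by norm_num [tcHold]⟩
  · exact chold_bounds n i (j + 1)

lemma tcStep_nonneg (n : ℕ) (x y : TwoCycleState n) : 0 ≤ tcStep n x y := by
  rcases x with _ | ⟨i, j⟩ <;> rcases y with _ | ⟨i', j'⟩ <;> simp only [tcStep] <;>
    (try split_ifs) <;> norm_num

lemma tcP_nonneg (n : ℕ) (x y : TwoCycleState n) : 0 ≤ tcP n x y := by
  have h := tcHold_bounds n x
  have h' := tcStep_nonneg n x y
  have : 0 ≤ 1 - tcHold n x := by linarith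
  rw [tcP]
  split_ifs
  · have : 0 ≤ tcHold n x := by linarith
    positivity
  · positivity

lemma cyc_const {n : ℕ} {E : Type*} (c : E) (i : Fin 2) (j : ℕ) :
    cyc (n := n) (fun _ => c) i j = c := by simp [cyc]

lemma tcP_row_sum {n : ℕ} (hn : 4 ≤ n) (x : TwoCycleState n) : ∑ y, tcP n x y = 1 := by
  have e : ∑ y, tcP n x y = ∑ y, tcP n x y • (1 : ℝ) := by simp
  rw [e]
  rcases x with u | ⟨i, j⟩
  · rw [sum_tcP_inl hn]
    simp only [cyc_const]
    norm_num
  · rw [sum_tcP_inr hn]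
    simp only [cyc_const]
    norm_num

end TwoCycle

namespace TwoCycle

open Complex

lemma norm_sum_le_sum_mul {V : Type*} [Fintype V] {P : Matrix V V ℝ}
    (h0 : ∀ x y, 0 ≤ P x y) (g : V → ℂ) (x : V) :
    ‖∑ y, (P x y : ℂ) * g y‖ ≤ ∑ y, P x y * ‖g y‖ := by
  refine (norm_sum_le _ _).trans (Finset.sum_le_sum fun y _ => ?_)
  rw [norm_mul, norm_real, Real.norm_of_nonneg (h0 x y)]

section Killed

variable {V : Type*} [Fintype V] [DecidableEq V] {P : Matrix V V ℝ} {o : V}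

lemma fser_surv_eq {L : ℝ} (h : ∀ x, SurvBound (fun t => surv P o t x) L) (x : V) (θ : ℝ) :
    fser (fun t => surv P o t x) θ = 1 + exp (θ * I) *
      ∑ y, (P x y : ℂ) * (if y = o then 0 else fser (fun t => surv P o t y) θ) := by
  have hs := fun y => ((h y).rapid.summable_norm θ).of_norm
  conv_lhs => rw [fser, (hs x).tsum_eq_zero_add]
  congr 1
  · simp [surv]
  · have e : ∀ t : ℕ, ((surv P o (t + 1) x : ℝ) : ℂ) * exp ((t + 1 : ℕ) * θ * I) =
        ∑ y, exp (θ * I) * ((P x y : ℂ) * (if y = o then 0 else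
          ((surv P o t y : ℝ) : ℂ) * exp (t * θ * I))) := fun t => by
      have : exp ((t + 1 : ℕ) * θ * I) = exp (θ * I) * exp (t * θ * I) := by
        rw [← exp_add]; congr 1; push_cast; ring
      rw [this, surv, ofReal_sum, Finset.sum_mul]
      refine Finset.sum_congr rfl fun y _ => ?_
      split_ifs
      · simp
      · push_cast; ring
    simp only [e]
    have hs' : ∀ y, Summable fun t : ℕ => exp (θ * I) * ((P x y : ℂ) * (if y = o then 0 else
          ((surv P o t y : ℝ) : ℂ) * exp (t * θ * I))) := fun y => by
      refine (Summable.mul_left _ ?_).mul_left _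
      split_ifs
      · exact summable_zero
      · exact hs y
    rw [Summable.tsum_finsetSum fun y _ => hs' y, Finset.mul_sum]
    refine Finset.sum_congr rfl fun y _ => ?_
    rw [tsum_mul_left, tsum_mul_left]
    congr 2
    split_ifs
    · simp
    · rfl

/-- A solution of `f = z P f` off `o` with `f o = 1` is bounded by `1`. -/
lemma norm_le_one_of_harmonic (h0 : ∀ x y, 0 ≤ P x y) (h1 : ∀ x, ∑ y, P x y = 1)
    (hlim : ∀ x, Filter.Tendsto (fun t => surv P o t x) Filter.atTop (nhds 0))
    {f : V → ℂ} {θ : ℝ} (ho : f o = 1)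
    (hf : ∀ x, x ≠ o → f x = exp (θ * I) * ∑ y, (P x y : ℂ) * f y) (x : V) : ‖f x‖ ≤ 1 := by
  have := subharmonic_nonpos (g := fun x => max (‖f x‖ - 1) 0) h0 (by simp [ho]) ?_ hlim x
  · have h' := le_max_left (‖f x‖ - 1) 0
    linarith
  · intro x hx
    refine max_le ?_ (Finset.sum_nonneg fun y _ => mul_nonneg (h0 x y) (le_max_right _ _))
    have : ‖f x‖ ≤ ∑ y, P x y * ‖f y‖ := by
      rw [hf x hx, norm_mul, norm_exp_ofReal_mul_I, one_mul]
      exact norm_sum_le_sum_mul h0 f x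
    have e : ∑ y, P x y * (‖f y‖ - 1) = ∑ y, P x y * ‖f y‖ - 1 := by
      simp only [mul_sub, mul_one, Finset.sum_sub_distrib, h1]
    calc ‖f x‖ - 1 ≤ ∑ y, P x y * (‖f y‖ - 1) := by rw [e]; linarith
      _ ≤ _ := Finset.sum_le_sum fun y _ => mul_le_mul_of_nonneg_left (le_max_left _ _) (h0 x y)

/-- The transform of the survival sequence at `o` in terms of the harmonic function. -/
lemma one_sub_mul_fser_surv (h0 : ∀ x y, 0 ≤ P x y) (h1 : ∀ x, ∑ y, P x y = 1)
    (hlim : ∀ x, Filter.Tendsto (fun t => surv P o t x) Filter.atTop (nhds 0))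
    {L : ℝ} (h : ∀ x, SurvBound (fun t => surv P o t x) L)
    {f : V → ℂ} {θ : ℝ} (ho : f o = 1)
    (hf : ∀ x, x ≠ o → f x = exp (θ * I) * ∑ y, (P x y : ℂ) * f y) :
    (1 - exp (θ * I)) * fser (fun t => surv P o t o) θ =
      1 - exp (θ * I) * ∑ y, (P o y : ℂ) * f y := by
  set z := exp (θ * I) with hz
  have hzn : ‖z‖ = 1 := norm_exp_ofReal_mul_I θ
  set S : V → ℂ := fun x => fser (fun t => surv P o t x) θ with hS
  set g : V → ℂ := fun x => if x = o then 1 else 1 - (1 - z) * S x with hg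
  have hP1 : ∀ x, ∑ y, (P x y : ℂ) = 1 := fun x => by rw [← ofReal_sum, h1, ofReal_one]
  have hgrec : ∀ x, z * ∑ y, (P x y : ℂ) * g y = 1 - (1 - z) * S x := fun x => by
    have e1 : ∀ y, (P x y : ℂ) * g y =
        P x y - (1 - z) * ((P x y : ℂ) * (if y = o then 0 else S y)) :=
      fun y => by
        simp only [hg]
        split_ifs <;> ring
    have e2 : S x = 1 + z * ∑ y, (P x y : ℂ) * (if y = o then 0 else S y) := fser_surv_eq h x θ
    rw [Finset.sum_congr rfl fun y _ => e1 y, Finset.sum_sub_distrib, hP1, ← Finset.mul_sum]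
    linear_combination (-(1 - z)) * (-e2)
  have hfg : ∀ x, f x = g x := fun x => by
    have := subharmonic_nonpos (g := fun x => ‖f x - g x‖) h0 (by simp [ho, hg]) ?_ hlim x
    · exact sub_eq_zero.1 (norm_le_zero_iff.1 this)
    · intro x hx
      have e : f x - g x = z * ∑ y, (P x y : ℂ) * (f y - g y) := by
        have e1 : g x = z * ∑ y, (P x y : ℂ) * g y := by
          rw [hgrec]; simp only [hg, if_neg hx]
        rw [e1, hf x hx, ← mul_sub, ← Finset.sum_sub_distrib]
        simp only [mul_sub]
      change ‖f x - g x‖ ≤ _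
      rw [e, norm_mul, hzn, one_mul]
      exact norm_sum_le_sum_mul h0 _ x
  have := hgrec o
  simp only [hfg]
  linear_combination (1 : ℂ) * this

end Killed

/-- The glued vertex. -/
abbrev oo (n : ℕ) : TwoCycleState n := Sum.inl ()

lemma surv_le {n : ℕ} (hn : 4 ≤ n) (t : ℕ) (x : TwoCycleState n) :
    surv (tcP n) (oo n) t x ≤ 2 * (1 - 1 / (18 * n : ℝ)) ^ t := by
  have hn' : (4 : ℝ) ≤ n := by exact_mod_cast hn
  have hn0 : (0 : ℝ) < n := by linarith
  set H : TwoCycleState n → ℝ := fun x => match x with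
    | Sum.inl _ => 2
    | Sum.inr (_, j) => 1 + 8 * (n - (j + 1)) / (9 * n) with hH
  set u : ℕ → ℝ := fun j => 1 + 8 * (n - j) / (9 * n) with hu
  have hu1 : ∀ j, j ≤ n → 1 ≤ u j := fun j hj => by
    have : (j : ℝ) ≤ n := by exact_mod_cast hj
    have : 0 ≤ 8 * (n - j : ℝ) / (9 * n) := by
      apply div_nonneg <;> linarith
    simp only [hu]; linarith
  have hu2 : ∀ j, u j ≤ 2 := fun j => by
    have : 8 * (n - j : ℝ) / (9 * n) ≤ 1 := by
      rw [div_le_one (by positivity)]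
      have : (0 : ℝ) ≤ j := j.cast_nonneg
      linarith
    simp only [hu]; linarith
  have hHu : ∀ i j, H (Sum.inr (i, j)) = u (j + 1) := fun i j => by simp [hH, hu]
  have hH1 : ∀ x, 1 ≤ H x := by
    rintro (_ | ⟨i, j⟩)
    · norm_num [hH]
    · rw [hHu i j]; exact hu1 _ (by omega)
  have hH2 : ∀ x, H x ≤ 2 := by
    rintro (_ | ⟨i, j⟩)
    · norm_num [hH]
    · rw [hHu i j]; exact hu2 _
  set g : TwoCycleState n → ℝ := fun y => if y = oo n then 0 else H y with hg
  have hgu : ∀ i j, j ≤ n → cyc g i j ≤ u j := fun i j hj => by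
    rw [cyc]
    split_ifs with h
    · have : g (Sum.inr (i, ⟨j - 1, h.1⟩)) = u j := by
        simp only [hg]
        rw [if_neg (by simp), hHu i ⟨j - 1, h.1⟩]
        congr 1
        simp only
        omega
      exact this.le
    · simp only [hg, if_true]
      linarith [hu1 j hj]
  have h18 : 1 / (18 * n : ℝ) ≤ 1 / 2 := by
    apply one_div_le_one_div_of_le <;> linarith
  have key : ∀ x, ∑ y, tcP n x y * (if y = oo n then 0 else H y) ≤
      (1 - 1 / (18 * n : ℝ)) * H x := by
    have e : ∀ x, ∑ y, tcP n x y * (if y = oo n then 0 else H y) = ∑ y, tcP n x y • g y :=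
      fun x => by simp [hg]
    intro x
    rw [e]
    rcases x with _ | ⟨i, j⟩
    · rw [sum_tcP_inl hn]
      simp only [hg, if_true, smul_eq_mul, mul_zero, zero_add]
      rw [Fin.sum_univ_two]
      have a0 := (hgu 0 1 (by omega)).trans (hu2 1)
      have a1 := (hgu 1 1 (by omega)).trans (hu2 1)
      have b0 := (hgu 0 (n - 1) (by omega)).trans (hu2 (n - 1))
      have b1 := (hgu 1 (n - 1) (by omega)).trans (hu2 (n - 1))
      simp only [hg] at a0 a1 b0 b1
      have : H (Sum.inl ()) = 2 := rfl
      rw [this]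
      linarith
    · rw [sum_tcP_inr hn, hHu i j]
      simp only [smul_eq_mul]
      have hj := j.2
      have c1 := hgu i (j + 1) (by omega)
      have c2 := hgu i (j + 2) (by omega)
      have c0 := hgu i j (by omega)
      obtain ⟨ch1, ch2⟩ := chold_bounds n i (j + 1)
      set c := chold n i (j + 1)
      have e1 : u (j + 2) = u (j + 1) - 8 / (9 * n) := by
        simp only [hu]; push_cast; field_simp; ring
      have e0 : u j = u (j + 1) + 8 / (9 * n) := by
        simp only [hu]; push_cast; field_simp; ring
      have hq : 0 < 1 / (9 * n : ℝ) := by positivity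
      have e8 : 8 / (9 * n : ℝ) = 8 * (1 / (9 * n)) := by ring
      have e18 : 1 / (18 * n : ℝ) = 1 / 2 * (1 / (9 * n)) := by field_simp; norm_num
      rw [e8] at e1 e0
      rw [e18]
      set q := 1 / (9 * n : ℝ)
      have step : c * cyc g i (j + 1) + (1 - c) * (2 / 3 * cyc g i (j + 2) + 1 / 3 * cyc g i j) ≤
          c * u (j + 1) + (1 - c) * (2 / 3 * u (j + 2) + 1 / 3 * u j) := by
        have : 0 ≤ 1 - c := by linarith
        gcongr
      refine step.trans ?_
      rw [e1, e0]
      nlinarith [hu2 (j + 1)]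
  have := surv_le_of_superharmonic (tcP_nonneg n) (r := 1 - 1 / (18 * n : ℝ)) (by linarith) hH1
    key t x
  refine this.trans ?_
  rw [mul_comm]
  have : 0 ≤ (1 - 1 / (18 * n : ℝ)) ^ t := pow_nonneg (by linarith) t
  nlinarith [hH2 x]

lemma survBound_tcP {n : ℕ} (hn : 4 ≤ n) (x : TwoCycleState n) :
    SurvBound (fun t => surv (tcP n) (oo n) t x) (18 * n) where
  one_le := by
    have hn' : (4 : ℝ) ≤ n := by exact_mod_cast hn
    linarith
  nonneg t := surv_nonneg (tcP_nonneg n) t x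
  zero := by simp [surv]
  anti t := surv_succ_le (tcP_nonneg n) (tcP_row_sum hn) t x
  le t := surv_le hn t x

lemma tendsto_surv {n : ℕ} (hn : 4 ≤ n) (x : TwoCycleState n) :
    Filter.Tendsto (fun t => surv (tcP n) (oo n) t x) Filter.atTop (nhds 0) := by
  have := (survBound_tcP hn x).rapid.abs.tendsto_atTop_zero
  refine this.congr fun t => ?_
  exact abs_of_nonneg (surv_nonneg (tcP_nonneg n) t x)

/-- Total mean time around cycle `i`. -/
noncomputable def cT (n : ℕ) (i : Fin 2) : ℝ := 3 * ∑ l ∈ Finset.range n, cw n i l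

/-- The near-eigenfunctions of the chain. -/
lemma exists_near_eigenfunction {n : ℕ} (hn : 4 ≤ n) {θ : ℝ} (hθ : |θ| ≤ Real.pi) :
    ∃ (f : TwoCycleState n → ℂ) (m W : Fin 2 → ℂ), f (oo n) = 1 ∧ (∀ x, ‖f x‖ ≤ 1) ∧
      (∀ x, ∑ y, (tcP n x y : ℂ) * f y = exp (-(θ * I)) * f x -
        if x = oo n then 1 / 4 * ∑ i, (1 - m i) * W i else 0) ∧
      (1 - exp (θ * I)) * fser (fun t => surv (tcP n) (oo n) t (oo n)) θ =
        exp (θ * I) * (1 / 4 * ∑ i, (1 - m i) * W i) ∧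
      (∀ i, ‖m i‖ ≤ 1 / (1 + 3 / 20 * (n * θ ^ 2))) ∧
      (∀ i, |θ| ≤ 1 / 9 → ‖m i - exp ((θ * cT n i : ℝ) * I)‖ ≤ 270 * (n * θ ^ 2)) ∧
      (∀ i, ‖W i - wronsk n‖ ≤ 12 * |θ|) := by
  choose F m W hF0 hFn hFrec hFo hm1 hm2 hW using
    fun i => exists_cycle_solution hn (w := cw n i) (cw_bounds n i) hθ
  set f : TwoCycleState n → ℂ := glue F with hf
  have hcyc : ∀ i j, j ≤ n → cyc f i j = F i j := fun i j hj =>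
    cyc_glue (by omega) (fun i => by rw [hF0, hF0]) (fun i => by rw [hFn, hF0]) i hj
  have hfo : f (oo n) = 1 := hF0 0
  have hinv : exp (-(θ * I)) * exp (θ * I) = 1 := by rw [← exp_add]; simp
  have hsum : ∀ x, ∑ y, (tcP n x y : ℂ) * f y = exp (-(θ * I)) * f x -
        if x = oo n then 1 / 4 * ∑ i, (1 - m i) * W i else 0 := by
    have e : ∀ x, ∑ y, (tcP n x y : ℂ) * f y = ∑ y, tcP n x y • f y := fun x => by
      simp only [real_smul]
    intro x
    rw [e]
    rcases x with u | ⟨i, j⟩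
    · rw [sum_tcP_inl hn, if_pos rfl]
      change _ • f (oo n) + _ = _ * f (oo n) - _
      rw [hfo]
      have h0 := hFo 0
      have h1 := hFo 1
      rw [cw_zero hn, kap] at h0 h1
      simp only [Fin.sum_univ_two, real_smul, hcyc _ 1 (by omega), hcyc _ (n - 1) (by omega)]
      push_cast at h0 h1 ⊢
      linear_combination (-1 / 4 : ℂ) * (h0 + h1)
    · rw [sum_tcP_inr hn, if_neg (by simp), sub_zero]
      have hj := j.2
      have hfx : f (Sum.inr (i, j)) = F i (j + 1) := rfl
      rw [hfx, hcyc _ _ (by omega), hcyc _ _ (by omega), hcyc _ _ (by omega)]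
      have h0 := hFrec i j (by omega)
      have hc : ((1 - chold n i (j + 1) : ℝ) : ℂ) * (cw n i (j + 1) : ℝ) = 1 := by
        rw [← ofReal_mul, cw_mul, ofReal_one]
      rw [kap] at h0
      simp only [real_smul]
      push_cast at h0 hc ⊢
      linear_combination (-(1 - (chold n i (j + 1) : ℂ))) * h0 +
        (exp (-(θ * I)) - 1) * F i (j + 1) * hc
  have hharm : ∀ x, x ≠ oo n → f x = exp (θ * I) * ∑ y, (tcP n x y : ℂ) * f y := fun x hx => by
    rw [hsum, if_neg hx]
    linear_combination (-f x) * hinv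
  refine ⟨f, m, W, hfo, norm_le_one_of_harmonic (tcP_nonneg n) (tcP_row_sum hn) (tendsto_surv hn)
    hfo hharm, hsum, ?_, hm1, hm2, hW⟩
  rw [one_sub_mul_fser_surv (tcP_nonneg n) (tcP_row_sum hn) (tendsto_surv hn) (survBound_tcP hn)
    hfo hharm, hsum, if_pos rfl, hfo]
  linear_combination (-1 : ℂ) * hinv

end TwoCycle

namespace TwoCycle

lemma one_sixth_le_mul_abs (p k : ℤ) (hk : k ≠ 0) :
    1 / 6 ≤ |(p : ℝ) - √5 * k| * |(k : ℝ)| := by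
  have hk1 : (1 : ℝ) ≤ |(k : ℝ)| := by exact_mod_cast Int.one_le_abs hk
  have h5 : √5 * √5 = 5 := Real.mul_self_sqrt (by norm_num)
  have hne : p * p - 5 * (k * k) ≠ 0 := by
    intro h
    have hirr : Irrational √5 := by
      have := Nat.Prime.irrational_sqrt (p := 5) (by norm_num)
      simpa using this
    apply hirr.ne_rat (|(p : ℚ)| / |(k : ℚ)|)
    have hR : (p : ℝ) * p = 5 * (k * k) := by
      have : p * p = 5 * (k * k) := by linarith
      exact_mod_cast this
    have hk0 : |(k : ℝ)| ≠ 0 := by positivity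
    push_cast
    rw [eq_div_iff hk0, ← abs_of_nonneg (Real.sqrt_nonneg 5), ← abs_mul]
    rw [abs_eq_abs.2]
    have : (√5 * k - p) * (√5 * k + p) = 0 := by linear_combination k * k * h5 - hR
    rcases mul_eq_zero.1 this with h | h
    · left; linarith
    · right; linarith
  have h1 : (1 : ℝ) ≤ |(p : ℝ) * p - 5 * (k * k)| := by exact_mod_cast Int.one_le_abs hne
  have hf : (p : ℝ) * p - 5 * (k * k) = (p - √5 * k) * (p + √5 * k) := by
    linear_combination (k * k : ℝ) * h5
  rw [hf, abs_mul] at h1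
  have h2 : |(p : ℝ) + √5 * k| ≤ |(p : ℝ) - √5 * k| + 2 * 2.237 * |(k : ℝ)| := by
    have e : (p : ℝ) + √5 * k = (p - √5 * k) + 2 * √5 * k := by ring
    rw [e]
    refine (abs_add_le _ _).trans ?_
    rw [abs_mul (2 * √5), abs_of_nonneg (by positivity : 0 ≤ 2 * √5)]
    have := sqrt_five_bounds.2
    gcongr
  set D := |(p : ℝ) - √5 * k|
  set K := |(k : ℝ)|
  have hD : 0 ≤ D := abs_nonneg _
  by_contra! hlt
  have : D < 1 / 6 := by nlinarith
  nlinarith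

/-- The asymptotic ratio of the mean lengths of the two cycles. -/
noncomputable def cβ : ℝ := (7 + √5) / 8

/-- The quadratic form controlling the resonances. -/
noncomputable def qa (n : ℕ) (k : ℤ × ℤ) : ℝ := (k.1 - k.2 * cβ) ^ 2 + (k.2 : ℝ) ^ 2 / n

lemma qa_nonneg (n : ℕ) (k : ℤ × ℤ) : 0 ≤ qa n k := by unfold qa; positivity

lemma one_le_mul_sqrt_mul_qa {n : ℕ} (hn : 0 < n) {k : ℤ × ℤ} (hk : k ≠ 0) :
    1 ≤ 24 * (√n * qa n k) := by
  have hn1 : (1 : ℝ) ≤ n := by exact_mod_cast hn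
  have hs : √(n : ℝ) * √n = n := Real.mul_self_sqrt (by linarith)
  have hs1 : 1 ≤ √(n : ℝ) := Real.one_le_sqrt.2 hn1
  by_cases h2 : k.2 = 0
  · have h1 : k.1 ≠ 0 := fun h => hk (Prod.ext h h2)
    have : (1 : ℝ) ≤ (k.1 : ℝ) ^ 2 := by
      have : 1 ≤ k.1 ^ 2 := by have := Int.one_le_abs h1; nlinarith [sq_abs k.1]
      exact_mod_cast this
    simp only [qa, h2, Int.cast_zero, zero_mul, sub_zero]
    rw [zero_pow two_ne_zero, zero_div, add_zero]
    nlinarith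
  · have h := one_sixth_le_mul_abs (8 * k.1 - 7 * k.2) k.2 h2
    have e : ((8 * k.1 - 7 * k.2 : ℤ) : ℝ) - √5 * k.2 = 8 * (k.1 - k.2 * cβ) := by
      push_cast; rw [cβ]; ring
    rw [e, abs_mul, abs_of_nonneg (by norm_num : (0 : ℝ) ≤ 8)] at h
    set u := (k.1 - k.2 * cβ : ℝ)
    have e2 : √n * qa n k = √n * |u| ^ 2 + |(k.2 : ℝ)| ^ 2 / √n := by
      rw [qa, sq_abs, sq_abs, mul_add]
      congr 1
      rw [eq_div_iff (by positivity)]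
      field_simp
      rw [sq, hs]
    rw [e2]
    have e3 : √n * |u| ^ 2 + |(k.2 : ℝ)| ^ 2 / √n - 2 * (|u| * |(k.2 : ℝ)|) =
        (√n * |u| - |(k.2 : ℝ)|) ^ 2 / √n := by
      field_simp; ring
    have : 0 ≤ (√n * |u| - |(k.2 : ℝ)|) ^ 2 / √n := by positivity
    linarith

lemma exists_sum_inv_qa_sq_le : ∃ C : ℝ, 0 ≤ C ∧ ∀ n : ℕ, 0 < n → ∀ B : Finset (ℤ × ℤ), (0 ∉ B) →
    ∑ k ∈ B, (qa n k ^ 2)⁻¹ ≤ C * n := by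
  set g : ℤ → ℝ := fun b => (1 + (b : ℝ) ^ 2)⁻¹ with hg
  have hg0 : ∀ b, 0 ≤ g b := fun b => by positivity
  have hgs : Summable g := by
    have h2 : Summable fun b : ℤ => 1 / (b : ℝ) ^ 2 :=
      Real.summable_one_div_int_pow.2 (by norm_num)
    refine Summable.of_norm_bounded_eventually h2 ?_
    have : {b : ℤ | ¬ ‖g b‖ ≤ 1 / (b : ℝ) ^ 2} ⊆ {0} := by
      intro b hb
      by_contra hb0
      apply hb
      have : (b : ℝ) ≠ 0 := by exact_mod_cast hb0
      rw [Real.norm_of_nonneg (hg0 b), hg, one_div]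
      apply inv_anti₀ (by positivity); linarith
    exact (Set.finite_singleton 0).subset this
  have hss : Summable fun p : ℤ × ℤ => g p.1 * g p.2 := hgs.mul_of_nonneg hgs hg0 hg0
  refine ⟨40000 * ∑' p : ℤ × ℤ, g p.1 * g p.2, ?_, fun n hn B hB => ?_⟩
  · have : 0 ≤ ∑' p : ℤ × ℤ, g p.1 * g p.2 := tsum_nonneg fun p => mul_nonneg (hg0 _) (hg0 _)
    positivity
  have hn1 : (1 : ℝ) ≤ n := by exact_mod_cast hn
  set N : ℝ := √(√n) with hN
  have hN2 : N ^ 2 = √n := Real.sq_sqrt (Real.sqrt_nonneg _)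
  have hN0 : 0 < N := by positivity
  have hsn : √(n : ℝ) ^ 2 = n := Real.sq_sqrt (by linarith)
  set X : ℤ × ℤ → ℝ := fun k => N * (k.1 - k.2 * cβ) with hX
  set Y : ℤ × ℤ → ℝ := fun k => k.2 / N with hY
  have hr : ∀ k, X k ^ 2 + Y k ^ 2 = √n * qa n k := fun k => by
    simp only [hX, hY, qa, mul_pow, div_pow, mul_add, hN2]
    congr 1
    rw [div_eq_iff (by positivity)]
    field_simp
    rw [hsn]
  have hr1 : ∀ k, k ≠ 0 → 1 ≤ 24 * (X k ^ 2 + Y k ^ 2) := fun k hk => by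
    rw [hr]; exact one_le_mul_sqrt_mul_qa hn hk
  set φ : ℤ × ℤ → ℤ × ℤ := fun k => (⌊8 * X k⌋, ⌊8 * Y k⌋) with hφ
  have hinj : Function.Injective φ := by
    intro k k' h
    by_contra hne
    have h1 := hr1 (k - k') (sub_ne_zero.2 hne)
    simp only [hφ, Prod.mk.injEq] at h
    have a := Int.abs_sub_lt_one_of_floor_eq_floor h.1
    have b := Int.abs_sub_lt_one_of_floor_eq_floor h.2
    have eX : X (k - k') = X k - X k' := by
      simp only [hX, Prod.fst_sub, Prod.snd_sub]; push_cast; ring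
    have eY : Y (k - k') = Y k - Y k' := by simp only [hY, Prod.snd_sub]; push_cast; ring
    rw [eX, eY] at h1
    rw [abs_lt] at a b
    nlinarith
  have hfl : ∀ x r : ℝ, x ^ 2 ≤ r → 1 ≤ 24 * r →
      1 + (⌊8 * x⌋ : ℝ) ^ 2 ≤ 200 * r := fun x r h1 h2 => by
    have a := Int.floor_le (8 * x)
    have b := Int.lt_floor_add_one (8 * x)
    set y : ℝ := (⌊8 * x⌋ : ℝ)
    have : (y - 8 * x) ^ 2 ≤ 1 := by nlinarith
    nlinarith [sq_nonneg (y - 8 * x - 8 * x)]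
  have hterm : ∀ k ∈ B, (qa n k ^ 2)⁻¹ ≤ (40000 * n) * (g (φ k).1 * g (φ k).2) := fun k hk => by
    have hk0 : k ≠ 0 := fun h => hB (h ▸ hk)
    have h1 := hr1 k hk0
    have hx := hfl (X k) _ (by nlinarith [sq_nonneg (Y k)]) h1
    have hy := hfl (Y k) _ (by nlinarith [sq_nonneg (X k)]) h1
    have hpos : 0 < qa n k := by
      have := one_le_mul_sqrt_mul_qa hn hk0
      by_contra! h
      nlinarith [Real.sqrt_nonneg (n : ℝ)]
    rw [hr] at hx hy
    simp only [hg, hφ]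
    rw [← mul_inv, ← div_eq_mul_inv, le_div_iff₀ (by positivity), inv_mul_le_iff₀ (by positivity)]
    calc _ ≤ (200 * (√n * qa n k)) * (200 * (√n * qa n k)) := by gcongr
      _ = _ := by linear_combination (40000 * qa n k ^ 2) * hsn
  calc ∑ k ∈ B, (qa n k ^ 2)⁻¹ ≤ ∑ k ∈ B, (40000 * n) * (g (φ k).1 * g (φ k).2) :=
        Finset.sum_le_sum hterm
    _ = (40000 * n) * ∑ p ∈ B.map ⟨φ, hinj⟩, g p.1 * g p.2 := by
        rw [Finset.sum_map, Finset.mul_sum]; rfl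
    _ ≤ (40000 * n) * ∑' p : ℤ × ℤ, g p.1 * g p.2 := by
        gcongr
        exact hss.sum_le_tsum _ fun p _ => mul_nonneg (hg0 _) (hg0 _)
    _ = _ := by ring

end TwoCycle

namespace TwoCycle

open Complex

lemma cT_one (n : ℕ) : cT n 1 = 6 * n := by
  have : ∀ l, cw n 1 l = 2 := fun l => by simp [cw]
  simp only [cT, this, Finset.sum_const, Finset.card_range, nsmul_eq_mul]; ring

lemma cT_zero {n : ℕ} (h4 : 4 ∣ n) (hn : 0 < n) : cT n 0 = cβ * cT n 1 + 3 / 2 * (√5 - 1) := by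
  obtain ⟨m, rfl⟩ := h4
  have h : ∀ l, cw (4 * m) 0 l =
      2 + if l ∈ Finset.Icc m (3 * m) then (√5 - 1) / 2 else 0 := fun l => by
    have e1 : 4 * m / 4 = m := by omega
    have e2 : 3 * (4 * m) / 4 = 3 * m := by omega
    simp only [cw, e1, e2, Finset.mem_Icc, true_and]
    split_ifs <;> ring
  have hsub : (Finset.range (4 * m)).filter (· ∈ Finset.Icc m (3 * m)) = Finset.Icc m (3 * m) := by
    ext l; simp only [Finset.mem_filter, Finset.mem_range, Finset.mem_Icc]; omega
  rw [cT_one]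
  simp only [cT, h, Finset.sum_add_distrib, ← Finset.sum_filter, hsub, Finset.sum_const,
    Finset.card_range, Nat.card_Icc, nsmul_eq_mul, cβ]
  have : ((3 * m + 1 - m : ℕ) : ℝ) = 2 * m + 1 := by
    rw [show 3 * m + 1 - m = 2 * m + 1 by omega]; push_cast; ring
  rw [this]; push_cast; ring

lemma cT_zero_bounds {n : ℕ} (h4 : 4 ∣ n) (hn : 0 < n) :
    6 * n ≤ cT n 0 ∧ cT n 0 ≤ 9 * n := by
  rw [cT_zero h4 hn, cT_one, cβ]
  have hn4 : (4 : ℝ) ≤ n := by exact_mod_cast Nat.le_of_dvd hn h4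
  obtain ⟨h1, h2⟩ := sqrt_five_bounds
  constructor <;> nlinarith

lemma exists_angle (y : ℝ) : ∃ k : ℤ, |y - 2 * Real.pi * k| ≤ Real.pi := by
  have hp := Real.pi_pos
  refine ⟨round (y / (2 * Real.pi)), ?_⟩
  have h := abs_sub_round (y / (2 * Real.pi))
  have e : y - 2 * Real.pi * round (y / (2 * Real.pi)) =
      2 * Real.pi * (y / (2 * Real.pi) - round (y / (2 * Real.pi))) := by field_simp
  rw [e, abs_mul, abs_of_pos (by positivity)]
  nlinarith

lemma exp_mul_I_sub_two_pi (y : ℝ) (k : ℤ) :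
    exp ((y : ℝ) * I) = exp (((y - 2 * Real.pi * k : ℝ) : ℂ) * I) := by
  rw [exp_eq_exp_iff_exists_int]
  exact ⟨k, by push_cast; ring⟩

lemma abs_sin_sub_self_le {x : ℝ} (hx : |x| ≤ Real.pi) : |Real.sin x - x| ≤ x ^ 2 := by
  wlog h : 0 ≤ x generalizing x
  · have := this (x := -x) (by rwa [abs_neg]) (by linarith)
    rw [Real.sin_neg] at this
    rw [← abs_neg]
    calc _ = |-Real.sin x - -x| := by congr 1; ring
      _ ≤ _ := by simpa using this
  have hp : x ≤ 3.15 := by rw [abs_of_nonneg h] at hx; linarith [Real.pi_lt_d2]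
  have h1 : Real.sin x ≤ x := Real.sin_le h
  rw [abs_of_nonpos (by linarith)]
  rcases le_total x 1 with h2 | h2
  · rcases h.eq_or_lt with h3 | h3
    · rw [← h3]; simp
    · have := Real.sin_gt_sub_cube h3 
      have : x ^ 3 ≤ x ^ 2 := pow_le_pow_of_le_one h h2 (by norm_num)
      nlinarith
  · have : 0 ≤ Real.sin x := Real.sin_nonneg_of_nonneg_of_le_pi h (by rwa [abs_of_nonneg h] at hx)
    nlinarith

lemma sq_le_one_sub_cos {x : ℝ} (hx : |x| ≤ Real.pi) : x ^ 2 / 5 ≤ 1 - Real.cos x := by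
  have h := Real.cos_le_one_sub_mul_cos_sq hx
  have hp : Real.pi ^ 2 ≤ 10 := by nlinarith [Real.pi_lt_d2, Real.pi_pos]
  have : x ^ 2 / 5 ≤ 2 / Real.pi ^ 2 * x ^ 2 := by
    rw [div_mul_eq_mul_div, div_le_div_iff₀ (by norm_num) (by positivity)]
    nlinarith [sq_nonneg x]
  linarith

end TwoCycle

namespace TwoCycle

open Complex

section resonance

variable {n : ℕ} {θ w : ℝ} {m W : Fin 2 → ℂ} {x : Fin 2 → ℝ}

lemma norm_one_sub_exp_le (x : ℝ) : ‖1 - exp (x * I)‖ ≤ |x| := by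
  rw [norm_sub_rev, mul_comm]
  exact (Real.norm_exp_I_mul_ofReal_sub_one_le (x := x)).trans_eq (Real.norm_eq_abs x)

lemma norm_wronsk_error_le (hn : (10 : ℝ) ^ 18 ≤ n) (hq : n * θ ^ 2 ≤ 1)
    (hm2 : ∀ i, ‖m i - exp (x i * I)‖ ≤ 270 * (n * θ ^ 2)) (hW : ∀ i, ‖W i - w‖ ≤ 12 * |θ|) :
    ‖∑ i, (1 - m i) * W i - w * ∑ i, (1 - m i)‖ ≤
      6.6 / 10 ^ 6 * (x 0 ^ 2 + x 1 ^ 2 + n * θ ^ 2) := by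
  have hθ2 : θ ^ 2 ≤ n * θ ^ 2 / 10 ^ 18 := by
    rw [le_div_iff₀ (by positivity)]; nlinarith [sq_nonneg θ]
  set q := n * θ ^ 2 with hq'
  have hq0 : 0 ≤ q := by positivity
  have hθ : |θ| ≤ 1 / 10 ^ 9 := by
    apply abs_le_of_sq_le_sq _ (by positivity)
    rw [div_pow]; norm_num at hθ2 ⊢; linarith
  have hθ0 := abs_nonneg θ
  have hi : ∀ i, ‖(1 - m i) * (W i - w)‖ ≤
      12 * (1 / 10 ^ 9) * (x i ^ 2 / 2 + 271 * q) := fun i => by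
    have h1 : ‖1 - m i‖ ≤ |x i| + 270 * q := by
      have e : 1 - m i = (1 - exp (x i * I)) - (m i - exp (x i * I)) := by ring
      rw [e]
      exact (norm_sub_le _ _).trans (add_le_add (norm_one_sub_exp_le _) (hm2 i))
    have h2 : |θ| * |x i| ≤ 1 / 10 ^ 9 * (x i ^ 2 / 2 + q / 2) := by
      have h := sq_nonneg (|x i| - 10 ^ 9 * |θ|)
      have e : (|x i| - 10 ^ 9 * |θ|) ^ 2 =
          x i ^ 2 - 2 * 10 ^ 9 * (|θ| * |x i|) + 10 ^ 18 * θ ^ 2 := by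
        rw [← sq_abs θ, ← sq_abs (x i)]; ring
      rw [e] at h
      linarith
    rw [norm_mul]
    calc _ ≤ (|x i| + 270 * q) * (12 * |θ|) := by gcongr; exact hW i
      _ = 12 * (|θ| * |x i|) + 12 * 270 * q * |θ| := by ring
      _ ≤ 12 * (1 / 10 ^ 9 * (x i ^ 2 / 2 + q / 2)) + 12 * 270 * q * (1 / 10 ^ 9) := by gcongr
      _ ≤ _ := by linarith
  have e : ∑ i, (1 - m i) * W i - w * ∑ i, (1 - m i) =
      (1 - m 0) * (W 0 - w) + (1 - m 1) * (W 1 - w) := by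
    simp only [Fin.sum_univ_two]; ring
  rw [e]
  refine (norm_add_le _ _).trans ((add_le_add (hi 0) (hi 1)).trans ?_)
  have := sq_nonneg (x 0)
  have := sq_nonneg (x 1)
  linarith

lemma resonance_lower (hn : (10 : ℝ) ^ 18 ≤ n) (hq : n * θ ^ 2 ≤ 1)
    (hm1 : ∀ i, ‖m i‖ ≤ 1 / (1 + 3 / 20 * (n * θ ^ 2)))
    (hm2 : ∀ i, ‖m i - exp (x i * I)‖ ≤ 270 * (n * θ ^ 2)) (hW : ∀ i, ‖W i - w‖ ≤ 12 * |θ|)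
    (hx : ∀ i, |x i| ≤ Real.pi) (hw : 7 / 24 ≤ w) :
    |x 0 + x 1| + (x 0 ^ 2 + x 1 ^ 2 + n * θ ^ 2) ≤ 10 ^ 9 * ‖1 / 4 * ∑ i, (1 - m i) * W i‖ := by
  have hE := norm_wronsk_error_le hn hq hm2 hW
  set q := n * θ ^ 2 with hq'
  have hq0 : 0 ≤ q := by positivity
  set D := ∑ i, (1 - m i) with hD
  have hre1 : ∀ i, 0.13 * q ≤ 1 - (m i).re := fun i => by
    have h1 := (re_le_norm (m i)).trans (hm1 i)
    have : 1 / (1 + 3 / 20 * q) ≤ 1 - 0.13 * q := by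
      rw [div_le_iff₀ (by positivity)]; nlinarith
    linarith
  have hre2 : ∀ i, x i ^ 2 / 5 - 270 * q ≤ 1 - (m i).re := fun i => by
    have h1 := (re_le_norm _).trans (hm2 i)
    rw [sub_re, exp_ofReal_mul_I_re] at h1
    linarith [sq_le_one_sub_cos (hx i)]
  have him : ∀ i, |(m i).im - x i| ≤ x i ^ 2 + 270 * q := fun i => by
    have h1 := (abs_im_le_norm _).trans (hm2 i)
    rw [sub_im, exp_ofReal_mul_I_im] at h1
    have e : (m i).im - x i = ((m i).im - Real.sin (x i)) + (Real.sin (x i) - x i) := by ring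
    rw [e]
    linarith [abs_add_le ((m i).im - Real.sin (x i)) (Real.sin (x i) - x i),
      abs_sin_sub_self_le (hx i)]
  have hDre : D.re = (1 - (m 0).re) + (1 - (m 1).re) := by
    simp only [hD, Fin.sum_univ_two, add_re, sub_re, one_re]
  have hDim : D.im = -((m 0).im + (m 1).im) := by
    simp only [hD, Fin.sum_univ_two, add_im, sub_im, one_im]; ring
  have h1 : x 0 ^ 2 + x 1 ^ 2 + q ≤ 20000 * ‖D‖ := by
    have := re_le_norm D
    rw [hDre] at this
    linarith [hre1 0, hre1 1, hre2 0, hre2 1]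
  have h2 : |x 0 + x 1| ≤ ‖D‖ + 540 * (x 0 ^ 2 + x 1 ^ 2 + q) := by
    have h := abs_im_le_norm D
    rw [hDim, abs_neg] at h
    have e : x 0 + x 1 = ((m 0).im + (m 1).im) - ((m 0).im - x 0) - ((m 1).im - x 1) := by ring
    rw [e]
    have a := abs_sub ((m 0).im + (m 1).im - ((m 0).im - x 0)) ((m 1).im - x 1)
    have b := abs_sub ((m 0).im + (m 1).im) ((m 0).im - x 0)
    linarith [him 0, him 1, sq_nonneg (x 0), sq_nonneg (x 1)]
  have h3 : w * ‖D‖ - ‖∑ i, (1 - m i) * W i - w * D‖ ≤ ‖∑ i, (1 - m i) * W i‖ := by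
    have := norm_sub_norm_le (w * D) (-(∑ i, (1 - m i) * W i - w * D))
    rw [norm_neg, norm_mul, norm_real, Real.norm_of_nonneg (by linarith)] at this
    refine this.trans (le_of_eq ?_)
    congr 1; ring
  have h4 : 7 / 24 * ‖D‖ ≤ w * ‖D‖ := by gcongr
  have h5 : ‖(1 / 4 : ℂ)‖ = 1 / 4 := by norm_num
  rw [norm_mul, h5]
  linarith [norm_nonneg D]

lemma resonance_upper (hn : (10 : ℝ) ^ 18 ≤ n) (hq : n * θ ^ 2 ≤ 1)
    (hm2 : ∀ i, ‖m i - exp (x i * I)‖ ≤ 270 * (n * θ ^ 2)) (hW : ∀ i, ‖W i - w‖ ≤ 12 * |θ|)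
    (hw0 : 0 ≤ w) (hw : w ≤ 2) (hx : x 0 + x 1 = 0) :
    ‖1 / 4 * ∑ i, (1 - m i) * W i‖ ≤ 300 * (x 0 ^ 2 + n * θ ^ 2) := by
  have hE := norm_wronsk_error_le hn hq hm2 hW
  set q := n * θ ^ 2 with hq'
  have hq0 : 0 ≤ q := by positivity
  set D := ∑ i, (1 - m i) with hD
  have hx1 : x 1 = - x 0 := by linarith
  have e : D =
      ((2 - 2 * Real.cos (x 0) : ℝ) : ℂ) - (m 0 - exp (x 0 * I)) - (m 1 - exp (x 1 * I)) := by
    rw [hD, Fin.sum_univ_two, hx1]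
    push_cast
    rw [neg_mul, ← neg_mul]
    rw [Complex.cos]; ring
  have h1 : ‖D‖ ≤ x 0 ^ 2 + 540 * q := by
    rw [e]
    have a := norm_sub_le (((2 - 2 * Real.cos (x 0) : ℝ) : ℂ) - (m 0 - exp (x 0 * I)))
      (m 1 - exp (x 1 * I))
    have b := norm_sub_le ((2 - 2 * Real.cos (x 0) : ℝ) : ℂ) (m 0 - exp (x 0 * I))
    have c : ‖((2 - 2 * Real.cos (x 0) : ℝ) : ℂ)‖ ≤ x 0 ^ 2 := by
      rw [norm_real, Real.norm_of_nonneg (by linarith [Real.cos_le_one (x 0)])]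
      linarith [Real.one_sub_sq_div_two_le_cos (x := x 0)]
    linarith [hm2 0, hm2 1]
  have h3 : ‖∑ i, (1 - m i) * W i‖ ≤ w * ‖D‖ + ‖∑ i, (1 - m i) * W i - w * D‖ := by
    have := norm_add_le (w * D) (∑ i, (1 - m i) * W i - w * D)
    rw [norm_mul, norm_real, Real.norm_of_nonneg hw0] at this
    refine le_trans (le_of_eq ?_) this
    congr 1; ring
  have h4 : w * ‖D‖ ≤ 2 * ‖D‖ := by gcongr
  have h5 : ‖(1 / 4 : ℂ)‖ = 1 / 4 := by norm_num
  have h6 : x 1 ^ 2 = x 0 ^ 2 := by rw [hx1, neg_sq]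
  rw [h6] at hE
  rw [norm_mul, h5]
  linarith [sq_nonneg (x 0)]

lemma norm_ge_of_one_le (hθ : |θ| ≤ 1 / 1200) (hq : 1 ≤ n * θ ^ 2)
    (hm1 : ∀ i, ‖m i‖ ≤ 1 / (1 + 3 / 20 * (n * θ ^ 2)))
    (hW : ∀ i, ‖W i - w‖ ≤ 12 * |θ|) (hw : 7 / 24 ≤ w) :
    1 / 120 ≤ ‖1 / 4 * ∑ i, (1 - m i) * W i‖ := by
  have hm : ∀ i, ‖m i‖ ≤ 20 / 23 := fun i => (hm1 i).trans (by
    rw [div_le_div_iff₀ (by positivity) (by norm_num)]; linarith)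
  have hi : ∀ i, ‖(1 - m i) * (W i - w)‖ ≤ 2 * (12 * (1 / 1200)) := fun i => by
    rw [norm_mul]
    gcongr
    · refine (norm_sub_le _ _).trans ?_
      rw [norm_one]; linarith [hm i]
    · exact (hW i).trans (by linarith)
  have e : ∑ i, (1 - m i) * W i =
      w * ((1 - m 0) + (1 - m 1)) + ((1 - m 0) * (W 0 - w) + (1 - m 1) * (W 1 - w)) := by
    simp only [Fin.sum_univ_two]; ring
  have h1 : 7 / 24 * (6 / 23) ≤ ‖(w : ℂ) * ((1 - m 0) + (1 - m 1))‖ := by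
    rw [norm_mul, norm_real, Real.norm_of_nonneg (by linarith)]
    gcongr
    have := re_le_norm ((1 - m 0) + (1 - m 1))
    simp only [add_re, sub_re, one_re] at this
    linarith [re_le_norm (m 0), re_le_norm (m 1), hm 0, hm 1]
  have h2 := norm_add_le ((1 - m 0) * (W 0 - w)) ((1 - m 1) * (W 1 - w))
  have h3 := norm_sub_norm_le ((w : ℂ) * ((1 - m 0) + (1 - m 1)))
    (-((1 - m 0) * (W 0 - w) + (1 - m 1) * (W 1 - w)))
  rw [norm_neg, sub_neg_eq_add, ← e] at h3
  have h5 : ‖(1 / 4 : ℂ)‖ = 1 / 4 := by norm_num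
  rw [norm_mul, h5]
  linarith [hi 0, hi 1]

end resonance

lemma tcP_oo (n : ℕ) : tcP n (oo n) (oo n) = 1 / 2 := by
  simp [tcP, tcHold, tcStep]

lemma norm_ge_of_large {n : ℕ} (hn : 4 ≤ n) {θ : ℝ} (hθ : |θ| ≤ Real.pi)
    {f : TwoCycleState n → ℂ} {A : ℂ}
    (hfo : f (oo n) = 1) (hf : ∀ x, ‖f x‖ ≤ 1)
    (h : ∑ y, (tcP n (oo n) y : ℂ) * f y = exp (-(θ * I)) * f (oo n) - A) :
    θ ^ 2 / 20 ≤ ‖A‖ := by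
  have hk := (kap_bounds hθ (w := 2) le_rfl (by norm_num)).1
  have hs : ‖∑ y ∈ Finset.univ.erase (oo n), (tcP n (oo n) y : ℂ) * f y‖ ≤ 1 / 2 := by
    have h1 := tcP_row_sum hn (oo n)
    rw [← Finset.add_sum_erase _ _ (Finset.mem_univ (oo n)), tcP_oo] at h1
    refine (norm_sum_le _ _).trans ?_
    calc _ ≤ ∑ y ∈ Finset.univ.erase (oo n), tcP n (oo n) y := Finset.sum_le_sum fun y _ => by
          rw [norm_mul, norm_real, Real.norm_of_nonneg (tcP_nonneg n _ _)]
          exact mul_le_of_le_one_right (tcP_nonneg n _ _) (hf y)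
      _ = _ := by linarith
  rw [← Finset.add_sum_erase _ _ (Finset.mem_univ (oo n)), tcP_oo, hfo] at h
  set R := ∑ y ∈ Finset.univ.erase (oo n), (tcP n (oo n) y : ℂ) * f y
  have e : kap θ 2 = 2 * (A + R) := by
    rw [kap]; push_cast at h ⊢; linear_combination (-2) * h
  rw [e, norm_mul] at hk
  have := norm_add_le A R
  norm_num at hk
  linarith

end TwoCycle

namespace TwoCycle

open Complex

lemma integral_inv_sq_add_sq_le {T a : ℝ} (hT : 0 < T) (ha : 0 < a) (c u v : ℝ) :
    ∫ θ in u..v, ((θ * T - c) ^ 2 + a ^ 2)⁻¹ ≤ Real.pi / (T * a) := by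
  have hd : ∀ θ ∈ Set.uIcc u v, HasDerivAt (fun θ => Real.arctan ((θ * T - c) / a) / (T * a))
      ((θ * T - c) ^ 2 + a ^ 2)⁻¹ θ := fun θ _ => by
    have h1 : HasDerivAt (fun θ : ℝ => (θ * T - c) / a) (T / a) θ := by
      have := (((hasDerivAt_id θ).mul_const T).sub_const c).div_const a
      simpa using this
    have := h1.arctan.div_const (T * a)
    have e : 1 / (1 + ((θ * T - c) / a) ^ 2) * (T / a) / (T * a) = ((θ * T - c) ^ 2 + a ^ 2)⁻¹ := by
      have : a ^ 2 + (θ * T - c) ^ 2 ≠ 0 := by positivity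
      have : (θ * T - c) ^ 2 + a ^ 2 ≠ 0 := by positivity
      rw [div_pow]
      field_simp
      ring
    rwa [e] at this
  have hcont : Continuous fun θ : ℝ => ((θ * T - c) ^ 2 + a ^ 2)⁻¹ :=
    Continuous.inv₀ (by fun_prop) fun θ => by positivity
  rw [intervalIntegral.integral_eq_sub_of_hasDerivAt hd (hcont.intervalIntegrable _ _), ← sub_div]
  gcongr
  linarith [Real.arctan_lt_pi_div_two ((v * T - c) / a),
    Real.neg_pi_div_two_lt_arctan ((u * T - c) / a)]

lemma qa_le {n : ℕ} (h4 : 4 ∣ n) (hn : 0 < n) {θ : ℝ} {x : Fin 2 → ℝ} {k : Fin 2 → ℤ}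
    (hx : ∀ i, x i = θ * cT n i - 2 * Real.pi * k i) :
    qa n (k 0, k 1) ≤ 5 * (x 0 ^ 2 + x 1 ^ 2 + n * θ ^ 2) := by
  have hn4 : (4 : ℝ) ≤ n := by exact_mod_cast Nat.le_of_dvd hn h4
  have hT1 := cT_one n
  have hT0 := cT_zero h4 hn
  have hx0 := hx 0
  have hx1 := hx 1
  rw [hT1] at hT0 hx1
  rw [hT0] at hx0
  have hp := Real.pi_gt_three
  have h5 := sqrt_five_bounds
  have hβ : 1 ≤ cβ ∧ cβ ≤ 1.2 := by rw [cβ]; constructor <;> linarith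
  have hk1 : |(k 1 : ℝ)| ≤ n * |θ| + |x 1| := by
    have e : 2 * Real.pi * k 1 = 6 * n * θ + - x 1 := by rw [hx1]; ring
    have : |2 * Real.pi * k 1| ≤ 6 * n * |θ| + |x 1| := by
      rw [e]
      refine (abs_add_le _ _).trans ?_
      rw [abs_neg, abs_mul, abs_of_nonneg (by positivity : (0 : ℝ) ≤ 6 * n)]
    rw [abs_mul, abs_of_pos (by positivity)] at this
    nlinarith [abs_nonneg (k 1 : ℝ), abs_nonneg (x 1)]
  have h2 : |(k 0 - k 1 * cβ : ℝ)| ≤ |x 0| + |x 1| + |θ| := by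
    have e : 6 * Real.pi * (k 0 - k 1 * cβ) =
        3 * cβ * x 1 + -(3 * x 0) + 9 / 2 * (√5 - 1) * θ := by
      rw [hx0, hx1]; ring
    have : |6 * Real.pi * (k 0 - k 1 * cβ)| ≤ 3.6 * |x 1| + 3 * |x 0| + 6 * |θ| := by
      rw [e]
      refine (abs_add_three _ _ _).trans ?_
      rw [abs_neg, abs_mul, abs_mul 3 (x 0), abs_mul (9 / 2 * (√5 - 1)),
        abs_of_nonneg (by linarith : 0 ≤ 3 * cβ), abs_of_nonneg (by norm_num : (0 : ℝ) ≤ 3),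
        abs_of_nonneg (by linarith : 0 ≤ 9 / 2 * (√5 - 1))]
      gcongr <;> linarith
    rw [abs_mul, abs_of_pos (by positivity)] at this
    nlinarith [abs_nonneg (k 0 - k 1 * cβ : ℝ), abs_nonneg (x 1), abs_nonneg (x 0), abs_nonneg θ]
  have h3 : (k 0 - k 1 * cβ : ℝ) ^ 2 ≤ 3 * (x 0 ^ 2 + x 1 ^ 2 + θ ^ 2) := by
    rw [← sq_abs, ← sq_abs (x 0), ← sq_abs (x 1), ← sq_abs θ]
    refine (pow_le_pow_left₀ (abs_nonneg _) h2 2).trans ?_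
    nlinarith [sq_nonneg (|x 0| - |x 1|), sq_nonneg (|x 0| - |θ|), sq_nonneg (|θ| - |x 1|)]
  have h4 : (k 1 : ℝ) ^ 2 / n ≤ 2 * (n * θ ^ 2) + x 1 ^ 2 := by
    rw [div_le_iff₀ (by linarith), ← sq_abs, ← sq_abs (x 1), ← sq_abs θ]
    refine (pow_le_pow_left₀ (abs_nonneg _) hk1 2).trans ?_
    nlinarith [sq_nonneg (n * |θ| - |x 1|), sq_nonneg (|x 1|)]
  have : θ ^ 2 ≤ n * θ ^ 2 := by nlinarith [sq_nonneg θ]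
  rw [qa]
  dsimp only
  linarith [sq_nonneg (x 0), sq_nonneg (x 1)]

lemma exists_surv_le_half {n : ℕ} (hn : 4 ≤ n) : ∃ N, ∀ x, surv (tcP n) (oo n) N x ≤ 1 / 2 := by
  have hn' : (4 : ℝ) ≤ n := by exact_mod_cast hn
  have h18 : 1 / (18 * n : ℝ) ≤ 1 / 2 := by
    apply one_div_le_one_div_of_le <;> linarith
  have h0 : 0 < 1 / (18 * n : ℝ) := by positivity
  obtain ⟨N, hN⟩ := exists_pow_lt_of_lt_one (by norm_num : (0 : ℝ) < 1 / 4)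
    (by linarith : 1 - 1 / (18 * n : ℝ) < 1)
  exact ⟨N, fun x => (surv_le hn N x).trans (by linarith)⟩

lemma exists_osc_tcP {n : ℕ} (hn : 4 ≤ n) : ∃ C r : ℝ, 0 ≤ C ∧ 0 ≤ r ∧ r < 1 ∧ ∀ t x x' y,
    |(tcP n ^ t) x y - (tcP n ^ t) x' y| ≤ C * r ^ t := by
  obtain ⟨N, hN⟩ := exists_surv_le_half hn
  exact exists_osc_le (tcP_nonneg n) (tcP_row_sum hn) (tcP_oo n).ge hN

/-- The majorant of the cube of the inverse of the transform. -/
noncomputable def resG (n : ℕ) (B : Finset (ℤ × ℤ)) (θ : ℝ) : ℝ :=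
  10 ^ 30 * (1 + ∑ k ∈ B, (qa n k)⁻¹ *
    ((θ * (cT n 0 + cT n 1) - 2 * Real.pi * (k.1 + k.2)) ^ 2 + qa n k ^ 2)⁻¹)

lemma qa_pos {n : ℕ} (hn : 0 < n) {k : ℤ × ℤ} (hk : k ≠ 0) : 0 < qa n k := by
  have := one_le_mul_sqrt_mul_qa hn hk
  by_contra! h
  nlinarith [Real.sqrt_nonneg (n : ℝ)]

lemma continuous_resG {n : ℕ} (hn : 0 < n) {B : Finset (ℤ × ℤ)} (hB : 0 ∉ B) :
    Continuous (resG n B) := by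
  unfold resG
  refine continuous_const.mul (continuous_const.add (continuous_finsetSum _ fun k hk => ?_))
  have := qa_pos hn (k := k) fun h => hB (h ▸ hk)
  exact continuous_const.mul (Continuous.inv₀ (by fun_prop) fun θ => by positivity)

lemma le_resG (n : ℕ) (B : Finset (ℤ × ℤ)) (θ : ℝ) : 10 ^ 30 ≤ resG n B θ := by
  unfold resG
  have : 0 ≤ ∑ k ∈ B, (qa n k)⁻¹ *
    ((θ * (cT n 0 + cT n 1) - 2 * Real.pi * (k.1 + k.2)) ^ 2 + qa n k ^ 2)⁻¹ :=
    Finset.sum_nonneg fun k _ => by have := qa_nonneg n k; positivity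
  linarith

lemma term_le_resG (n : ℕ) {B : Finset (ℤ × ℤ)} (θ : ℝ) {k : ℤ × ℤ} (hk : k ∈ B) :
    10 ^ 30 * ((qa n k)⁻¹ *
    ((θ * (cT n 0 + cT n 1) - 2 * Real.pi * (k.1 + k.2)) ^ 2 + qa n k ^ 2)⁻¹) ≤ resG n B θ := by
  unfold resG
  have := Finset.single_le_sum (f := fun k => (qa n k)⁻¹ *
    ((θ * (cT n 0 + cT n 1) - 2 * Real.pi * (k.1 + k.2)) ^ 2 + qa n k ^ 2)⁻¹)
    (fun k _ => by have := qa_nonneg n k; positivity) hk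
  linarith

lemma integral_resG_le {n : ℕ} (h4 : 4 ∣ n) (hn : 0 < n) {B : Finset (ℤ × ℤ)} (hB : 0 ∉ B) {C : ℝ}
    (hC : ∑ k ∈ B, (qa n k ^ 2)⁻¹ ≤ C * n) :
    ∫ θ in -Real.pi..Real.pi, resG n B θ ≤ 10 ^ 30 * (2 * Real.pi + Real.pi * C) := by
  have hn4 : (4 : ℝ) ≤ n := by exact_mod_cast Nat.le_of_dvd hn h4
  have hT : 12 * n ≤ cT n 0 + cT n 1 := by
    rw [cT_one]; linarith [(cT_zero_bounds h4 hn).1]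
  set T := cT n 0 + cT n 1 with hTdef
  have hT0 : 0 < T := by linarith
  have hpos : ∀ k ∈ B, 0 < qa n k := fun k hk => qa_pos hn fun h => hB (h ▸ hk)
  have hcont : ∀ k ∈ B, Continuous fun θ : ℝ => (qa n k)⁻¹ *
      ((θ * T - 2 * Real.pi * (k.1 + k.2)) ^ 2 + qa n k ^ 2)⁻¹ := fun k hk => by
    have := hpos k hk
    exact continuous_const.mul (Continuous.inv₀ (by fun_prop) fun θ => by positivity)
  simp only [resG, ← hTdef]
  rw [intervalIntegral.integral_const_mul, intervalIntegral.integral_add (by simp)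
    ((continuous_finsetSum _ hcont).intervalIntegrable _ _),
    intervalIntegral.integral_finsetSum fun k hk => (hcont k hk).intervalIntegrable _ _]
  gcongr
  · simp; linarith
  calc _ ≤ ∑ k ∈ B, Real.pi / n * (qa n k ^ 2)⁻¹ := Finset.sum_le_sum fun k hk => by
        have hk0 := hpos k hk
        rw [intervalIntegral.integral_const_mul]
        refine (mul_le_mul_of_nonneg_left (integral_inv_sq_add_sq_le hT0 hk0 _ _ _)
          (by positivity)).trans ?_
        have : Real.pi / (T * qa n k) ≤ Real.pi / (n * qa n k) := by
          gcongr
          linarith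
        refine (mul_le_mul_of_nonneg_left this (by positivity)).trans (le_of_eq ?_)
        field_simp
    _ = Real.pi / n * ∑ k ∈ B, (qa n k ^ 2)⁻¹ := by rw [Finset.mul_sum]
    _ ≤ Real.pi / n * (C * n) := by gcongr
    _ = _ := by field_simp

/-- The box of resonance indices. -/
noncomputable def resBox (n : ℕ) : Finset (ℤ × ℤ) :=
  (Finset.Icc (-(5 * n : ℤ)) (5 * n) ×ˢ Finset.Icc (-(5 * n : ℤ)) (5 * n)).erase 0

lemma mem_resBox {n : ℕ} (h4 : 4 ∣ n) (hn : 0 < n) {θ : ℝ} (hθ : |θ| ≤ Real.pi) {k : Fin 2 → ℤ}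
    (hx : ∀ i, |θ * cT n i - 2 * Real.pi * k i| ≤ Real.pi) (hk : (k 0, k 1) ≠ 0) :
    (k 0, k 1) ∈ resBox n := by
  have hn4 : (4 : ℝ) ≤ n := by exact_mod_cast Nat.le_of_dvd hn h4
  have hp := Real.pi_pos
  have key : ∀ i, |k i| ≤ 5 * n := fun i => by
    have hT : 0 ≤ cT n i ∧ cT n i ≤ 9 * n := by
      have := cT_zero_bounds h4 hn
      fin_cases i
      · exact ⟨by simp only [Fin.zero_eta]; linarith, this.2⟩
      · simp only [Fin.mk_one, cT_one]; constructor <;> linarith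
    have h1 : |2 * Real.pi * k i| ≤ Real.pi * (9 * n) + Real.pi := by
      have e : 2 * Real.pi * k i = θ * cT n i - (θ * cT n i - 2 * Real.pi * k i) := by ring
      rw [e]
      refine (abs_sub _ _).trans (add_le_add ?_ (hx i))
      rw [abs_mul, abs_of_nonneg hT.1]
      exact mul_le_mul hθ hT.2 hT.1 hp.le
    rw [abs_mul, abs_of_pos (by positivity)] at h1
    have h2 : |(k i : ℝ)| ≤ 5 * n := by
      by_contra! h
      nlinarith
    exact_mod_cast h2
  simp only [resBox, Finset.mem_erase, Finset.mem_product, Finset.mem_Icc]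
  exact ⟨hk, abs_le.1 (key 0), abs_le.1 (key 1)⟩

lemma inv_pow_le_resonance {s a : ℝ} (ha : 0 < a) :
    1 / ((|s| + a) / (5 * 10 ^ 9)) ^ 3 ≤ 10 ^ 30 * (a⁻¹ * (s ^ 2 + a ^ 2)⁻¹) := by
  have hs := abs_nonneg s
  have h1 : a * (s ^ 2 + a ^ 2) ≤ (|s| + a) ^ 3 := by
    rw [← sq_abs s]
    nlinarith [mul_nonneg hs ha.le, pow_nonneg hs 3,
      mul_nonneg (mul_nonneg hs hs) ha.le, mul_nonneg (mul_nonneg hs ha.le) ha.le]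
  rw [← mul_inv, ← div_eq_mul_inv, div_pow, one_div_div,
    div_le_div_iff₀ (by positivity) (by positivity)]
  have : 0 ≤ a * (s ^ 2 + a ^ 2) := by positivity
  nlinarith

lemma exists_transform_lower {n : ℕ} (h4 : 4 ∣ n) (hn : 10 ^ 18 ≤ n) {θ : ℝ}
    (hθ : θ ∈ Set.Icc (-Real.pi) Real.pi) (hθ0 : θ ≠ 0) :
    ∃ σ > 0, 1 / σ ^ 3 ≤ resG n (resBox n) θ ∧
      (σ * (18 * n) ≤ ‖fser (fun t => surv (tcP n) (oo n) t (oo n)) θ‖ ∨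
        σ ≤ ‖(1 - exp (θ * I)) * fser (fun t => surv (tcP n) (oo n) t (oo n)) θ‖) := by
  have hnR : (10 : ℝ) ^ 18 ≤ n := by exact_mod_cast hn
  have hθ' : |θ| ≤ Real.pi := abs_le.2 hθ
  obtain ⟨f, m, W, hfo, hf, hsum, hS, hm1, hm2, hW⟩ :=
    exists_near_eigenfunction (n := n) (by omega) hθ'
  have hn0 : 0 < n := by omega
  obtain ⟨hw1, hw2⟩ := wronsk_bounds (n := n) (by omega)
  rw [hS, norm_mul, norm_exp_ofReal_mul_I, one_mul]
  have hA : 1 / (1 / 10 ^ 8 : ℝ) ^ 3 ≤ resG n (resBox n) θ := le_trans (by norm_num) (le_resG _ _ _)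
  by_cases hbig : |θ| ≤ 1 / 1200
  swap
  · refine ⟨1 / 10 ^ 8, by norm_num, hA, Or.inr ?_⟩
    have h := hsum (oo n)
    rw [if_pos rfl] at h
    refine le_trans ?_ (norm_ge_of_large (by omega) hθ' hfo hf h)
    rw [← sq_abs]; nlinarith
  by_cases hq : n * θ ^ 2 ≤ 1
  swap
  · refine ⟨1 / 10 ^ 8, by norm_num, hA, Or.inr ?_⟩
    exact le_trans (by norm_num) (norm_ge_of_one_le hbig (not_le.1 hq).le hm1 hW hw1)
  choose k hk using fun i => exists_angle (θ * cT n i)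
  set x : Fin 2 → ℝ := fun i => θ * cT n i - 2 * Real.pi * k i with hx
  have hm2' : ∀ i, ‖m i - exp (x i * I)‖ ≤ 270 * (n * θ ^ 2) := fun i => by
    rw [hx, ← exp_mul_I_sub_two_pi]
    exact hm2 i (by linarith)
  have hR := resonance_lower hnR hq hm1 hm2' hW hk hw1
  set A := 1 / 4 * ∑ i, (1 - m i) * W i with hAdef
  have hpos : 0 ≤ x 0 ^ 2 + x 1 ^ 2 + n * θ ^ 2 := by positivity
  by_cases hk0 : (k 0, k 1) = 0
  · have hk1 : k 0 = 0 ∧ k 1 = 0 := by simpa using hk0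
    refine ⟨1 / 10 ^ 9 / 2, by norm_num, le_trans (by norm_num) (le_resG _ _ _), Or.inl ?_⟩
    have hs : x 0 + x 1 = θ * (cT n 0 + cT n 1) := by
      simp only [hx, hk1.1, hk1.2]; push_cast; ring
    have hT : 12 * n ≤ cT n 0 + cT n 1 := by
      rw [cT_one]; linarith [(cT_zero_bounds h4 hn0).1]
    rw [hs, abs_mul, abs_of_nonneg (by linarith : 0 ≤ cT n 0 + cT n 1)] at hR
    have hA2 : ‖A‖ ≤ |θ| * ‖fser (fun t => surv (tcP n) (oo n) t (oo n)) θ‖ := by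
      have := congrArg norm hS
      rw [norm_mul, norm_mul, norm_exp_ofReal_mul_I, one_mul] at this
      rw [← this]
      gcongr
      exact norm_one_sub_exp_le θ
    have hθp : 0 < |θ| := abs_pos.2 hθ0
    set S := ‖fser (fun t => surv (tcP n) (oo n) t (oo n)) θ‖
    have h1 : |θ| * (12 * n) ≤ |θ| * (10 ^ 9 * S) := by nlinarith
    have h2 := le_of_mul_le_mul_left h1 hθp
    linarith
  · have hmem := mem_resBox h4 hn0 hθ' hk hk0
    have ha := qa_pos hn0 hk0
    have hqa := qa_le h4 hn0 (x := x) (k := k) (fun i => rfl)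
    refine ⟨(|x 0 + x 1| + qa n (k 0, k 1)) / (5 * 10 ^ 9), by positivity, ?_, Or.inr ?_⟩
    · refine (inv_pow_le_resonance ha).trans ?_
      refine le_trans (le_of_eq ?_) (term_le_resG n θ hmem)
      simp only [hx]
      congr 4
      ring
    · rw [div_le_iff₀ (by positivity)]
      linarith [abs_nonneg (x 0 + x 1)]

/-- Decay of the dependence of return probabilities on the starting point. -/
lemma exists_sq_mul_abs_le : ∃ C : ℝ, 0 ≤ C ∧ ∀ n : ℕ, 4 ∣ n → 10 ^ 18 ≤ n → ∀ x (t : ℕ),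
    (t : ℝ) ^ 2 * |(tcP n ^ t) (oo n) (oo n) - (tcP n ^ t) x (oo n)| ≤ C * n ^ 2 := by
  obtain ⟨C, hC0, hC⟩ := exists_sum_inv_qa_sq_le
  refine ⟨1296 * 18 ^ 2 * 10 ^ 30 * (1 + C), by positivity, fun n h4 hn x t => ?_⟩
  have hn0 : 0 < n := by omega
  have hn4 : 4 ≤ n := by omega
  by_cases hx : x = oo n
  · rw [hx, sub_self, abs_zero, mul_zero]; positivity
  obtain ⟨C', r, hC', hr0, hr1, hosc⟩ := exists_osc_tcP hn4
  have hB : (0 : ℤ × ℤ) ∉ resBox n := by simp [resBox]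
  have h := sq_mul_abs_le_integral
    (d := fun s => (tcP n ^ s) (oo n) (oo n) - (tcP n ^ s) x (oo n))
    (Rapid.of_le_geometric hr0 hr1 fun s => hosc s _ _ _) (survBound_tcP hn4 (oo n))
    (survBound_tcP hn4 x) (fun s => convolution_surv (tcP_row_sum hn4) s hx)
    (continuous_resG hn0 hB) (fun θ hθ hθ0 => exists_transform_lower h4 hn hθ hθ0) t
  have hI := integral_resG_le h4 hn0 hB (hC n hn0 _ hB)
  have hp := Real.pi_pos
  have h2 := h.trans (mul_le_mul_of_nonneg_left hI (by positivity))
  have h3 : 2 * Real.pi * ((t : ℝ) ^ 2 * |(tcP n ^ t) (oo n) (oo n) - (tcP n ^ t) x (oo n)|) ≤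
      2 * Real.pi * (1296 * 18 ^ 2 * 10 ^ 30 * (1 + C) * n ^ 2) := by
    refine h2.trans ?_
    have : 0 ≤ Real.pi * C * n ^ 2 := by positivity
    nlinarith
  exact le_of_mul_le_mul_left h3 (by positivity)

end TwoCycle

namespace TwoCycle

lemma mul_pow_reversal {V : Type*} [Fintype V] [DecidableEq V] {P : Matrix V V ℝ} {μ : V → ℝ}
    (σ : V ≃ V) (h : ∀ x y, μ x * P x y = μ y * P (σ y) (σ x)) (t : ℕ) (x y : V) :
    μ x * (P ^ t) x y = μ y * (P ^ t) (σ y) (σ x) := by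
  induction t generalizing x y with
  | zero =>
    simp only [pow_zero, Matrix.one_apply, EmbeddingLike.apply_eq_iff_eq]
    by_cases hxy : x = y
    · simp [hxy]
    · simp [hxy, Ne.symm hxy]
  | succ t ih =>
    have e1 : (P ^ (t + 1)) x y = ∑ z, (P ^ t) x z * P z y := by rw [pow_succ, Matrix.mul_apply]
    have e2 : (P ^ (t + 1)) (σ y) (σ x) = ∑ z, P (σ y) (σ z) * (P ^ t) (σ z) (σ x) := by
      rw [pow_succ', Matrix.mul_apply, ← σ.sum_comp]
    rw [e1, e2, Finset.mul_sum, Finset.mul_sum]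
    refine Finset.sum_congr rfl fun z _ => ?_
    calc μ x * ((P ^ t) x z * P z y) = (μ x * (P ^ t) x z) * P z y := by ring
      _ = (μ z * P z y) * (P ^ t) (σ z) (σ x) := by rw [ih]; ring
      _ = _ := by rw [h]; ring

/-- Reflection of the two cycles. -/
def flip (n : ℕ) : TwoCycleState n ≃ TwoCycleState n :=
  (Equiv.refl Unit).sumCongr ((Equiv.refl (Fin 2)).prodCongr Fin.revPerm)

/-- The unnormalised stationary measure. -/
noncomputable def stat (n : ℕ) : TwoCycleState n → ℝ
  | Sum.inl _ => 4
  | Sum.inr (i, j) => cw n i (j + 1)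

lemma tcHold_inl (n : ℕ) (u : Unit) : tcHold n (Sum.inl u) = 1 / 2 := rfl

lemma chold_reflect {n : ℕ} (h4 : 4 ∣ n) (i : Fin 2) {l : ℕ} (hl : l ≤ n) :
    chold n i (n - l) = chold n i l := by
  obtain ⟨m, rfl⟩ := h4
  have : (i = 0 ∧ 4 * m / 4 ≤ 4 * m - l ∧ 4 * m - l ≤ 3 * (4 * m) / 4) ↔
      (i = 0 ∧ 4 * m / 4 ≤ l ∧ l ≤ 3 * (4 * m) / 4) := by
    refine and_congr_right fun _ => ?_
    omega
  simp only [chold, this]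

lemma stat_mul_tcP {n : ℕ} (h4 : 4 ∣ n) (x y : TwoCycleState n) :
    stat n x * tcP n x y = stat n y * tcP n (flip n y) (flip n x) := by
  rcases x with u | ⟨i, j⟩ <;> rcases y with u' | ⟨i', j'⟩
  · rfl
  · have hj := j'.2
    have hc := cw_mul n i' (j' + 1)
    have hr : chold n i' ((Fin.rev j' : Fin (n - 1)) + 1) = chold n i' (j' + 1) := by
      rw [← chold_reflect h4 i' (l := j' + 1) (by omega), Fin.val_rev]
      congr 1
      omega
    simp only [flip, stat, tcP, Equiv.sumCongr_apply, Sum.map_inl, Sum.map_inr,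
      Equiv.prodCongr_apply, Prod.map_apply, Equiv.refl_apply, Fin.revPerm_apply,
      tcHold_inr, hr, tcHold_inl, tcStep, reduceCtorEq, if_false, zero_add]
    rw [← mul_assoc (cw _ _ _), mul_comm (cw _ _ _), hc]
    have a1 : ((Fin.rev j' : Fin (n - 1)) : ℕ) + 2 = n ↔ (j' : ℕ) = 0 := by rw [Fin.val_rev]; omega
    have a2 : ((Fin.rev j' : Fin (n - 1)) : ℕ) = 0 ↔ (j' : ℕ) + 2 = n := by rw [Fin.val_rev]; omega
    simp only [a1, a2]
    split_ifs <;> norm_num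
  · have hj := j.2
    have hc := cw_mul n i (j + 1)
    have a1 : ((Fin.rev j : Fin (n - 1)) : ℕ) + 2 = n ↔ (j : ℕ) = 0 := by rw [Fin.val_rev]; omega
    have a2 : ((Fin.rev j : Fin (n - 1)) : ℕ) = 0 ↔ (j : ℕ) + 2 = n := by rw [Fin.val_rev]; omega
    simp only [flip, stat, tcP, Equiv.sumCongr_apply, Sum.map_inl, Sum.map_inr,
      Equiv.prodCongr_apply, Prod.map_apply, Equiv.refl_apply, Fin.revPerm_apply,
      tcHold_inr, tcHold_inl, tcStep, reduceCtorEq, if_false, zero_add]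
    rw [← mul_assoc, mul_comm (cw _ _ _), hc]
    simp only [a1, a2]
    split_ifs <;> norm_num
  · have hj := j.2
    have hj' := j'.2
    have hc := cw_mul n i (j + 1)
    have hc' := cw_mul n i' (j' + 1)
    have hr : chold n i' ((Fin.rev j' : Fin (n - 1)) + 1) = chold n i' (j' + 1) := by
      rw [← chold_reflect h4 i' (l := j' + 1) (by omega), Fin.val_rev]
      congr 1
      omega
    have a1 : ((Fin.rev j : Fin (n - 1)) : ℕ) = Fin.rev j' + 1 ↔ (j' : ℕ) = j + 1 := by
      rw [Fin.val_rev, Fin.val_rev]; omega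
    have a2 : ((Fin.rev j : Fin (n - 1)) : ℕ) + 1 = Fin.rev j' ↔ (j' : ℕ) + 1 = j := by
      rw [Fin.val_rev, Fin.val_rev]; omega
    have a3 : (Sum.inr (i', Fin.rev j') : TwoCycleState n) = Sum.inr (i, Fin.rev j) ↔
        (Sum.inr (i, j) : TwoCycleState n) = Sum.inr (i', j') := by
      simp only [Sum.inr.injEq, Prod.mk.injEq, Fin.rev_inj]
      exact ⟨fun h => ⟨h.1.symm, h.2.symm⟩, fun h => ⟨h.1.symm, h.2.symm⟩⟩
    simp only [flip, stat, tcP, Equiv.sumCongr_apply, Sum.map_inr,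
      Equiv.prodCongr_apply, Prod.map_apply, Equiv.refl_apply, Fin.revPerm_apply,
      tcHold_inr, hr, tcStep, a1, a2, a3, eq_comm (a := i') (b := i)]
    by_cases hxy : (Sum.inr (i, j) : TwoCycleState n) = Sum.inr (i', j')
    · simp only [Sum.inr.injEq, Prod.mk.injEq] at hxy
      obtain ⟨rfl, rfl⟩ := hxy
      rfl
    · simp only [if_neg hxy, zero_add]
      rw [← mul_assoc, ← mul_assoc, mul_comm (cw _ _ _), hc, mul_comm (cw _ _ _), hc']

lemma stat_bounds (n : ℕ) (x : TwoCycleState n) : 2 ≤ stat n x ∧ stat n x ≤ 4 := by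
  rcases x with u | ⟨i, j⟩
  · norm_num [stat]
  · have := cw_bounds n i (j + 1)
    simp only [stat]
    constructor <;> linarith [this.1, this.2]

lemma sum_stat_bounds {n : ℕ} (hn : 4 ≤ n) : 4 * n ≤ ∑ x, stat n x ∧ ∑ x, stat n x ≤ 6 * n := by
  have hn' : (4 : ℝ) ≤ n := by exact_mod_cast hn
  rw [Fintype.sum_sum_type]
  have e : ((n - 1 : ℕ) : ℝ) = n - 1 := by rw [Nat.cast_sub (by omega)]; simp
  have h0 : ∑ a : Unit, stat n (Sum.inl a) = 4 := by simp [stat]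
  have hcard : ((Finset.univ : Finset (Fin 2 × Fin (n - 1))).card : ℝ) = 2 * (n - 1) := by
    simp [e]
  have h1 : ∀ a : Fin 2 × Fin (n - 1), 2 ≤ stat n (Sum.inr a) ∧ stat n (Sum.inr a) ≤ 3 := fun a =>
    cw_bounds n a.1 (a.2 + 1)
  have lo := Finset.card_nsmul_le_sum Finset.univ (fun a => stat n (Sum.inr a)) 2
    fun a _ => (h1 a).1
  have hi := Finset.sum_le_card_nsmul Finset.univ (fun a => stat n (Sum.inr a)) 3
    fun a _ => (h1 a).2
  rw [nsmul_eq_mul, hcard] at lo hi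
  rw [h0]
  constructor <;> linarith

/-- A stationary distribution of the chain. -/
structure IsStat (n : ℕ) (π : TwoCycleState n → ℝ) : Prop where
  nonneg : ∀ x, 0 ≤ π x
  sum_eq_one : ∑ x, π x = 1
  stationary : ∀ y, ∑ x, π x * tcP n x y = π y

lemma IsStat.unique {n : ℕ} (hn : 4 ≤ n) {π ρ : TwoCycleState n → ℝ} (hπ : IsStat n π)
    (hρ : IsStat n ρ) (y : TwoCycleState n) : π y = ρ y := by
  obtain ⟨C, r, hC, hr0, hr1, h⟩ := exists_osc_tcP hn
  have hlim : Filter.Tendsto (fun t : ℕ => C * r ^ t + C * r ^ t) Filter.atTop (nhds 0) := by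
    have := (tendsto_pow_atTop_nhds_zero_of_lt_one hr0 hr1).const_mul C
    simpa using this.add this
  have hle : ∀ t : ℕ, |π y - ρ y| ≤ C * r ^ t + C * r ^ t := fun t => by
    have a := abs_pow_sub_stationary_le hπ.nonneg hπ.sum_eq_one hπ.stationary
      (fun x' => h t (oo n) x' y)
    have b := abs_pow_sub_stationary_le hρ.nonneg hρ.sum_eq_one hρ.stationary
      (fun x' => h t (oo n) x' y)
    have e : π y - ρ y = ((tcP n ^ t) (oo n) y - ρ y) - ((tcP n ^ t) (oo n) y - π y) := by ring
    rw [e]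
    exact (abs_sub _ _).trans (add_le_add b a)
  have := ge_of_tendsto hlim (Filter.Eventually.of_forall hle)
  exact sub_eq_zero.1 (abs_nonpos_iff.1 this)

lemma IsStat.eq_stat {n : ℕ} (h4 : 4 ∣ n) (hn : 4 ≤ n) {π : TwoCycleState n → ℝ} (hπ : IsStat n π)
    (y : TwoCycleState n) : π y = stat n y / ∑ x, stat n x := by
  have hZ := sum_stat_bounds hn
  have hn' : (4 : ℝ) ≤ n := by exact_mod_cast hn
  have hZ0 : 0 < ∑ x, stat n x := by linarith
  refine hπ.unique hn (ρ := fun y => stat n y / ∑ x, stat n x) ⟨fun x => ?_, ?_, fun y => ?_⟩ y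
  · exact div_nonneg (by linarith [(stat_bounds n x).1]) hZ0.le
  · rw [← Finset.sum_div, div_self hZ0.ne']
  · simp only [div_mul_eq_mul_div]
    rw [← Finset.sum_div]
    congr 1
    rw [Finset.sum_congr rfl fun x _ => stat_mul_tcP h4 x y, ← Finset.mul_sum,
      (flip n).sum_comp (fun x => tcP n (flip n y) x), tcP_row_sum hn, mul_one]

lemma IsStat.bounds {n : ℕ} (h4 : 4 ∣ n) (hn : 4 ≤ n) {π : TwoCycleState n → ℝ} (hπ : IsStat n π)
    (y : TwoCycleState n) : 1 / (3 * n : ℝ) ≤ π y ∧ π y ≤ 1 / n := by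
  have hZ := sum_stat_bounds hn
  have hs := stat_bounds n y
  have hn' : (4 : ℝ) ≤ n := by exact_mod_cast hn
  rw [hπ.eq_stat h4 hn]
  constructor
  · rw [div_le_div_iff₀ (by linarith) (by linarith)]
    nlinarith
  · rw [div_le_div_iff₀ (by linarith) (by linarith)]
    nlinarith

lemma IsStat.abs_from_oo_le {n : ℕ} (h4 : 4 ∣ n) (hn : 4 ≤ n) {π : TwoCycleState n → ℝ}
    (hπ : IsStat n π) (s : ℕ) (y : TwoCycleState n) :
    |(tcP n ^ s) (oo n) y - π y| ≤ |(tcP n ^ s) (flip n y) (oo n) - π (oo n)| := by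
  have h := mul_pow_reversal (flip n) (stat_mul_tcP h4) s (oo n) y
  have ho : stat n (oo n) = 4 := rfl
  have hf : flip n (oo n) = oo n := rfl
  rw [ho, hf] at h
  have e : (tcP n ^ s) (oo n) y - π y =
      stat n y / 4 * ((tcP n ^ s) (flip n y) (oo n) - π (oo n)) := by
    rw [hπ.eq_stat h4 hn y, hπ.eq_stat h4 hn (oo n), ho]
    linear_combination (1 / 4) * h
  have hs := stat_bounds n y
  rw [e, abs_mul, abs_of_nonneg (by linarith)]
  exact mul_le_of_le_one_left (abs_nonneg _) (by linarith)

end TwoCycle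

namespace TwoCycle

lemma IsStat.unif_of_abs_le {n : ℕ} (h4 : 4 ∣ n) (hn : 4 ≤ n) {π : TwoCycleState n → ℝ}
    (hπ : IsStat n π) {t : ℕ} (h : ∀ x y, |(tcP n ^ t) x y - π y| ≤ 1 / (12 * n : ℝ))
    (x y : TwoCycleState n) : |(tcP n ^ t) x y / π y - 1| ≤ 1 / 4 := by
  have hn' : (4 : ℝ) ≤ n := by exact_mod_cast hn
  have hb := (hπ.bounds h4 hn y).1
  have hpos : 0 < 1 / (3 * n : ℝ) := by positivity
  have hy : 0 < π y := by linarith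
  have e : (tcP n ^ t) x y / π y - 1 = ((tcP n ^ t) x y - π y) / π y := by field_simp
  rw [e, abs_div, abs_of_pos hy, div_le_iff₀ hy]
  refine (h x y).trans ?_
  have : 1 / (12 * n : ℝ) = 1 / 4 * (1 / (3 * n)) := by field_simp; norm_num
  rw [this]
  linarith

lemma exists_unif_time {n : ℕ} (h4 : 4 ∣ n) (hn : 4 ≤ n) : ∃ t : ℕ, ∀ π : TwoCycleState n → ℝ,
    IsStat n π → ∀ x y, |(tcP n ^ t) x y / π y - 1| ≤ 1 / 4 := by
  have hn' : (4 : ℝ) ≤ n := by exact_mod_cast hn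
  obtain ⟨C, r, hC, hr0, hr1, h⟩ := exists_osc_tcP hn
  have hlim : Filter.Tendsto (fun t : ℕ => C * r ^ t) Filter.atTop (nhds 0) := by
    simpa using (tendsto_pow_atTop_nhds_zero_of_lt_one hr0 hr1).const_mul C
  obtain ⟨t, ht⟩ := (hlim.eventually_le_const (by positivity : 0 < 1 / (12 * n : ℝ))).exists
  exact ⟨t, fun π hπ => hπ.unif_of_abs_le h4 hn fun x y =>
    (abs_pow_sub_stationary_le hπ.nonneg hπ.sum_eq_one hπ.stationary
      (fun x' => h t x x' y)).trans ht⟩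

lemma surv_le_div_sq {n : ℕ} (hn : 4 ≤ n) {t : ℕ} (ht : 0 < t) (x : TwoCycleState n) :
    surv (tcP n) (oo n) t x ≤ 1296 * n ^ 2 / t ^ 2 := by
  have hn' : (4 : ℝ) ≤ n := by exact_mod_cast hn
  have ht' : (0 : ℝ) < t := by exact_mod_cast ht
  have h18 : 1 / (18 * n : ℝ) ≤ 1 / 2 := by
    apply one_div_le_one_div_of_le <;> linarith
  set u : ℝ := t * (1 / (18 * n)) with hu
  have hu0 : 0 < u := by positivity
  have h1 : (1 - 1 / (18 * n : ℝ)) ^ t ≤ Real.exp (-u) := by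
    have : 1 - 1 / (18 * n : ℝ) ≤ Real.exp (-(1 / (18 * n))) := by
      have := Real.add_one_le_exp (-(1 / (18 * n : ℝ))); linarith
    refine (pow_le_pow_left₀ (by linarith) this t).trans (le_of_eq ?_)
    rw [← Real.exp_nat_mul]; congr 1; rw [hu]; ring
  have h2 : Real.exp (-u) ≤ 2 / u ^ 2 := by
    have := Real.quadratic_le_exp_of_nonneg hu0.le
    rw [Real.exp_neg, inv_le_comm₀ (Real.exp_pos _) (by positivity), inv_div]
    linarith
  refine (surv_le hn t x).trans ?_
  calc 2 * (1 - 1 / (18 * n : ℝ)) ^ t ≤ 2 * (2 / u ^ 2) := by linarith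
    _ = _ := by rw [hu]; field_simp; norm_num

lemma exists_unif_upper : ∃ L : ℝ, 0 < L ∧ ∀ n : ℕ, 4 ∣ n → 10 ^ 18 ≤ n →
    ∀ π : TwoCycleState n → ℝ, IsStat n π → ∃ t : ℕ, (t : ℝ) ≤ L * (n : ℝ) ^ (3 / 2 : ℝ) ∧
      ∀ x y, |(tcP n ^ t) x y / π y - 1| ≤ 1 / 4 := by
  obtain ⟨C, hC0, hC⟩ := exists_sq_mul_abs_le
  set K : ℝ := 24 * C + 15552 + 1 with hK
  refine ⟨2 * K + 2, by positivity, fun n h4 hn π hπ => ?_⟩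
  have hn4 : 4 ≤ n := by omega
  have hn1 : (1 : ℝ) ≤ n := by exact_mod_cast (by omega : 1 ≤ n)
  set N : ℝ := (n : ℝ) ^ (3 / 2 : ℝ) with hN
  have hN1 : 1 ≤ N := Real.one_le_rpow hn1 (by norm_num)
  have hN2 : N ^ 2 = n ^ 3 := by
    rw [hN, ← Real.rpow_natCast, ← Real.rpow_mul (by linarith), ← Real.rpow_natCast]
    norm_num
  set s : ℕ := ⌈K * N⌉₊ with hs
  have hsK : K * N ≤ s := Nat.le_ceil _
  have hsK' : s ≤ K * N + 1 := (Nat.ceil_lt_add_one (by positivity)).le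
  have hs0 : (0 : ℝ) < s := lt_of_lt_of_le (by positivity) hsK
  have hs0' : 0 < s := by exact_mod_cast hs0
  refine ⟨s + s, by push_cast; nlinarith, hπ.unif_of_abs_le h4 hn4 fun x y => ?_⟩
  have hdiff : ∀ s', s ≤ s' → ∀ x x', |(tcP n ^ s') x (oo n) - (tcP n ^ s') x' (oo n)| ≤
      2 * C * n ^ 2 / s ^ 2 := fun s' hs' x x' => by
    have hss : (s : ℝ) ≤ s' := by exact_mod_cast hs'
    have key : ∀ x, |(tcP n ^ s') (oo n) (oo n) - (tcP n ^ s') x (oo n)| ≤ C * n ^ 2 / s ^ 2 :=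
      fun x => by
        rw [le_div_iff₀ (by positivity), mul_comm]
        refine le_trans ?_ (hC n h4 hn x s')
        gcongr
    have e : (tcP n ^ s') x (oo n) - (tcP n ^ s') x' (oo n) =
      ((tcP n ^ s') (oo n) (oo n) - (tcP n ^ s') x' (oo n)) -
        ((tcP n ^ s') (oo n) (oo n) - (tcP n ^ s') x (oo n)) := by ring
    rw [e]
    refine (abs_sub _ _).trans ((add_le_add (key x') (key x)).trans (le_of_eq ?_))
    ring
  have hb := hπ.bounds h4 hn4 y
  have hb1 : π y ≤ 1 := hb.2.trans (by rw [div_le_one (by linarith)]; exact hn1)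
  have h := abs_pow_sub_le (tcP_nonneg n) (tcP_row_sum hn4) (o := oo n) (y := y) (b := π y)
    (ε := 2 * C * n ^ 2 / s ^ 2) (t₀ := s) (by positivity) (hπ.nonneg y) hb1
    (fun s' hs' => (hπ.abs_from_oo_le h4 hn4 s' y).trans
      (abs_pow_sub_stationary_le hπ.nonneg hπ.sum_eq_one hπ.stationary
        fun x' => hdiff s' hs' _ x')) s x
  refine h.trans ?_
  have h2 := surv_le_div_sq hn4 hs0' x
  have h3 : 2 * C * n ^ 2 / s ^ 2 + 1296 * n ^ 2 / s ^ 2 ≤ 1 / (12 * n : ℝ) := by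
    rw [← add_div, div_le_div_iff₀ (by positivity) (by positivity), one_mul]
    have h4 : K * n ^ 3 ≤ (s : ℝ) ^ 2 := by
      calc K * n ^ 3 ≤ K ^ 2 * N ^ 2 := by
            rw [hN2]; gcongr; nlinarith
        _ = (K * N) ^ 2 := by ring
        _ ≤ _ := by gcongr
    refine le_trans ?_ h4
    have : (0 : ℝ) ≤ n ^ 3 := by positivity
    rw [hK]
    nlinarith
  linarith

end TwoCycle

namespace TwoCycle

open Complex

section NearEigen

variable {V : Type*} [Fintype V] [DecidableEq V] {P : Matrix V V ℝ} {o : V}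

lemma sum_pow_succ {E : Type*} [AddCommGroup E] [Module ℝ E] (t : ℕ) (x : V) (g : V → E) :
    ∑ y, (P ^ (t + 1)) x y • g y = ∑ z, (P ^ t) x z • ∑ y, P z y • g y := by
  simp only [pow_succ, Matrix.mul_apply, Finset.sum_smul, Finset.smul_sum, mul_smul]
  exact Finset.sum_comm

/-- A Lyapunov bound for the expected occupation time of `o`. -/
lemma occupation_le (h0 : ∀ x y, 0 ≤ P x y) (h1 : ∀ x, ∑ y, P x y = 1) {h : V → ℝ} {M a : ℝ}
    (hM : ∀ x, h x ≤ M) (hh : ∀ x, h x - 1 + (if x = o then a else 0) ≤ ∑ y, P x y • h y) (t : ℕ)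
    (x : V) : a * ∑ s ∈ Finset.range t, (P ^ s) x o ≤ t + M - h x := by
  have key : h x - t + a * ∑ s ∈ Finset.range t, (P ^ s) x o ≤ ∑ y, (P ^ t) x y • h y := by
    induction t with
    | zero => simp [Matrix.one_apply]
    | succ t ih =>
      rw [sum_pow_succ, Finset.sum_range_succ]
      have h2 : ∑ y, (P ^ t) x y • h y - 1 + a * (P ^ t) x o ≤
          ∑ z, (P ^ t) x z • ∑ y, P z y • h y := by
        refine le_trans (le_of_eq ?_) (Finset.sum_le_sum fun z _ =>
          smul_le_smul_of_nonneg_left (hh z) (pow_entry_nonneg h0 t x z))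
        simp only [smul_eq_mul, mul_add, mul_sub, mul_one, Finset.sum_add_distrib,
          Finset.sum_sub_distrib, pow_row_sum h1, mul_ite, mul_zero, Finset.sum_ite_eq',
          Finset.mem_univ, if_true]
        ring
      push_cast
      linarith
  have h3 : ∑ y, (P ^ t) x y • h y ≤ M := by
    calc _ ≤ ∑ y, (P ^ t) x y • M := Finset.sum_le_sum fun y _ =>
          smul_le_smul_of_nonneg_left (hM y) (pow_entry_nonneg h0 t x y)
      _ = M := by rw [← Finset.sum_smul, pow_row_sum h1, one_smul]
  linarith

lemma near_eigen_lower (h0 : ∀ x y, 0 ≤ P x y) {f : V → ℂ} {lam A : ℂ} (hl : ‖lam‖ = 1)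
    (hf : ∀ x, ∑ y, P x y • f y = lam * f x - if x = o then A else 0) (t : ℕ) (x : V) :
    ‖f x‖ - ‖A‖ * ∑ s ∈ Finset.range t, (P ^ s) x o ≤ ‖∑ y, (P ^ t) x y • f y‖ := by
  induction t with
  | zero => simp [Matrix.one_apply]
  | succ t ih =>
    have e : ∑ y, (P ^ (t + 1)) x y • f y = lam * ∑ y, (P ^ t) x y • f y - (P ^ t) x o • A := by
      rw [sum_pow_succ]
      simp only [hf, smul_sub, Finset.sum_sub_distrib, smul_ite, smul_zero, Finset.sum_ite_eq',
        Finset.mem_univ, if_true, Finset.mul_sum, mul_smul_comm]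
    rw [e, Finset.sum_range_succ]
    have := norm_sub_norm_le (lam * ∑ y, (P ^ t) x y • f y) ((P ^ t) x o • A)
    rw [norm_mul, hl, one_mul, norm_smul, Real.norm_of_nonneg (pow_entry_nonneg h0 t x o)] at this
    linarith

lemma stationary_near_eigen {π : V → ℝ} (hπ : ∀ y, ∑ x, π x * P x y = π y) {f : V → ℂ} {lam A : ℂ}
    (hf : ∀ x, ∑ y, P x y • f y = lam * f x - if x = o then A else 0) :
    (1 - lam) * ∑ x, π x • f x = -(π o • A) := by
  have e : ∑ x, π x • f x = ∑ x, π x • ∑ y, P x y • f y := by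
    simp only [Finset.smul_sum, smul_smul]
    rw [Finset.sum_comm]
    simp only [← Finset.sum_smul, hπ]
  have e2 : ∑ x, π x • ∑ y, P x y • f y = lam * ∑ x, π x • f x - π o • A := by
    simp only [hf, smul_sub, Finset.sum_sub_distrib, smul_ite, smul_zero, Finset.sum_ite_eq',
        Finset.mem_univ, if_true, Finset.mul_sum, mul_smul_comm]
  linear_combination e.trans e2

end NearEigen

lemma occupation_tcP {n : ℕ} (hn : 4 ≤ n) (t : ℕ) :
    ∑ s ∈ Finset.range t, (tcP n ^ s) (oo n) (oo n) ≤ 12 + 2 * t / n := by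
  have hn' : (4 : ℝ) ≤ n := by exact_mod_cast hn
  set u : ℕ → ℝ := fun j => 6 * ((n - j) - n * (1 / 2) ^ j) with hu
  set h : TwoCycleState n → ℝ := fun x => match x with
    | Sum.inl _ => 0
    | Sum.inr (_, j) => u (j + 1) with hh
  have hM : ∀ x, h x ≤ 6 * n := by
    rintro (_ | ⟨i, j⟩)
    · simp only [hh]; linarith
    · simp only [hh, hu]
      have : (0 : ℝ) ≤ ((j : ℕ) + 1 : ℕ) := Nat.cast_nonneg _
      have : (0 : ℝ) ≤ n * (1 / 2) ^ ((j : ℕ) + 1) := by positivity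
      linarith
  have hcyc : ∀ i j, j ≤ n → u j ≤ cyc h i j := fun i j hj => by
    rw [cyc]
    split_ifs with hc
    · have : j - 1 + 1 = j := by omega
      simp only [hh, this, le_refl]
    · have hj' : j = 0 ∨ j = n := by omega
      simp only [hh]
      rcases hj' with rfl | rfl
      · simp [hu]
      · simp only [hu]
        have : (0 : ℝ) ≤ j * (1 / 2) ^ j := by positivity
        linarith
  have hinner : ∀ i (j : ℕ) , j < n - 1 → cyc h i (j + 1) = u (j + 1) := fun i j hj => by
    rw [cyc_succ _ _ ⟨j, hj⟩]
  have hle := occupation_le (tcP_nonneg n) (tcP_row_sum hn) (o := oo n) (a := n / 2) hM ?_ t (oo n)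
  · have ho : h (oo n) = 0 := rfl
    rw [ho] at hle
    have : ∑ s ∈ Finset.range t, (tcP n ^ s) (oo n) (oo n) ≤ (t + 6 * n - 0) / (n / 2) := by
      rw [le_div_iff₀ (by linarith), mul_comm]; exact hle
    refine this.trans (le_of_eq ?_)
    field_simp
    ring
  · rintro (⟨⟩ | ⟨i, j⟩)
    · rw [sum_tcP_inl hn, if_pos rfl]
      have ho : h (Sum.inl ()) = 0 := rfl
      rw [ho]
      simp only [smul_eq_mul, Fin.sum_univ_two]
      have a0 := hcyc 0 1 (by omega)
      have a1 := hcyc 1 1 (by omega)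
      have b0 := hcyc 0 (n - 1) (by omega)
      have b1 := hcyc 1 (n - 1) (by omega)
      have e1 : u 1 = 3 * n - 6 := by simp only [hu]; push_cast; ring
      have e2 : 6 - 3 / 4 * n ≤ u (n - 1) := by
        simp only [hu]
        have : (1 / 2 : ℝ) ^ (n - 1) ≤ (1 / 2) ^ 3 :=
          pow_le_pow_of_le_one (by norm_num) (by norm_num) (by omega)
        rw [Nat.cast_sub (by omega)]
        push_cast
        nlinarith
      linarith
    · rw [sum_tcP_inr hn, if_neg (by simp), add_zero]
      have hj := j.2
      have c1 := hinner i j hj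
      have c2 := hcyc i (j + 2) (by omega)
      have c0 := hcyc i j (by omega)
      obtain ⟨ch1, ch2⟩ := chold_bounds n i (j + 1)
      have hx : h (Sum.inr (i, j)) = u (j + 1) := rfl
      rw [c1, hx]
      simp only [smul_eq_mul]
      set c := chold n i (j + 1)
      have e : 2 / 3 * u (j + 2) + 1 / 3 * u j = u (j + 1) - 2 := by
        simp only [hu]; push_cast; ring
      have step : (1 - c) * (2 / 3 * u (j + 2) + 1 / 3 * u j) ≤
          (1 - c) * (2 / 3 * cyc h i (j + 2) + 1 / 3 * cyc h i j) := by
        have : 0 ≤ 1 - c := by linarith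
        gcongr
      rw [e] at step
      nlinarith

end TwoCycle

namespace TwoCycle

open Complex

lemma half_le_norm_one_sub_exp {θ : ℝ} (h0 : 0 ≤ θ) (h1 : θ ≤ 1 / 9) :
    θ / 2 ≤ ‖1 - exp (-(θ * I))‖ := by
  have hp := Real.pi_gt_three
  have hp4 := Real.pi_lt_d2
  have him := abs_im_le_norm (1 - exp (-(θ * I)))
  have e : (1 - exp (-(θ * I))).im = Real.sin θ := by
    have : (-(θ * I) : ℂ) = ((-θ : ℝ) : ℂ) * I := by push_cast; ring
    rw [this, sub_im, exp_ofReal_mul_I_im, one_im, Real.sin_neg]; ring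
  rw [e] at him
  have hsin : θ / 2 ≤ Real.sin θ := by
    have := Real.mul_le_sin h0 (by linarith)
    have h2 : 1 / 2 ≤ 2 / Real.pi := by
      rw [div_le_div_iff₀ (by norm_num) Real.pi_pos]; linarith
    nlinarith
  linarith [le_abs_self (Real.sin θ)]

set_option maxHeartbeats 1000000 in
/-- A near-eigenfunction whose defect is of order `n ^ (-1/2)`. -/
lemma exists_slow_mode {n : ℕ} (h4 : 4 ∣ n) (hn : 10 ^ 18 ≤ n) :
    ∃ (f : TwoCycleState n → ℂ) (θ : ℝ) (A : ℂ), f (oo n) = 1 ∧ (∀ x, ‖f x‖ ≤ 1) ∧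
      (∀ x, ∑ y, tcP n x y • f y = exp (-(θ * I)) * f x - if x = oo n then A else 0) ∧
      ‖A‖ ≤ 13000 / √n ∧ 1 / (6 * n : ℝ) ≤ ‖1 - exp (-(θ * I))‖ := by
  have hnR : (10 : ℝ) ^ 18 ≤ n := by exact_mod_cast hn
  have hn0 : 0 < n := by omega
  have hn1 : (1 : ℝ) ≤ n := by linarith
  have hT0 := cT_zero_bounds h4 hn0
  have hT1 := cT_one n
  set T := cT n 0 + cT n 1 with hT
  have hTl : 12 * n ≤ T := by rw [hT, hT1]; linarith
  have hTu : T ≤ 15 * n := by rw [hT, hT1]; linarith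
  have hTpos : 0 < T := by linarith
  set M : ℝ := √(√n) with hM
  have hs1 : 1 ≤ √(n : ℝ) := Real.one_le_sqrt.2 hn1
  have hM1 : 1 ≤ M := Real.one_le_sqrt.2 hs1
  have hM2 : M ^ 2 = √n := Real.sq_sqrt (by linarith)
  have hsn : √(n : ℝ) ^ 2 = n := Real.sq_sqrt (by linarith)
  have hs9 : 10 ^ 9 ≤ √(n : ℝ) := Real.le_sqrt_of_sq_le (by norm_num at hnR ⊢; linarith)
  set N : ℕ := ⌈M⌉₊ with hN
  have hNM : M ≤ N := Nat.le_ceil M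
  have hNM' : (N : ℝ) ≤ 2 * M := by linarith [Nat.ceil_lt_add_one (by linarith : 0 ≤ M)]
  have hN0 : 0 < N := by
    have : (0 : ℝ) < N := by linarith
    exact_mod_cast this
  obtain ⟨l, K, hK0, hKN, hl⟩ := Real.exists_int_int_abs_mul_sub_le (cT n 0 / T) hN0
  have hp := Real.pi_pos
  have hp3 := Real.pi_gt_three
  have hp4 := Real.pi_lt_d2
  have hK1 : (1 : ℝ) ≤ K := by exact_mod_cast hK0
  have hKN' : (K : ℝ) ≤ N := by exact_mod_cast hKN
  set θ : ℝ := 2 * Real.pi * K / T with hθ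
  have hθT : θ * T = 2 * Real.pi * K := by rw [hθ]; field_simp
  have hθ0 : 0 < θ := by positivity
  have hθl : 1 / (3 * n : ℝ) ≤ θ := by
    rw [hθ, div_le_div_iff₀ (by positivity) hTpos]
    nlinarith [mul_nonneg (by linarith : (0:ℝ) ≤ Real.pi - 3) (by linarith : (0 : ℝ) ≤ K)]
  have hθu : n * θ ≤ 2 * M * 0.53 := by
    have h1 : 12 * n * θ ≤ 2 * Real.pi * (2 * M) := by
      calc 12 * n * θ ≤ T * θ := by gcongr
        _ = 2 * Real.pi * K := by linarith
        _ ≤ _ := by gcongr; linarith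
    nlinarith
  have hq : n * θ ^ 2 ≤ 1.2 / √n := by
    rw [le_div_iff₀ (by linarith)]
    have h1 : (n * θ) ^ 2 ≤ (2 * M * 0.53) ^ 2 := by gcongr
    have h2 : (n * θ) ^ 2 = (n * θ ^ 2 * √n) * √n := by
      calc (n * θ) ^ 2 = n * θ ^ 2 * n := by ring
        _ = n * θ ^ 2 * (√n) ^ 2 := by rw [hsn]
        _ = _ := by ring
    have h3 : (2 * M * 0.53) ^ 2 = 1.1236 * √n := by rw [← hM2]; ring
    rw [h2, h3] at h1
    have := le_of_mul_le_mul_right h1 (by linarith)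
    linarith
  have hq1 : n * θ ^ 2 ≤ 1 := hq.trans (by rw [div_le_one (by linarith)]; linarith)
  have hθs : |θ| ≤ 1 / 9 := by
    rw [abs_of_pos hθ0]
    by_contra! h
    nlinarith
  obtain ⟨f, m, W, hfo, hf, hsum, -, -, hm2, hW⟩ :=
    exists_near_eigenfunction (n := n) (by omega) (θ := θ) (by linarith)
  obtain ⟨hw1, hw2⟩ := wronsk_bounds (n := n) (by omega)
  set k : Fin 2 → ℤ := ![l, K - l] with hk
  set x : Fin 2 → ℝ := fun i => θ * cT n i - 2 * Real.pi * k i with hx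
  have hm2' : ∀ i, ‖m i - exp (x i * I)‖ ≤ 270 * (n * θ ^ 2) := fun i => by
    rw [hx, ← exp_mul_I_sub_two_pi]
    exact hm2 i hθs
  have hx01 : x 0 + x 1 = 0 := by
    have e : x 0 + x 1 = θ * T - 2 * Real.pi * K := by
      simp only [hx, hk, hT, Matrix.cons_val_zero, Matrix.cons_val_one]; push_cast; ring
    rw [e, hθT, sub_self]
  have hx0 : x 0 ^ 2 ≤ 40 / √n := by
    have e : x 0 = 2 * Real.pi * (K * (cT n 0 / T) - l) := by
      simp only [hx, hk, hθ, Matrix.cons_val_zero]; ring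
    have h1 : |K * (cT n 0 / T) - l| ≤ 1 / M := hl.trans (by
      apply one_div_le_one_div_of_le <;> linarith)
    rw [e, mul_pow, ← sq_abs (K * (cT n 0 / T) - l)]
    calc _ ≤ (2 * Real.pi) ^ 2 * (1 / M) ^ 2 := by gcongr
      _ = (2 * Real.pi) ^ 2 / √n := by rw [div_pow, hM2]; ring
      _ ≤ _ := by gcongr; nlinarith
  have hA := resonance_upper hnR hq1 hm2' hW (by linarith) hw2 hx01
  refine ⟨f, θ, 1 / 4 * ∑ i, (1 - m i) * W i, hfo, hf, fun y => ?_, ?_, ?_⟩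
  · rw [← hsum]; simp only [real_smul]
  · refine hA.trans ?_
    have : 13000 / √(n : ℝ) = 300 * (40 / √n + 1.2 / √n) + 640 / √n := by ring
    have : 0 ≤ 640 / √(n : ℝ) := by positivity
    linarith
  · have e : 1 / (6 * n : ℝ) = 1 / (3 * n) / 2 := by field_simp; norm_num
    rw [abs_of_pos hθ0] at hθs
    rw [e]
    exact le_trans (by linarith) (half_le_norm_one_sub_exp hθ0.le hθs)

lemma IsStat.mix_lower {n : ℕ} (h4 : 4 ∣ n) (hn : 10 ^ 18 ≤ n) {π : TwoCycleState n → ℝ}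
    (hπ : IsStat n π) {t : ℕ}
    (h : 1 / 2 * ∑ y, |(tcP n ^ t) (oo n) y - π y| ≤ 1 / 4) :
    1 / 10 ^ 6 * (n : ℝ) ^ (3 / 2 : ℝ) ≤ t := by
  have hnR : (10 : ℝ) ^ 18 ≤ n := by exact_mod_cast hn
  have hn0 : (0 : ℝ) < n := by linarith
  have hn4 : 4 ≤ n := by omega
  have hs9 : 10 ^ 9 ≤ √(n : ℝ) := Real.le_sqrt_of_sq_le (by norm_num at hnR ⊢; linarith)
  obtain ⟨f, θ, A, hfo, hf, hrec, hA, hlam⟩ := exists_slow_mode h4 hn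
  have hl : ‖exp (-(θ * I))‖ = 1 := by
    have : (-(θ * I) : ℂ) = ((-θ : ℝ) : ℂ) * I := by push_cast; ring
    rw [this, norm_exp_ofReal_mul_I]
  have h1 := near_eigen_lower (tcP_nonneg n) hl hrec t (oo n)
  rw [hfo, norm_one] at h1
  have h2 := occupation_tcP hn4 t
  have h3 : ‖∑ x, π x • f x‖ ≤ 6 * ‖A‖ := by
    have e := congrArg norm (stationary_near_eigen hπ.stationary hrec)
    rw [norm_mul, norm_neg, norm_smul, Real.norm_of_nonneg (hπ.nonneg _)] at e
    have hb := (hπ.bounds h4 hn4 (oo n)).2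
    have h6 : 1 / (6 * n : ℝ) * ‖∑ x, π x • f x‖ ≤ 1 / n * ‖A‖ := by
      calc _ ≤ ‖1 - exp (-(θ * I))‖ * ‖∑ x, π x • f x‖ := by gcongr
        _ = π (oo n) * ‖A‖ := e
        _ ≤ _ := by gcongr
    rw [div_mul_eq_mul_div, div_mul_eq_mul_div, div_le_div_iff₀ (by positivity) hn0] at h6
    nlinarith
  have h4' : ‖∑ y, (tcP n ^ t) (oo n) y • f y - ∑ x, π x • f x‖ ≤ 1 / 2 := by
    rw [← Finset.sum_sub_distrib]
    calc _ ≤ ∑ y, ‖(tcP n ^ t) (oo n) y • f y - π y • f y‖ := norm_sum_le _ _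
      _ ≤ ∑ y, |(tcP n ^ t) (oo n) y - π y| := Finset.sum_le_sum fun y _ => by
          rw [← sub_smul, norm_smul, Real.norm_eq_abs]
          exact mul_le_of_le_one_right (abs_nonneg _) (hf y)
      _ ≤ 1 / 2 := by linarith
  have h5 := norm_sub_norm_le (∑ y, (tcP n ^ t) (oo n) y • f y) (∑ x, π x • f x)
  have h6 : ‖A‖ * ∑ s ∈ Finset.range t, (tcP n ^ s) (oo n) (oo n) ≤ ‖A‖ * (12 + 2 * t / n) := by
    gcongr
  have h7 : 1 / 2 ≤ ‖A‖ * (18 + 2 * t / n) := by linarith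
  have h8 : 1 / 2 ≤ 13000 / √n * (18 + 2 * t / n) := h7.trans (by gcongr)
  have h9 : √n ≤ 26000 * (18 + 2 * t / n) := by
    rw [div_mul_eq_mul_div, le_div_iff₀ (by linarith)] at h8
    linarith
  have h10 : √n * n ≤ 10 ^ 6 * t := by
    have : √(n : ℝ) ≤ 10 ^ 6 * (t / n) := by
      have e : 2 * (t : ℝ) / n = 2 * (t / n) := by ring
      rw [e] at h9
      have : 0 ≤ (t : ℝ) / n := by positivity
      linarith
    calc √n * n ≤ 10 ^ 6 * (t / n) * n := by gcongr
      _ = _ := by field_simp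
  have e : (n : ℝ) ^ (3 / 2 : ℝ) = √n * n := by
    rw [Real.sqrt_eq_rpow, show (3 / 2 : ℝ) = 1 / 2 + 1 by norm_num, Real.rpow_add hn0,
      Real.rpow_one]
  rw [e]
  linarith

end TwoCycle

namespace TwoCycle

lemma tv_le_of_unif {V : Type*} [Fintype V] {μ π : V → ℝ} (hpos : ∀ y, 0 < π y)
    (hsum : ∑ y, π y = 1) (h : ∀ y, |μ y / π y - 1| ≤ 1 / 4) :
    1 / 2 * ∑ y, |μ y - π y| ≤ 1 / 4 := by
  have : ∑ y, |μ y - π y| ≤ ∑ y, 1 / 4 * π y := Finset.sum_le_sum fun y _ => by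
    have e : μ y - π y = (μ y / π y - 1) * π y := by
      have := (hpos y).ne'
      field_simp
    rw [e, abs_mul, abs_of_pos (hpos y)]
    exact mul_le_mul_of_nonneg_right (h y) (hpos y).le
  rw [← Finset.mul_sum, hsum] at this
  linarith

lemma IsStat.pos {n : ℕ} (h4 : 4 ∣ n) (hn : 4 ≤ n) {π : TwoCycleState n → ℝ}
    (hπ : IsStat n π) (y : TwoCycleState n) : 0 < π y :=
  lt_of_lt_of_le (by positivity) (hπ.bounds h4 hn y).1

/-- The chain started at `o` is not mixed at time zero. -/
lemma IsStat.one_le_of_mixed {n : ℕ} (h4 : 4 ∣ n) (hn : 4 ≤ n) {π : TwoCycleState n → ℝ}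
    (hπ : IsStat n π) {t : ℕ}
    (h : 1 / 2 * ∑ y, |(tcP n ^ t) (oo n) y - π y| ≤ 1 / 4) : 1 ≤ t := by
  by_contra! h0
  obtain rfl : t = 0 := by omega
  have h1 := Finset.single_le_sum (f := fun y => |(tcP n ^ 0) (oo n) y - π y|)
    (fun y _ => abs_nonneg _) (Finset.mem_univ (oo n))
  have h2 : |(tcP n ^ 0) (oo n) (oo n) - π (oo n)| ≤ 1 / 2 := by linarith
  rw [pow_zero, Matrix.one_apply_eq] at h2
  have h3 : π (oo n) ≤ 1 / n := (hπ.bounds h4 hn (oo n)).2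
  have h4' : (1 : ℝ) / n ≤ 1 / 4 := by
    apply one_div_le_one_div_of_le (by norm_num)
    exact_mod_cast hn
  linarith [le_abs_self (1 - π (oo n))]

lemma exists_mix_lower : ∃ c : ℝ, 0 < c ∧ ∀ n : ℕ, 4 ∣ n → 4 ≤ n →
    ∀ π : TwoCycleState n → ℝ, IsStat n π → ∀ t : ℕ,
      1 / 2 * ∑ y, |(tcP n ^ t) (oo n) y - π y| ≤ 1 / 4 → c * (n : ℝ) ^ (3 / 2 : ℝ) ≤ t := by
  refine ⟨1 / 10 ^ 27, by positivity, fun n h4 hn π hπ t ht => ?_⟩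
  rcases le_total (10 ^ 18) n with h | h
  · refine le_trans ?_ (hπ.mix_lower h4 h ht)
    gcongr <;> norm_num
  · have h1 : (1 : ℝ) ≤ t := by exact_mod_cast hπ.one_le_of_mixed h4 hn ht
    have h2 : (n : ℝ) ^ (3 / 2 : ℝ) ≤ ((10 : ℝ) ^ (18 : ℝ)) ^ (3 / 2 : ℝ) := by
      gcongr
      rw [show (18 : ℝ) = (18 : ℕ) by norm_num, Real.rpow_natCast]
      exact_mod_cast h
    rw [← Real.rpow_mul (by norm_num), show (18 : ℝ) * (3 / 2) = (27 : ℕ) by norm_num,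
      Real.rpow_natCast] at h2
    linarith

lemma exists_unif_upper_all : ∃ C : ℝ, 0 < C ∧ ∀ n : ℕ, 4 ∣ n → 4 ≤ n →
    ∀ π : TwoCycleState n → ℝ, IsStat n π → ∃ t : ℕ, (t : ℝ) ≤ C * (n : ℝ) ^ (3 / 2 : ℝ) ∧
      ∀ x y, |(tcP n ^ t) x y / π y - 1| ≤ 1 / 4 := by
  obtain ⟨L, hL, h⟩ := exists_unif_upper
  generalize 10 ^ 18 = N at h
  have hB : ∀ n : ℕ, ∃ t : ℕ, 4 ∣ n → 4 ≤ n → ∀ π : TwoCycleState n → ℝ, IsStat n π →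
      ∀ x y, |(tcP n ^ t) x y / π y - 1| ≤ 1 / 4 := fun n => by
    by_cases hn : 4 ∣ n ∧ 4 ≤ n
    · obtain ⟨t, ht⟩ := exists_unif_time hn.1 hn.2
      exact ⟨t, fun _ _ => ht⟩
    · exact ⟨0, fun h4 h5 => absurd ⟨h4, h5⟩ hn⟩
  choose B hB using hB
  have hS : (0 : ℝ) ≤ ∑ m ∈ Finset.range N, (B m : ℝ) := by positivity
  refine ⟨L + ∑ m ∈ Finset.range N, (B m : ℝ), by linarith, fun n h4 hn π hπ => ?_⟩
  have hn1 : (1 : ℝ) ≤ n := by exact_mod_cast (by omega : 1 ≤ n)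
  have hp : 1 ≤ (n : ℝ) ^ (3 / 2 : ℝ) := Real.one_le_rpow hn1 (by norm_num)
  rcases le_or_gt N n with hNn | hNn
  · obtain ⟨t, ht, hu⟩ := h n h4 hNn π hπ
    refine ⟨t, ht.trans ?_, hu⟩
    gcongr
    linarith
  · refine ⟨B n, ?_, hB n h4 hn π hπ⟩
    have h1 : (B n : ℝ) ≤ ∑ m ∈ Finset.range N, (B m : ℝ) :=
      Finset.single_le_sum (f := fun m => (B m : ℝ)) (fun m _ => Nat.cast_nonneg _)
        (Finset.mem_range.2 hNn)
    nlinarith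

end TwoCycle

/-- There are positive constants `c1, c2` such that for every `n` divisible
by `4`, the two-cycle chain with golden-ratio laziness satisfies
`c1·n^{3/2} ≤ t_mix ≤ t_unif ≤ c2·n^{3/2}` with respect to its (unique) stationary
distribution `π`. -/
theorem twoCycle_mixing_sensitivity :
    ∃ c1 c2 : ℝ, 0 < c1 ∧ 0 < c2 ∧
      ∀ n : ℕ, 0 < n → 4 ∣ n →
        ∀ π : TwoCycleState n → ℝ,
          (∀ v, 0 ≤ π v) → (∑ v, π v = 1) →
          (∀ y, ∑ x, π x * tcP n x y = π y) →
          c1 * (n : ℝ) ^ ((3 : ℝ) / 2) ≤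
            (sInf {t : ℕ | ∀ x, (1 / 2) * ∑ y, |(tcP n ^ t) x y - π y| ≤ 1 / 4} : ℕ) ∧
          sInf {t : ℕ | ∀ x, (1 / 2) * ∑ y, |(tcP n ^ t) x y - π y| ≤ 1 / 4} ≤
            sInf {t : ℕ | ∀ x y, |(tcP n ^ t) x y / π y - 1| ≤ 1 / 4} ∧
          ((sInf {t : ℕ | ∀ x y, |(tcP n ^ t) x y / π y - 1| ≤ 1 / 4} : ℕ) : ℝ) ≤
            c2 * (n : ℝ) ^ ((3 : ℝ) / 2) := by
  obtain ⟨c1, hc1, hlow⟩ := TwoCycle.exists_mix_lower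
  obtain ⟨c2, hc2, hup⟩ := TwoCycle.exists_unif_upper_all
  refine ⟨c1, c2, hc1, hc2, fun n hn0 h4 π h0 h1 hst => ?_⟩
  have hn : 4 ≤ n := Nat.le_of_dvd hn0 h4
  have hπ : TwoCycle.IsStat n π := ⟨h0, h1, hst⟩
  obtain ⟨t, ht, hu⟩ := hup n h4 hn π hπ
  set U := {t : ℕ | ∀ x y, |(tcP n ^ t) x y / π y - 1| ≤ 1 / 4}
  set M := {t : ℕ | ∀ x, (1 / 2) * ∑ y, |(tcP n ^ t) x y - π y| ≤ 1 / 4}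
  have hUM : U ⊆ M := fun s hs x => TwoCycle.tv_le_of_unif (hπ.pos h4 hn) h1 (hs x)
  have hU : t ∈ U := hu
  have hMmem : sInf M ∈ M := Nat.sInf_mem ⟨t, hUM hU⟩
  refine ⟨hlow n h4 hn π hπ _ (hMmem _), Nat.sInf_le (hUM (Nat.sInf_mem ⟨t, hU⟩)), ?_⟩
  exact le_trans (by exact_mod_cast Nat.sInf_le hU) ht
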